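/- Let d ≥ 1, α ∈ (1,2), let b : ℝ^d → ℝ^d be measurable with |b| in the Kato class K_{d,α−1}, and let q^b(t,x,y) be the fundamental solution from the perturbation construction, extended to all t > 0 by Chapman–Kolmogorov. Define T_t^b f(x) := ∫_{ℝ^d} q^b(t,x,y) f(y) dy. Then for all f, g ∈ C_c^∞(ℝ^d), lim_{t↓0} (1/t) ∫_{ℝ^d} ( T_t^b f(x) − f(x) ) g(x) dx = ∫_{ℝ^d} ( Δ^{α/2} f(x) + b(x)·∇f(x) ) g(x) dx. -/

import Mathlib

open MeasureTheory Filter Topology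
open scoped ENNReal NNReal RealInnerProductSpace BigOperators

/-- The Kato-class quantity `M_f^α(r) = sup_x ∫_{B(x,r)} |f(y)| |x-y|^{-(d+1-α)} dy`. -/
noncomputable def katoSup (d : ℕ) (α : ℝ) (f : EuclideanSpace ℝ (Fin d) → ℝ) (r : ℝ) : ℝ≥0∞ :=
  ⨆ x : EuclideanSpace ℝ (Fin d),
    ∫⁻ y in Metric.ball x r, ENNReal.ofReal (|f y| * ‖x - y‖ ^ (-((d : ℝ) + 1 - α)))

/-- `p(t,x) = (2π)^{-d} ∫ e^{-iξ·x} e^{-t|ξ|^α} dξ` (real part of the complex integral). -/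
noncomputable def stableP (d : ℕ) (α : ℝ) (t : ℝ) (x : EuclideanSpace ℝ (Fin d)) : ℝ :=
  ((((2 * Real.pi) ^ (-(d : ℝ)) : ℝ) : ℂ) *
    ∫ ξ : EuclideanSpace ℝ (Fin d),
      Complex.exp (-Complex.I * ((⟪ξ, x⟫ : ℝ) : ℂ)) *
        Complex.exp (-(t : ℂ) * ((‖ξ‖ ^ α : ℝ) : ℂ))).re

/-- The terms of the perturbation series. -/
noncomputable def qSeries (d : ℕ) (α : ℝ)
    (b : EuclideanSpace ℝ (Fin d) → EuclideanSpace ℝ (Fin d)) :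
    ℕ → ℝ → EuclideanSpace ℝ (Fin d) → EuclideanSpace ℝ (Fin d) → ℝ
  | 0, t, x, y => stableP d α t (x - y)
  | k + 1, t, x, y =>
      ∫ s in Set.Ioc (0 : ℝ) t, ∫ z,
        qSeries d α b k s x z * ⟪b z, gradient (fun w => stableP d α (t - s) (w - y)) z⟫

/-- The comparison function `t^{-d/α} ∧ t|x-y|^{-(d+α)}`, valued in `[0,∞]`. -/
noncomputable def heatBnd (d : ℕ) (α : ℝ) (t : ℝ) (x y : EuclideanSpace ℝ (Fin d)) : ℝ≥0∞ :=
  min (ENNReal.ofReal t ^ (-(d : ℝ) / α)) (ENNReal.ofReal t * (‖x - y‖₊ : ℝ≥0∞) ^ (-((d : ℝ) + α)))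

/-- The normalizing constant `A(d,-α)`. -/
noncomputable def stableConst (d : ℕ) (α : ℝ) : ℝ :=
  α * 2 ^ (α - 1) * Real.pi ^ (-(d : ℝ) / 2) * Real.Gamma (((d : ℝ) + α) / 2) /
    Real.Gamma (1 - α / 2)

/-- The fractional Laplacian
`Δ^{α/2}u(x) = ∫ (u(x+z) - u(x) - ∇u(x)·z 1_{|z|≤1}) A(d,-α)|z|^{-(d+α)} dz`. -/
noncomputable def fracLap (d : ℕ) (α : ℝ) (u : EuclideanSpace ℝ (Fin d) → ℝ)
    (x : EuclideanSpace ℝ (Fin d)) : ℝ :=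
  ∫ z, (u (x + z) - u x - (if ‖z‖ ≤ 1 then ⟪gradient u x, z⟫ else 0)) *
    (stableConst d α * ‖z‖ ^ (-((d : ℝ) + α)))

namespace S15

lemma one_sub_exp_le {x : ℝ} : 1 - Real.exp (-x) ≤ x := by
  have := Real.add_one_le_exp (-x); linarith

lemma levy_integrableOn {β : ℝ} (hβ0 : 0 < β) (hβ1 : β < 1) {l : ℝ} (hl : 0 < l) :
    IntegrableOn (fun u : ℝ => (1 - Real.exp (-(l * u))) * u ^ (-1 - β)) (Set.Ioi 0) := by
  have hm : Measurable (fun u : ℝ => (1 - Real.exp (-(l * u))) * u ^ (-1 - β)) := by fun_prop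
  rw [← Set.Ioc_union_Ioi_eq_Ioi (zero_le_one' ℝ)]
  refine IntegrableOn.union ?_ ?_
  · have h1 : IntegrableOn (fun u : ℝ => l * u ^ (-β)) (Set.Ioc 0 1) := by
      have := (intervalIntegral.intervalIntegrable_rpow' (a := 0) (b := 1) (r := -β) (by linarith)).const_mul l
      rwa [intervalIntegrable_iff_integrableOn_Ioc_of_le zero_le_one] at this
    refine h1.mono' hm.aestronglyMeasurable ?_
    refine (ae_restrict_iff' measurableSet_Ioc).2 (ae_of_all _ fun u hu => ?_)
    have hu0 : 0 < u := hu.1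
    have e1 : 0 ≤ 1 - Real.exp (-(l * u)) := by
      have : Real.exp (-(l*u)) ≤ 1 := Real.exp_le_one_iff.2 (by nlinarith)
      linarith
    rw [Real.norm_of_nonneg (mul_nonneg e1 (Real.rpow_nonneg hu0.le _))]
    calc _ ≤ (l * u) * u ^ (-1 - β) := by
          gcongr; exact one_sub_exp_le
      _ = l * (u ^ (1:ℝ) * u ^ (-1 - β)) := by rw [Real.rpow_one]; ring
      _ = _ := by rw [← Real.rpow_add hu0]; ring_nf
  · have h1 : IntegrableOn (fun u : ℝ => u ^ (-1 - β)) (Set.Ioi 1) :=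
      integrableOn_Ioi_rpow_of_lt (by linarith) zero_lt_one
    refine h1.mono' hm.aestronglyMeasurable ?_
    refine (ae_restrict_iff' measurableSet_Ioi).2 (ae_of_all _ fun u hu => ?_)
    have hu0 : 0 < u := lt_trans zero_lt_one hu
    have e1 : 0 ≤ 1 - Real.exp (-(l * u)) := by
      have : Real.exp (-(l*u)) ≤ 1 := Real.exp_le_one_iff.2 (by nlinarith)
      linarith
    rw [Real.norm_of_nonneg (mul_nonneg e1 (Real.rpow_nonneg hu0.le _))]
    have : 1 - Real.exp (-(l * u)) ≤ 1 := by linarith [Real.exp_pos (-(l*u))]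
    have h2 := Real.rpow_nonneg hu0.le (-1 - β)
    nlinarith

lemma levy_integral {β : ℝ} (hβ0 : 0 < β) (hβ1 : β < 1) {l : ℝ} (hl : 0 < l) :
    ∫ u in Set.Ioi (0:ℝ), (1 - Real.exp (-(l * u))) * u ^ (-1 - β)
      = Real.Gamma (1 - β) / β * l ^ β := by
  have hI1 := levy_integrableOn hβ0 hβ1 hl
  have hG := Real.integral_rpow_mul_exp_neg_mul_Ioi (a := 1 - β) (r := l) (by linarith) hl
  have hI2 : IntegrableOn (fun u : ℝ => u ^ (1 - β - 1) * Real.exp (-(l * u))) (Set.Ioi 0) := by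
    by_contra h
    rw [integral_undef h] at hG
    have := Real.Gamma_pos_of_pos (s := 1 - β) (by linarith)
    have : 0 < (1 / l) ^ (1 - β) * Real.Gamma (1 - β) := by positivity
    linarith
  have hI3 := hI2.const_mul (l / β)
  have key : ∫ u in Set.Ioi (0:ℝ), ((1 - Real.exp (-(l * u))) * u ^ (-1 - β)
      - l / β * (u ^ (1 - β - 1) * Real.exp (-(l * u)))) = 0 - 0 := by
    have hF0 : (fun u : ℝ => -(1 - Real.exp (-(l * u))) * u ^ (-β) / β) 0 = 0 := by simp
    refine integral_Ioi_of_hasDerivAt_of_tendsto (f := fun u : ℝ => -(1 - Real.exp (-(l * u))) * u ^ (-β) / β) (m := 0)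
      ?_ ?_ (hI1.sub hI3) ?_ |>.trans ?_
    · rw [← continuousWithinAt_Ioi_iff_Ici]
      unfold ContinuousWithinAt
      rw [hF0]
      refine squeeze_zero_norm' (a := fun u : ℝ => l / β * u ^ (1 - β)) ?_ ?_
      · filter_upwards [self_mem_nhdsWithin] with u (hu : 0 < u)
        have e1 : 0 ≤ 1 - Real.exp (-(l * u)) := by
          have : Real.exp (-(l*u)) ≤ 1 := Real.exp_le_one_iff.2 (by nlinarith)
          linarith
        rw [neg_mul, neg_div, norm_neg, Real.norm_of_nonneg (div_nonneg (mul_nonneg e1 (Real.rpow_nonneg hu.le _)) hβ0.le)]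
        calc _ ≤ (l * u) * u ^ (-β) / β := by
              gcongr; exact one_sub_exp_le
          _ = l / β * (u ^ (1:ℝ) * u ^ (-β)) := by rw [Real.rpow_one]; ring
          _ = _ := by rw [← Real.rpow_add hu]; ring_nf
      · have : Tendsto (fun u : ℝ => l / β * u ^ (1 - β)) (𝓝 0) (𝓝 (l / β * 0 ^ (1 - β))) :=
          ((Real.continuousAt_rpow_const 0 (1-β) (Or.inr (by linarith))).tendsto).const_mul _
        rw [Real.zero_rpow (by linarith), mul_zero] at this
        exact this.mono_left nhdsWithin_le_nhds
    · intro u (hu : 0 < u)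
      have h1 : HasDerivAt (fun u : ℝ => Real.exp (-(l * u))) (Real.exp (-(l*u)) * (-(l * 1))) u :=
        (((hasDerivAt_id u).const_mul l).neg).exp
      have h2 := Real.hasDerivAt_rpow_const (x := u) (p := -β) (Or.inl hu.ne')
      have := (((h1.const_sub 1).neg).mul h2).div_const β
      refine this.congr_deriv ?_
      have e : u ^ (1 - β - 1) = u ^ (-β) := by ring_nf
      have e2 : u ^ (-β - 1) = u ^ (-1 - β) := by ring_nf
      simp only [Pi.sub_apply, Pi.neg_apply]
      rw [e, e2]; field_simp; ring
    · refine squeeze_zero_norm' (a := fun u : ℝ => 1 / β * u ^ (-β)) ?_ ?_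
      · filter_upwards [eventually_gt_atTop 0] with u hu
        have e1 : 0 ≤ 1 - Real.exp (-(l * u)) := by
          have : Real.exp (-(l*u)) ≤ 1 := Real.exp_le_one_iff.2 (by nlinarith)
          linarith
        rw [neg_mul, neg_div, norm_neg, Real.norm_of_nonneg (div_nonneg (mul_nonneg e1 (Real.rpow_nonneg hu.le _)) hβ0.le)]
        calc _ ≤ 1 * u ^ (-β) / β := by
              gcongr; linarith [Real.exp_pos (-(l*u))]
          _ = _ := by ring
      · simpa using (tendsto_rpow_neg_atTop hβ0).const_mul (1/β)
    · simp
  rw [integral_sub hI1 hI3, sub_self, sub_eq_zero] at key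
  rw [key, integral_const_mul, hG, one_div, Real.inv_rpow hl.le, ← Real.rpow_neg hl.le]
  have : l ^ β = l * l ^ (-(1 - β)) := by
    nth_rewrite 2 [← Real.rpow_one l]
    rw [← Real.rpow_add hl]; ring_nf
  rw [this]; ring

end S15

namespace S15

lemma pareto_laplace {β : ℝ} (hβ0 : 0 < β) {l : ℝ} (hl : 0 < l) {t : ℝ} (ht : 0 < t) :
    ∫ x, Real.exp (-(l * max x 0)) ∂(ProbabilityTheory.paretoMeasure t β)
      = 1 + -(β * t ^ β * ∫ x in Set.Ioi t, (1 - Real.exp (-(l * x))) * x ^ (-1 - β)) := by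
  have := ProbabilityTheory.isProbabilityMeasure_paretoMeasure ht hβ0
  have hInt0 : Integrable (fun x : ℝ => Real.exp (-(l * max x 0))) (ProbabilityTheory.paretoMeasure t β) := by
    refine Integrable.of_bound (C := 1) (by fun_prop) (ae_of_all _ fun x => ?_)
    rw [Real.norm_of_nonneg (Real.exp_pos _).le]
    have : 0 ≤ l * max x 0 := by positivity
    exact Real.exp_le_one_iff.2 (by linarith)
  have h1 : ∫ x, (1 - Real.exp (-(l * max x 0))) ∂(ProbabilityTheory.paretoMeasure t β)
      = 1 - ∫ x, Real.exp (-(l * max x 0)) ∂(ProbabilityTheory.paretoMeasure t β) := by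
    rw [integral_sub (integrable_const _) hInt0]; simp
  have h2 : ∫ x, (1 - Real.exp (-(l * max x 0))) ∂(ProbabilityTheory.paretoMeasure t β)
      = β * t ^ β * ∫ x in Set.Ioi t, (1 - Real.exp (-(l * x))) * x ^ (-1 - β) := by
    rw [ProbabilityTheory.paretoMeasure, integral_withDensity_eq_integral_toReal_smul
      (f := ProbabilityTheory.paretoPDF t β)
      ((ProbabilityTheory.measurable_paretoPDFReal t β).ennreal_ofReal)
      (ae_of_all _ fun x => by simp [ProbabilityTheory.paretoPDF])]
    rw [← integral_const_mul, ← integral_Ici_eq_integral_Ioi, ← integral_indicator measurableSet_Ici]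
    congr 1; ext x
    by_cases hx : t ≤ x
    · have hx0 : 0 < x := lt_of_lt_of_le ht hx
      rw [ProbabilityTheory.paretoPDF_of_le hx, Set.indicator_of_mem (by exact hx), max_eq_left hx0.le,
        ENNReal.toReal_ofReal (by positivity), smul_eq_mul]
      have : -(β + 1) = -1 - β := by ring
      rw [this]; ring
    · rw [ProbabilityTheory.paretoPDF_of_lt (not_le.1 hx), Set.indicator_of_notMem (by exact hx)]; simp
  linarith

lemma pareto_limit {β : ℝ} (hβ0 : 0 < β) (hβ1 : β < 1) {l : ℝ} (hl : 0 < l) :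
    Tendsto (fun n : ℕ => (∫ x, Real.exp (-(l * max x 0))
      ∂(ProbabilityTheory.paretoMeasure ((n : ℝ) ^ (-(1/β))) β)) ^ n) atTop
      (𝓝 (Real.exp (-(Real.Gamma (1 - β) * l ^ β)))) := by
  have h := Real.tendsto_one_add_pow_exp_of_tendsto
    (g := fun n : ℕ => -(β * ((n : ℝ) ^ (-(1/β))) ^ β * ∫ x in Set.Ioi ((n : ℝ) ^ (-(1/β))), (1 - Real.exp (-(l * x))) * x ^ (-1 - β)))
    (t := -(Real.Gamma (1 - β) * l ^ β)) ?_
  · refine h.congr' ?_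
    filter_upwards [eventually_gt_atTop 0] with n hn
    rw [pareto_laplace hβ0 hl (by positivity)]
  · have h0 : Tendsto (fun n : ℕ => ((n : ℝ) ^ (-(1/β)))) atTop (𝓝 0) :=
      (tendsto_rpow_neg_atTop (by positivity)).comp tendsto_natCast_atTop_atTop
    have h1 := (aecover_Ioi_of_Ioi (μ := volume) h0).integral_tendsto_of_countably_generated
      (levy_integrableOn hβ0 hβ1 hl)
    rw [levy_integral hβ0 hβ1 hl] at h1
    have h2 := (h1.const_mul β).neg
    have e : β * (Real.Gamma (1 - β) / β * l ^ β) = Real.Gamma (1 - β) * l ^ β := by field_simp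
    rw [e] at h2
    refine h2.congr' ?_
    filter_upwards [eventually_gt_atTop 0] with n hn
    have hn' : (0:ℝ) < n := by exact_mod_cast hn
    have e1 : ((n : ℝ) ^ (-(1/β))) ^ β = (n : ℝ)⁻¹ := by
      rw [← Real.rpow_mul hn'.le]
      have : -(1/β) * β = -1 := by field_simp
      rw [this, Real.rpow_neg_one]
    rw [e1, Measure.restrict_restrict measurableSet_Ioi, Set.inter_eq_left.2]
    · field_simp
    · intro x hx
      exact lt_trans (show (0:ℝ) < (n:ℝ) ^ (-(1/β)) by positivity) hx

lemma exists_unit_measure {β : ℝ} (hβ0 : 0 < β) (hβ1 : β < 1) :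
    ∃ μ : ProbabilityMeasure unitInterval, ∀ l : ℝ, 0 < l →
      ∫ u : unitInterval, (u : ℝ) ^ l ∂(μ : Measure unitInterval) = Real.exp (-(Real.Gamma (1 - β) * l ^ β)) := by
  classical
  let F (n : ℕ) (x : Fin n → ℝ) : unitInterval :=
    ⟨Real.exp (-(∑ i, max (x i) 0)), ⟨(Real.exp_pos _).le, Real.exp_le_one_iff.2 (by
      have : 0 ≤ ∑ i, max (x i) 0 := Finset.sum_nonneg fun i _ => le_max_right _ _
      linarith)⟩⟩
  have hF : ∀ n, Measurable (F n) := fun n => Measurable.subtype_mk (by fun_prop)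
  have hpar : ∀ n : ℕ, IsProbabilityMeasure (ProbabilityTheory.paretoMeasure (((n + 1 : ℕ) : ℝ) ^ (-(1/β))) β) :=
    fun n => ProbabilityTheory.isProbabilityMeasure_paretoMeasure (by positivity) hβ0
  let m (n : ℕ) : ProbabilityMeasure unitInterval :=
    ⟨(Measure.pi fun _ : Fin (n+1) => ProbabilityTheory.paretoMeasure (((n + 1 : ℕ) : ℝ) ^ (-(1/β))) β).map (F (n+1)),
      Measure.isProbabilityMeasure_map (hF _).aemeasurable⟩
  refine ⟨((hyperfilter ℕ).map m).lim, fun l hl => ?_⟩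
  have h1 : Tendsto m (hyperfilter ℕ : Filter ℕ) (𝓝 ((hyperfilter ℕ).map m).lim) :=
    Ultrafilter.le_nhds_lim ((hyperfilter ℕ).map m)
  rw [ProbabilityMeasure.tendsto_iff_forall_integral_tendsto] at h1
  have hc : Continuous (fun u : unitInterval => (u : ℝ) ^ l) :=
    (Real.continuous_rpow_const hl.le).comp continuous_subtype_val
  have h2 := h1 (BoundedContinuousFunction.mkOfCompact ⟨_, hc⟩)
  simp only [BoundedContinuousFunction.mkOfCompact_apply, ContinuousMap.coe_mk] at h2
  refine tendsto_nhds_unique h2 ?_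
  have h3 := ((tendsto_add_atTop_iff_nat 1).2 (pareto_limit hβ0 hβ1 hl)).mono_left Nat.hyperfilter_le_atTop
  refine h3.congr fun n => ?_
  change _ = ∫ u, (u:ℝ) ^ l ∂((Measure.pi fun _ : Fin (n+1) => ProbabilityTheory.paretoMeasure (((n + 1 : ℕ) : ℝ) ^ (-(1/β))) β).map (F (n+1)))
  rw [integral_map (hF _).aemeasurable hc.measurable.aestronglyMeasurable]
  have e : ∀ x : Fin (n+1) → ℝ, ((F (n+1) x : unitInterval) : ℝ) ^ l = ∏ i, Real.exp (-(l * max (x i) 0)) := by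
    intro x
    change (Real.exp _) ^ l = _
    rw [← Real.exp_mul, ← Real.exp_sum, Finset.sum_neg_distrib, ← Finset.mul_sum]
    ring_nf
  simp_rw [e]
  rw [integral_fintype_prod_eq_pow (𝕜 := ℝ) (fun x : ℝ => Real.exp (-(l * max x 0)))]
  simp

/-- Existence of the one-sided stable law. -/
lemma exists_subordinator {β : ℝ} (hβ0 : 0 < β) (hβ1 : β < 1) :
    ∃ η : Measure ℝ, IsProbabilityMeasure η ∧ (∀ᵐ s ∂η, 0 < s) ∧ ∀ l : ℝ, 0 < l →
      ∫ s, Real.exp (-(l * s)) ∂η = Real.exp (-(l ^ β)) := by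
  obtain ⟨μ, hμ⟩ := exists_unit_measure hβ0 hβ1
  set c := Real.Gamma (1 - β) with hc
  have hcpos : 0 < c := Real.Gamma_pos_of_pos (by linarith)
  have hInt0 : ∀ l : ℝ, 0 < l → Integrable (fun u : unitInterval => (u : ℝ) ^ l) (μ : Measure unitInterval) := by
    intro l hl
    have hcc : Continuous (fun u : unitInterval => (u : ℝ) ^ l) :=
      (Real.continuous_rpow_const hl.le).comp continuous_subtype_val
    exact hcc.integrable_of_hasCompactSupport (HasCompactSupport.of_compactSpace _)
  -- no atoms at the endpoints
  have h0 : (μ : Measure unitInterval) {0} = 0 := by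
    have hle : ∀ l : ℝ, 0 < l → (μ : Measure unitInterval).real {0} ≤ 1 - Real.exp (-(c * l ^ β)) := by
      intro l hl
      rw [← hμ l hl]
      have e1 : (1:ℝ) - ∫ u : unitInterval, (u : ℝ) ^ l ∂(μ : Measure unitInterval)
          = ∫ u : unitInterval, (1 - (u : ℝ) ^ l) ∂(μ : Measure unitInterval) := by
        rw [integral_sub (integrable_const _) (hInt0 l hl)]; simp
      rw [e1, ← integral_indicator_one (measurableSet_singleton _)]
      refine integral_mono ((integrable_const _).indicator (measurableSet_singleton _)) ((integrable_const _).sub (hInt0 l hl)) fun u => ?_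
      by_cases hu : u = 0
      · subst hu; simp [hl.ne']
      · simp [hu, Real.rpow_le_one u.2.1 u.2.2 hl.le]
    have ht : Tendsto (fun l : ℝ => 1 - Real.exp (-(c * l ^ β))) (𝓝[>] 0) (𝓝 (1 - Real.exp (-(c * 0 ^ β)))) := by
      refine Tendsto.mono_left ?_ nhdsWithin_le_nhds
      have := (Real.continuous_rpow_const (q := β) hβ0.le).tendsto 0
      exact tendsto_const_nhds.sub ((Real.continuous_exp.tendsto _).comp ((this.const_mul c).neg))
    rw [Real.zero_rpow hβ0.ne'] at ht
    simp only [mul_zero, neg_zero, Real.exp_zero, sub_self] at ht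
    have := ge_of_tendsto ht (by filter_upwards [self_mem_nhdsWithin] with l hl using hle l hl)
    have h' : (μ : Measure unitInterval).real {0} = 0 := le_antisymm this measureReal_nonneg
    rwa [measureReal_eq_zero_iff] at h'
  have h1 : (μ : Measure unitInterval) {1} = 0 := by
    have hle : ∀ l : ℝ, 0 < l → (μ : Measure unitInterval).real {1} ≤ Real.exp (-(c * l ^ β)) := by
      intro l hl
      rw [← hμ l hl, ← integral_indicator_one (measurableSet_singleton _)]
      refine integral_mono ((integrable_const _).indicator (measurableSet_singleton _)) (hInt0 l hl) fun u => ?_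
      by_cases hu : u = 1
      · subst hu; simp
      · simp [hu, Real.rpow_nonneg u.2.1]
    have ht : Tendsto (fun l : ℝ => Real.exp (-(c * l ^ β))) atTop (𝓝 0) := by
      refine Real.tendsto_exp_neg_atTop_nhds_zero.comp ?_
      exact (tendsto_rpow_atTop hβ0).const_mul_atTop hcpos
    have := ge_of_tendsto ht (by filter_upwards [eventually_gt_atTop 0] with l hl using hle l hl)
    have h' : (μ : Measure unitInterval).real {1} = 0 := le_antisymm this measureReal_nonneg
    rwa [measureReal_eq_zero_iff] at h'
  have hae : ∀ᵐ u : unitInterval ∂(μ : Measure unitInterval), 0 < (u : ℝ) ∧ (u:ℝ) < 1 := by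
    have a0 : ∀ᵐ u ∂(μ : Measure unitInterval), u ≠ 0 := by
      rw [ae_iff]; simpa using h0
    have a1 : ∀ᵐ u ∂(μ : Measure unitInterval), u ≠ 1 := by
      rw [ae_iff]; simpa using h1
    filter_upwards [a0, a1] with u hu0 hu1
    refine ⟨lt_of_le_of_ne u.2.1 fun h => hu0 (Subtype.ext h.symm), lt_of_le_of_ne u.2.2 fun h => hu1 (Subtype.ext h)⟩
  let G : unitInterval → ℝ := fun u => -Real.log u * c ^ (-(1/β))
  have hG : Measurable G := by
    have : Measurable (fun u : unitInterval => (u:ℝ)) := measurable_subtype_coe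
    exact (Real.measurable_log.comp this).neg.mul_const _
  refine ⟨Measure.map G (μ : Measure unitInterval), Measure.isProbabilityMeasure_map hG.aemeasurable, ?_, ?_⟩
  · refine (ae_map_iff (p := fun s : ℝ => 0 < s) hG.aemeasurable measurableSet_Ioi).2 ?_
    filter_upwards [hae] with u hu
    have := Real.log_neg hu.1 hu.2
    have h2 : 0 < c ^ (-(1/β)) := by positivity
    change 0 < -Real.log u * c ^ (-(1/β))
    nlinarith [mul_pos (neg_pos.2 this) h2]
  · intro l hl
    rw [integral_map hG.aemeasurable (by fun_prop)]
    have h2 : 0 < c ^ (-(1/β)) := by positivity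
    have := hμ (l * c ^ (-(1/β))) (by positivity)
    rw [Real.mul_rpow hl.le h2.le, ← Real.rpow_mul hcpos.le] at this
    have e : -(1/β) * β = -1 := by field_simp
    rw [e, Real.rpow_neg_one] at this
    have e3 : c * (l ^ β * c⁻¹) = l ^ β := by field_simp
    rw [e3] at this
    rw [← this]
    refine integral_congr_ae ?_
    filter_upwards [hae] with u hu
    rw [Real.rpow_def_of_pos hu.1]
    congr 1
    change -(l * (-Real.log u * c ^ (-(1/β)))) = _
    ring

end S15

namespace S15

/-- `η` is the one-sided `β`-stable law. -/
structure IsSub (β : ℝ) (η : Measure ℝ) : Prop where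
  prob : IsProbabilityMeasure η
  pos : ∀ᵐ s ∂η, 0 < s
  lap : ∀ l : ℝ, 0 < l → ∫ s, Real.exp (-(l * s)) ∂η = Real.exp (-(l ^ β))

lemma IsSub.lapInt {β : ℝ} {η : Measure ℝ} (h : IsSub β η) {l : ℝ} (hl : 0 < l) :
    Integrable (fun s => Real.exp (-(l * s))) η := by
  have := h.prob
  refine Integrable.of_bound (C := 1) (by fun_prop) ?_
  filter_upwards [h.pos] with s hs
  rw [Real.norm_of_nonneg (Real.exp_pos _).le]
  exact Real.exp_le_one_iff.2 (by nlinarith)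

lemma IsSub.lapL {β : ℝ} {η : Measure ℝ} (h : IsSub β η) {l : ℝ} (hl : 0 < l) :
    ∫⁻ s, ENNReal.ofReal (Real.exp (-(l * s))) ∂η = ENNReal.ofReal (Real.exp (-(l ^ β))) := by
  rw [← h.lap l hl, ofReal_integral_eq_lintegral_ofReal (h.lapInt hl) (ae_of_all _ fun s => (Real.exp_pos _).le)]

lemma IsSub.mom_neg {β : ℝ} (hβ0 : 0 < β) {η : Measure ℝ} (h : IsSub β η) {m : ℝ} (hm : 0 < m) :
    Integrable (fun s : ℝ => s ^ (-m)) η := by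
  have := h.prob
  have hfin : ∫⁻ s, (∫⁻ l in Set.Ioi (0:ℝ), ENNReal.ofReal (l ^ (m-1)) * ENNReal.ofReal (Real.exp (-(l * s)))) ∂η < ∞ := by
    rw [lintegral_lintegral_swap (by fun_prop)]
    have e : ∀ l ∈ Set.Ioi (0:ℝ), ∫⁻ s, ENNReal.ofReal (l ^ (m-1)) * ENNReal.ofReal (Real.exp (-(l * s))) ∂η
        = ENNReal.ofReal (l ^ (m-1) * Real.exp (-(l ^ β))) := by
      intro l hl
      rw [lintegral_const_mul _ (by fun_prop), h.lapL hl, ENNReal.ofReal_mul (Real.rpow_nonneg (le_of_lt hl) _)]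
    rw [setLIntegral_congr_fun measurableSet_Ioi e]
    have hI : IntegrableOn (fun l : ℝ => l ^ (m-1) * Real.exp (-(l ^ β))) (Set.Ioi 0) := by
      by_contra hn
      have h1 := integral_rpow_mul_exp_neg_rpow (p := β) (q := m - 1) hβ0 (by linarith)
      rw [integral_undef hn] at h1
      have := Real.Gamma_pos_of_pos (s := (m - 1 + 1)/β) (by simp; positivity)
      have : 0 < (1/β) * Real.Gamma ((m - 1 + 1)/β) := by positivity
      linarith
    exact hI.lintegral_lt_top
  have e2 : ∀ᵐ s ∂η, ∫⁻ l in Set.Ioi (0:ℝ), ENNReal.ofReal (l ^ (m-1)) * ENNReal.ofReal (Real.exp (-(l * s)))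
      = ENNReal.ofReal (s ^ (-m) * Real.Gamma m) := by
    filter_upwards [h.pos] with s hs
    have hG := Real.integral_rpow_mul_exp_neg_mul_Ioi (a := m) (r := s) hm hs
    have hI : IntegrableOn (fun u : ℝ => u ^ (m - 1) * Real.exp (-(s * u))) (Set.Ioi 0) := by
      by_contra hn
      rw [integral_undef hn] at hG
      have := Real.Gamma_pos_of_pos hm
      have : 0 < (1 / s) ^ m * Real.Gamma m := by positivity
      linarith
    have : s ^ (-m) = (1/s) ^ m := by rw [one_div, Real.inv_rpow hs.le, Real.rpow_neg hs.le]
    rw [this, ← hG, ofReal_integral_eq_lintegral_ofReal hI]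
    · refine setLIntegral_congr_fun measurableSet_Ioi fun l hl => ?_
      rw [← ENNReal.ofReal_mul (Real.rpow_nonneg (le_of_lt hl) _), mul_comm l s]
    · refine (ae_restrict_iff' measurableSet_Ioi).2 (ae_of_all _ fun l hl => ?_)
      exact mul_nonneg (Real.rpow_nonneg (le_of_lt hl) _) (Real.exp_pos _).le
  rw [lintegral_congr_ae e2] at hfin
  have hΓ := Real.Gamma_pos_of_pos hm
  have hI : Integrable (fun s : ℝ => s ^ (-m) * Real.Gamma m) η := by
    refine ⟨by fun_prop, ?_⟩
    rw [hasFiniteIntegral_iff_ofReal]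
    · exact hfin
    · filter_upwards [h.pos] with s hs
      exact mul_nonneg (Real.rpow_nonneg hs.le _) hΓ.le
  have := hI.mul_const (Real.Gamma m)⁻¹
  refine this.congr (ae_of_all _ fun s => ?_)
  simp only; field_simp

lemma IsSub.mom_half {β : ℝ} (hβ0 : 1/2 < β) {η : Measure ℝ} (h : IsSub β η) :
    Integrable (fun s : ℝ => s ^ (1/2 : ℝ)) η := by
  have := h.prob
  have hfin : ∫⁻ s, (∫⁻ l in Set.Ioi (0:ℝ), ENNReal.ofReal (l ^ (-(3/2:ℝ))) * ENNReal.ofReal (1 - Real.exp (-(l * s)))) ∂η < ∞ := by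
    rw [lintegral_lintegral_swap (by fun_prop)]
    have e : ∀ l ∈ Set.Ioi (0:ℝ), ∫⁻ s, ENNReal.ofReal (l ^ (-(3/2:ℝ))) * ENNReal.ofReal (1 - Real.exp (-(l * s))) ∂η
        = ENNReal.ofReal (l ^ (-(3/2:ℝ)) * (1 - Real.exp (-(l ^ β)))) := by
      intro l hl
      rw [lintegral_const_mul _ (by fun_prop), ENNReal.ofReal_mul (Real.rpow_nonneg (le_of_lt hl) _)]
      congr 1
      rw [← h.lap l hl, ← ofReal_integral_eq_lintegral_ofReal (f := fun s => 1 - Real.exp (-(l * s))) ((integrable_const _).sub (h.lapInt hl)), integral_sub (integrable_const _) (h.lapInt hl)]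
      · simp
      · filter_upwards [h.pos] with s hs
        have : Real.exp (-(l*s)) ≤ 1 := Real.exp_le_one_iff.2 (by nlinarith [mul_pos (show 0 < l from hl) hs])
        simp only [Pi.zero_apply]; linarith
    rw [setLIntegral_congr_fun measurableSet_Ioi e]
    have hI : IntegrableOn (fun l : ℝ => l ^ (-(3/2:ℝ)) * (1 - Real.exp (-(l ^ β)))) (Set.Ioi 0) := by
      have hm : Measurable (fun l : ℝ => l ^ (-(3/2:ℝ)) * (1 - Real.exp (-(l ^ β)))) := by fun_prop
      rw [← Set.Ioc_union_Ioi_eq_Ioi (zero_le_one' ℝ)]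
      have pos : ∀ l : ℝ, 0 < l → 0 ≤ 1 - Real.exp (-(l ^ β)) := fun l hl => by
        have : Real.exp (-(l^β)) ≤ 1 := Real.exp_le_one_iff.2 (by have := Real.rpow_nonneg hl.le β; linarith)
        linarith
      refine IntegrableOn.union ?_ ?_
      · have h1 : IntegrableOn (fun u : ℝ => u ^ (β - 3/2)) (Set.Ioc 0 1) := by
          have := (intervalIntegral.intervalIntegrable_rpow' (a := 0) (b := 1) (r := β - 3/2) (by linarith))
          rwa [intervalIntegrable_iff_integrableOn_Ioc_of_le zero_le_one] at this
        refine h1.mono' hm.aestronglyMeasurable ?_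
        refine (ae_restrict_iff' measurableSet_Ioc).2 (ae_of_all _ fun u hu => ?_)
        have hu0 : 0 < u := hu.1
        rw [Real.norm_of_nonneg (mul_nonneg (Real.rpow_nonneg hu0.le _) (pos u hu0))]
        calc _ ≤ u ^ (-(3/2:ℝ)) * u ^ β := by
              gcongr; exact one_sub_exp_le
          _ = _ := by rw [← Real.rpow_add hu0]; ring_nf
      · have h1 : IntegrableOn (fun u : ℝ => u ^ (-(3/2:ℝ))) (Set.Ioi 1) :=
          integrableOn_Ioi_rpow_of_lt (by norm_num) zero_lt_one
        refine h1.mono' hm.aestronglyMeasurable ?_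
        refine (ae_restrict_iff' measurableSet_Ioi).2 (ae_of_all _ fun u hu => ?_)
        have hu0 : 0 < u := lt_trans zero_lt_one hu
        rw [Real.norm_of_nonneg (mul_nonneg (Real.rpow_nonneg hu0.le _) (pos u hu0))]
        have h2 := Real.rpow_nonneg hu0.le (-(3/2:ℝ))
        have : 1 - Real.exp (-(u ^ β)) ≤ 1 := by linarith [Real.exp_pos (-(u^β))]
        nlinarith
    exact hI.lintegral_lt_top
  set c : ℝ := (1/2) ^ (3/2:ℝ) * (1 - Real.exp (-1)) with hc
  have hcpos : 0 < c := by
    have : Real.exp (-1) < 1 := Real.exp_lt_one_iff.2 (by norm_num)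
    have : 0 < 1 - Real.exp (-1) := by linarith
    positivity
  have e2 : ∀ᵐ s ∂η, ENNReal.ofReal (c * s ^ (1/2:ℝ)) ≤ ∫⁻ l in Set.Ioi (0:ℝ), ENNReal.ofReal (l ^ (-(3/2:ℝ))) * ENNReal.ofReal (1 - Real.exp (-(l * s))) := by
    filter_upwards [h.pos] with s hs
    have hsub : Set.Ioc (1/s) (2/s) ⊆ Set.Ioi (0:ℝ) := fun l hl => lt_trans (by positivity) hl.1
    refine le_trans ?_ (lintegral_mono_set hsub)
    have : ENNReal.ofReal (c * s ^ (1/2:ℝ)) = ∫⁻ l in Set.Ioc (1/s) (2/s), ENNReal.ofReal ((2/s) ^ (-(3/2:ℝ)) * (1 - Real.exp (-1))) := by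
      rw [setLIntegral_const, Real.volume_Ioc, ← ENNReal.ofReal_mul (by
        have : Real.exp (-1) < 1 := Real.exp_lt_one_iff.2 (by norm_num)
        have : 0 < 1 - Real.exp (-1) := by linarith
        positivity)]
      congr 1
      have e1 : (2/s) ^ (-(3/2:ℝ)) = (1/2) ^ (3/2:ℝ) * s ^ (3/2:ℝ) := by
        rw [← Real.mul_rpow (by norm_num) hs.le, Real.rpow_neg (by positivity), ← Real.inv_rpow (by positivity)]
        congr 1; field_simp
      have e3 : s ^ (3/2:ℝ) = s ^ (1/2:ℝ) * s := by
        nth_rewrite 3 [← Real.rpow_one s]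
        rw [← Real.rpow_add hs]; norm_num
      rw [e1, e3, hc]; field_simp; ring
    rw [this]
    refine setLIntegral_mono' measurableSet_Ioc fun l hl => ?_
    have hl0 : 0 < l := hsub hl
    rw [← ENNReal.ofReal_mul (Real.rpow_nonneg hl0.le _)]
    refine ENNReal.ofReal_le_ofReal ?_
    have h1 : (2/s) ^ (-(3/2:ℝ)) ≤ l ^ (-(3/2:ℝ)) := Real.rpow_le_rpow_of_nonpos hl0 hl.2 (by norm_num)
    have h2 : 1 - Real.exp (-1) ≤ 1 - Real.exp (-(l*s)) := by
      have : 1 ≤ l * s := by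
        have := hl.1.le
        rwa [div_le_iff₀ hs] at this
      have : Real.exp (-(l*s)) ≤ Real.exp (-1) := Real.exp_le_exp.2 (by linarith)
      linarith
    have h3 : 0 ≤ 1 - Real.exp (-1) := by
      have : Real.exp (-1) < 1 := Real.exp_lt_one_iff.2 (by norm_num)
      linarith
    exact mul_le_mul h1 h2 h3 (Real.rpow_nonneg hl0.le _)
  have hfin' := lt_of_le_of_lt (lintegral_mono_ae e2) hfin
  have hI : Integrable (fun s : ℝ => c * s ^ (1/2:ℝ)) η := by
    refine ⟨by fun_prop, ?_⟩
    rw [hasFiniteIntegral_iff_ofReal]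
    · exact hfin'
    · filter_upwards [h.pos] with s hs
      exact mul_nonneg hcpos.le (Real.rpow_nonneg hs.le _)
  have := hI.const_mul c⁻¹
  refine this.congr (ae_of_all _ fun s => ?_)
  simp only; field_simp

end S15

namespace S15

abbrev Ed (d : ℕ) := EuclideanSpace ℝ (Fin d)

/-- Gaussian kernel with variance parameter `v`. -/
noncomputable def gk (d : ℕ) (v : ℝ) (x : Ed d) : ℝ :=
  (4 * Real.pi * v) ^ (-(d:ℝ)/2) * Real.exp (-(‖x‖ ^ 2 / (4 * v)))

noncomputable def pk (d : ℕ) (α : ℝ) (η : Measure ℝ) (t : ℝ) (x : Ed d) : ℝ :=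
  ∫ s, gk d (s * t ^ (2/α)) x ∂η

noncomputable def hk (d : ℕ) (α : ℝ) (η : Measure ℝ) (t : ℝ) (x : Ed d) : ℝ :=
  ∫ s, gk d (s * t ^ (2/α)) x / (2 * (s * t ^ (2/α))) ∂η

noncomputable def Dk (d : ℕ) (α : ℝ) (η : Measure ℝ) (t : ℝ) (x : Ed d) : Ed d :=
  (-(hk d α η t x)) • x

lemma gk_meas (d : ℕ) : Measurable (fun p : ℝ × Ed d => gk d p.1 p.2) := by
  unfold gk; fun_prop

lemma gk_nonneg {d : ℕ} {v : ℝ} (hv : 0 < v) (x : Ed d) : 0 ≤ gk d v x := by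
  unfold gk; positivity

lemma pow_mul_exp_le (k : ℕ) {w : ℝ} (hw : 0 ≤ w) :
    w ^ k * Real.exp (-(w ^ 2 / 4)) ≤ k.factorial * Real.exp 1 := by
  have h1 := Real.pow_div_factorial_le_exp w hw k
  rw [div_le_iff₀ (by positivity)] at h1
  calc w ^ k * Real.exp (-(w ^ 2 / 4)) ≤ (Real.exp w * k.factorial) * Real.exp (-(w ^ 2 / 4)) := by gcongr
    _ = k.factorial * Real.exp (w + -(w^2/4)) := by rw [Real.exp_add]; ring
    _ ≤ _ := by gcongr; nlinarith [sq_nonneg (w - 2)]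

lemma gk_bound (d k : ℕ) : ∃ C : ℝ, 0 < C ∧ ∀ v : ℝ, 0 < v → ∀ x : Ed d,
    ‖x‖ ^ k * gk d v x ≤ C * v ^ (((k:ℝ) - d)/2) := by
  refine ⟨(4 * Real.pi) ^ (-(d:ℝ)/2) * (k.factorial * Real.exp 1), by positivity, fun v hv x => ?_⟩
  have hs : 0 < Real.sqrt v := Real.sqrt_pos.2 hv
  have h := pow_mul_exp_le k (w := ‖x‖ / Real.sqrt v) (by positivity)
  have e1 : (‖x‖ / Real.sqrt v) ^ 2 / 4 = ‖x‖ ^ 2 / (4 * v) := by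
    rw [div_pow, Real.sq_sqrt hv.le]; field_simp
  rw [e1, div_pow] at h
  have e2 : v ^ (((k:ℝ) - d)/2) = Real.sqrt v ^ k * v ^ (-(d:ℝ)/2) := by
    rw [Real.sqrt_eq_rpow, ← Real.rpow_natCast, ← Real.rpow_mul hv.le, ← Real.rpow_add hv]; ring_nf
  unfold gk
  rw [e2, Real.mul_rpow (by positivity) hv.le]
  have : ‖x‖ ^ k * ((4 * Real.pi) ^ (-(d:ℝ)/2) * v ^ (-(d:ℝ)/2) * Real.exp (-(‖x‖ ^ 2 / (4 * v))))
    = (4 * Real.pi) ^ (-(d:ℝ)/2) * (‖x‖ ^ k / Real.sqrt v ^ k * Real.exp (-(‖x‖ ^ 2 / (4 * v)))) * (Real.sqrt v ^ k * v ^ (-(d:ℝ)/2)) := by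
    field_simp
  rw [this]
  gcongr

lemma gk_integral {d : ℕ} {v : ℝ} (hv : 0 < v) : ∫ x : Ed d, gk d v x = 1 := by
  unfold gk
  rw [integral_const_mul]
  have h := GaussianFourier.integral_rexp_neg_mul_sq_norm (V := Ed d) (b := 1/(4*v)) (by positivity)
  have e : (fun x : Ed d => Real.exp (-(‖x‖ ^ 2 / (4 * v)))) = fun x : Ed d => Real.exp (-(1/(4*v)) * ‖x‖ ^ 2) := by
    ext x; congr 1; ring
  rw [e, h]
  have e2 : Real.pi / (1 / (4 * v)) = 4 * Real.pi * v := by field_simp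
  rw [e2, finrank_euclideanSpace_fin, ← Real.rpow_add (by positivity)]
  ring_nf; simp

lemma gk_integrable {d : ℕ} {v : ℝ} (hv : 0 < v) : Integrable (fun x : Ed d => gk d v x) := by
  by_contra h
  have := gk_integral (d := d) hv
  rw [integral_undef h] at this
  exact zero_ne_one this

lemma gk_lintegral {d : ℕ} {v : ℝ} (hv : 0 < v) : ∫⁻ x : Ed d, ENNReal.ofReal (gk d v x) = 1 := by
  rw [← ofReal_integral_eq_lintegral_ofReal (gk_integrable hv) (ae_of_all _ fun x => gk_nonneg hv x), gk_integral hv]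
  simp

lemma gk_neg (d : ℕ) (v : ℝ) (x : Ed d) : gk d v (-x) = gk d v x := by
  unfold gk; rw [norm_neg]

lemma pk_neg (d : ℕ) (α : ℝ) (η : Measure ℝ) (t : ℝ) (x : Ed d) : pk d α η t (-x) = pk d α η t x := by
  unfold pk; simp_rw [gk_neg]

section
variable {d : ℕ} {α : ℝ} {η : Measure ℝ}

lemma pk_meas [SFinite η] : Measurable (fun p : ℝ × Ed d => pk d α η p.1 p.2) := by
  unfold pk
  refine StronglyMeasurable.measurable (StronglyMeasurable.integral_prod_right (f := fun (p : ℝ × Ed d) (s : ℝ) => gk d (s * p.1 ^ (2/α)) p.2) ?_)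
  refine Measurable.stronglyMeasurable ?_
  exact (gk_meas d).comp (f := fun q : (ℝ × Ed d) × ℝ => (q.2 * q.1.1 ^ (2/α), q.1.2)) (by fun_prop)

lemma hk_meas [SFinite η] : Measurable (fun p : ℝ × Ed d => hk d α η p.1 p.2) := by
  unfold hk
  refine StronglyMeasurable.measurable (StronglyMeasurable.integral_prod_right (f := fun (p : ℝ × Ed d) (s : ℝ) => gk d (s * p.1 ^ (2/α)) p.2 / (2 * (s * p.1 ^ (2/α)))) ?_)
  refine Measurable.stronglyMeasurable ?_
  refine Measurable.div ((gk_meas d).comp (f := fun q : (ℝ × Ed d) × ℝ => (q.2 * q.1.1 ^ (2/α), q.1.2)) (by fun_prop)) (by fun_prop)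

lemma Dk_meas [SFinite η] : Measurable (fun p : ℝ × Ed d => Dk d α η p.1 p.2) := by
  unfold Dk
  exact (hk_meas.neg).smul measurable_snd

lemma gk_meas_s (c : ℝ) (x : Ed d) : Measurable (fun s : ℝ => gk d (s * c) x) := by
  unfold gk; fun_prop

lemma gk_int_s {β : ℝ} (hβ : 0 < β) (h : IsSub β η) (hd : 1 ≤ d) {τ : ℝ} (hτ : 0 < τ) (x : Ed d) :
    Integrable (fun s => gk d (s * τ) x) η := by
  obtain ⟨C, hC, hb⟩ := gk_bound d 0
  have hd' : (1:ℝ) ≤ d := by exact_mod_cast hd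
  have h1 := (h.mom_neg hβ (m := (d:ℝ)/2) (by positivity)).const_mul (C * τ ^ (-((d:ℝ)/2)))
  refine h1.mono' (gk_meas_s _ _).aestronglyMeasurable ?_
  filter_upwards [h.pos] with s hs
  rw [Real.norm_of_nonneg (gk_nonneg (by positivity) x)]
  have := hb (s*τ) (by positivity) x
  rw [Real.mul_rpow hs.le hτ.le] at this
  have e : ((0:ℕ):ℝ) - d = -d := by simp
  rw [pow_zero, one_mul, e, neg_div] at this
  linarith

lemma gkd_int_s {β : ℝ} (hβ : 0 < β) (h : IsSub β η) {τ : ℝ} (hτ : 0 < τ) (x : Ed d) :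
    Integrable (fun s => gk d (s * τ) x / (2 * (s * τ))) η := by
  obtain ⟨C, hC, hb⟩ := gk_bound d 0
  have h1 := (h.mom_neg hβ (m := (d:ℝ)/2 + 1) (by positivity)).const_mul (C * τ ^ (-((d:ℝ)/2 + 1)))
  refine h1.mono' ((gk_meas_s _ _).div (by fun_prop)).aestronglyMeasurable ?_
  filter_upwards [h.pos] with s hs
  rw [Real.norm_of_nonneg (div_nonneg (gk_nonneg (by positivity) x) (by positivity))]
  have := hb (s*τ) (by positivity) x
  have e : ((0:ℕ):ℝ) - d = -d := by simp
  rw [pow_zero, one_mul, e, neg_div] at this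
  rw [mul_assoc, ← Real.mul_rpow hτ.le hs.le, mul_comm τ s, div_le_iff₀ (by positivity)]
  have e2 : (s * τ) ^ (-((d:ℝ)/2 + 1)) * (s * τ) = (s * τ) ^ (-((d:ℝ)/2)) := by
    nth_rewrite 2 [← Real.rpow_one (s * τ)]
    rw [← Real.rpow_add (by positivity)]; ring_nf
  have e3 : C * (s * τ) ^ (-((d:ℝ)/2 + 1)) * (2 * (s * τ)) = 2 * (C * (s * τ) ^ (-((d:ℝ)/2))) := by
    rw [← e2]; ring
  rw [e3]
  have := gk_nonneg (d := d) (v := s * τ) (by positivity) x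
  linarith

lemma pk_nonneg {β : ℝ} (h : IsSub β η) {t : ℝ} (ht : 0 < t) (x : Ed d) : 0 ≤ pk d α η t x := by
  unfold pk
  refine integral_nonneg_of_ae ?_
  filter_upwards [h.pos] with s hs
  exact gk_nonneg (by positivity) x

lemma hk_nonneg {β : ℝ} (h : IsSub β η) {t : ℝ} (ht : 0 < t) (x : Ed d) : 0 ≤ hk d α η t x := by
  unfold hk
  refine integral_nonneg_of_ae ?_
  filter_upwards [h.pos] with s hs
  exact div_nonneg (gk_nonneg (by positivity) x) (by positivity)

lemma pk_bound0 {β : ℝ} (hβ : 0 < β) (h : IsSub β η) (hd : 1 ≤ d) {t : ℝ} (ht : 0 < t) :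
    ∃ C : ℝ, ∀ x : Ed d, pk d α η t x ≤ C := by
  obtain ⟨C, hC, hb⟩ := gk_bound d 0
  have hd' : (1:ℝ) ≤ d := by exact_mod_cast hd
  set τ := t ^ (2/α) with hτd
  have hτ : 0 < τ := by positivity
  have h1 := (h.mom_neg hβ (m := (d:ℝ)/2) (by positivity)).const_mul (C * τ ^ (-((d:ℝ)/2)))
  refine ⟨_, fun x => integral_mono_ae (gk_int_s hβ h hd hτ x) h1 ?_⟩
  filter_upwards [h.pos] with s hs
  have := hb (s*τ) (by positivity) x
  rw [Real.mul_rpow hs.le hτ.le] at this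
  have e : ((0:ℕ):ℝ) - d = -d := by simp
  rw [pow_zero, one_mul, e, neg_div] at this
  linarith

lemma pk_bound {β : ℝ} (hβ : 1/2 < β) (h : IsSub β η) (hd : 1 ≤ d) :
    ∃ C : ℝ, 0 < C ∧ ∀ t : ℝ, 0 < t → ∀ x : Ed d, ‖x‖ ^ (d+1) * pk d α η t x ≤ C * t ^ (1/α) := by
  obtain ⟨C, hC, hb⟩ := gk_bound d (d+1)
  have hm : 0 ≤ ∫ s, s ^ (1/2:ℝ) ∂η := by
    refine integral_nonneg_of_ae ?_
    filter_upwards [h.pos] with s hs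
    exact Real.rpow_nonneg hs.le _
  refine ⟨C * (∫ s, s ^ (1/2:ℝ) ∂η) + 1, by positivity, fun t ht x => ?_⟩
  set τ := t ^ (2/α) with hτd
  have hτ : 0 < τ := by positivity
  have e1 : t ^ (1/α) = τ ^ (1/2:ℝ) := by
    rw [hτd, ← Real.rpow_mul ht.le]; congr 1; ring
  have : ‖x‖ ^ (d+1) * pk d α η t x ≤ ∫ s, (C * τ ^ (1/2:ℝ)) * s ^ (1/2:ℝ) ∂η := by
    unfold pk
    rw [← integral_const_mul]
    refine integral_mono_ae ((gk_int_s (by linarith) h hd hτ x).const_mul _) (h.mom_half hβ |>.const_mul _) ?_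
    filter_upwards [h.pos] with s hs
    have := hb (s*τ) (by positivity) x
    have e : (((d+1:ℕ):ℝ) - d)/2 = 1/2 := by push_cast; ring
    rw [e, Real.mul_rpow hs.le hτ.le] at this
    calc _ ≤ _ := this
      _ = _ := by ring
  refine this.trans ?_
  rw [integral_const_mul, e1]
  have : 0 ≤ τ ^ (1/2:ℝ) := by positivity
  nlinarith

lemma Dk_norm {β : ℝ} (h : IsSub β η) {t : ℝ} (ht : 0 < t) (x : Ed d) :
    ‖Dk d α η t x‖ = hk d α η t x * ‖x‖ := by
  unfold Dk
  rw [norm_smul, norm_neg, Real.norm_of_nonneg (hk_nonneg h ht x)]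

lemma Dk_bound {β : ℝ} (hβ : 0 < β) (h : IsSub β η) :
    ∃ C : ℝ, 0 < C ∧ ∀ t : ℝ, 0 < t → ∀ x : Ed d, ‖x‖ ^ (d+1) * ‖Dk d α η t x‖ ≤ C ∧
      ‖Dk d α η t x‖ ≤ C * t ^ (-((d:ℝ)+1)/α) := by
  have := h.prob
  obtain ⟨C, hC, hb⟩ := gk_bound d (d+2)
  obtain ⟨C', hC', hb'⟩ := gk_bound d 1
  have hm : 0 ≤ ∫ s, s ^ (-(((d:ℝ)+1)/2)) ∂η := by
    refine integral_nonneg_of_ae ?_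
    filter_upwards [h.pos] with s hs
    exact Real.rpow_nonneg hs.le _
  refine ⟨C + C' * (∫ s, s ^ (-(((d:ℝ)+1)/2)) ∂η), by positivity, fun t ht x => ?_⟩
  rw [Dk_norm h ht]
  set τ := t ^ (2/α) with hτd
  have hτ : 0 < τ := by positivity
  constructor
  · have : ‖x‖ ^ (d+1) * (hk d α η t x * ‖x‖) ≤ ∫ s, C ∂η := by
      have e : ‖x‖ ^ (d+1) * (hk d α η t x * ‖x‖) = ‖x‖ ^ (d+2) * hk d α η t x := by ring
      rw [e]; unfold hk
      rw [← integral_const_mul]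
      refine integral_mono_ae ((gkd_int_s hβ h hτ x).const_mul _) (integrable_const _) ?_
      filter_upwards [h.pos] with s hs
      have := hb (s*τ) (by positivity) x
      have e : (((d+2:ℕ):ℝ) - d)/2 = 1 := by push_cast; ring
      rw [e, Real.rpow_one] at this
      rw [← mul_div_assoc, div_le_iff₀ (by positivity)]
      have : 0 ≤ C * (s * τ) := by positivity
      linarith
    rw [integral_const, probReal_univ, one_smul] at this
    have : 0 ≤ C' * (∫ s, s ^ (-(((d:ℝ)+1)/2)) ∂η) := by positivity
    linarith
  · have e1 : t ^ (-((d:ℝ)+1)/α) = τ ^ (-(((d:ℝ)+1)/2)) := by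
      rw [hτd, ← Real.rpow_mul ht.le]; congr 1; ring
    have : hk d α η t x * ‖x‖ ≤ ∫ s, (C' * τ ^ (-(((d:ℝ)+1)/2))) * s ^ (-(((d:ℝ)+1)/2)) ∂η := by
      rw [mul_comm]; unfold hk
      rw [← integral_const_mul]
      refine integral_mono_ae ((gkd_int_s hβ h hτ x).const_mul _) ((h.mom_neg hβ (by positivity)).const_mul _) ?_
      filter_upwards [h.pos] with s hs
      have := hb' (s*τ) (by positivity) x
      rw [mul_assoc, ← Real.mul_rpow hτ.le hs.le, mul_comm τ s, ← mul_div_assoc, div_le_iff₀ (by positivity)]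
      have e2 : (s * τ) ^ (-(((d:ℝ)+1)/2)) * (s * τ) = (s * τ) ^ ((((1:ℕ):ℝ) - d)/2) := by
        nth_rewrite 2 [← Real.rpow_one (s * τ)]
        rw [← Real.rpow_add (by positivity)]
        congr 1; push_cast; ring
      have e3 : C' * (s * τ) ^ (-(((d:ℝ)+1)/2)) * (2 * (s * τ)) = 2 * (C' * (s * τ) ^ ((((1:ℕ):ℝ) - d)/2)) := by
        rw [← e2]; ring
      rw [e3]
      have h0 := gk_nonneg (d := d) (v := s * τ) (by positivity) x
      rw [pow_one] at this
      have : 0 ≤ ‖x‖ * gk d (s*τ) x := by positivity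
      linarith
    refine this.trans ?_
    rw [integral_const_mul, e1]
    have : 0 ≤ τ ^ (-(((d:ℝ)+1)/2)) := by positivity
    nlinarith

end
end S15

namespace S15
section
variable {d : ℕ} {α : ℝ} {η : Measure ℝ}

/-- Laplace transform at `t |ξ|^α`. -/
lemma lap_xi (hα1 : 1 < α) (h : IsSub (α/2) η) {t : ℝ} (ht : 0 < t) (ξ : Ed d) :
    ∫ s, Real.exp (-((s * t ^ (2/α)) * ‖ξ‖ ^ 2)) ∂η = Real.exp (-(t * ‖ξ‖ ^ α)) := by
  have := h.prob
  rcases eq_or_ne ξ 0 with rfl | hξ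
  · simp [Real.zero_rpow (by linarith : α ≠ 0)]
  have h0 : 0 < ‖ξ‖ := norm_pos_iff.2 hξ
  have := h.lap (t ^ (2/α) * ‖ξ‖ ^ 2) (by positivity)
  rw [Real.mul_rpow (by positivity) (by positivity), ← Real.rpow_mul ht.le, ← Real.rpow_natCast, ← Real.rpow_mul h0.le] at this
  have e1 : 2 / α * (α/2) = 1 := by field_simp
  have e2 : ((2:ℕ):ℝ) * (α/2) = α := by push_cast; ring
  rw [e1, e2, Real.rpow_one] at this
  rw [← this]
  congr 1; ext s; congr 1
  rw [← Real.rpow_natCast]; ring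

lemma gauss_fourier {v : ℝ} (hv : 0 < v) (x : Ed d) :
    (((2 * Real.pi) ^ (-(d : ℝ)) : ℝ) : ℂ) * ∫ ξ : Ed d, Complex.exp (-(v:ℂ) * ‖ξ‖ ^ 2 + (-Complex.I) * ⟪x, ξ⟫) = (gk d v x : ℂ) := by
  rw [GaussianFourier.integral_cexp_neg_mul_sq_norm_add (by simpa using hv)]
  unfold gk
  have e1 : (↑Real.pi / (v:ℂ)) ^ (((Module.finrank ℝ (Ed d)):ℂ) / 2) = (((Real.pi / v) ^ ((d:ℝ)/2) : ℝ) : ℂ) := by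
    rw [Complex.ofReal_cpow (by positivity)]; simp
  have e2 : (-Complex.I) ^ 2 * (‖x‖:ℂ) ^ 2 / (4 * v) = ((-(‖x‖^2/(4*v)) : ℝ) : ℂ) := by
    push_cast; rw [neg_sq, Complex.I_sq]; ring
  rw [e1, e2, ← Complex.ofReal_exp, ← Complex.ofReal_mul, ← Complex.ofReal_mul, ← mul_assoc]
  congr 3
  have hp := Real.pi_pos
  have e3 : (2 * Real.pi) ^ (-(d:ℝ)) = (4 * Real.pi ^ 2) ^ (-(d:ℝ)/2) := by
    rw [show 4 * Real.pi ^ 2 = (2 * Real.pi) ^ (2:ℝ) by rw [Real.rpow_two]; ring, ← Real.rpow_mul (by positivity)]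
    congr 1; ring
  have e4 : (Real.pi / v) ^ ((d:ℝ)/2) = (v / Real.pi) ^ (-(d:ℝ)/2) := by
    rw [neg_div, Real.rpow_neg (by positivity), ← Real.inv_rpow (by positivity), inv_div]
  rw [e3, e4, ← Real.mul_rpow (by positivity) (by positivity)]
  congr 1; field_simp

lemma fub_int (hα1 : 1 < α) (hd : 1 ≤ d) (h : IsSub (α/2) η) {τ : ℝ} (hτ : 0 < τ) (x : Ed d) :
    Integrable (fun p : Ed d × ℝ => Complex.exp (-((p.2 * τ : ℝ):ℂ) * ‖p.1‖ ^ 2 + (-Complex.I) * ⟪x, p.1⟫)) (volume.prod η) := by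
  have := h.prob
  have hd' : (1:ℝ) ≤ d := by exact_mod_cast hd
  rw [integrable_prod_iff']
  · constructor
    · filter_upwards [h.pos] with s hs
      exact GaussianFourier.integrable_cexp_neg_mul_sq_norm_add (by rw [Complex.ofReal_re]; positivity) _ _
    · have h1 := (h.mom_neg (by linarith) (m := (d:ℝ)/2) (by positivity)).const_mul ((Real.pi/τ) ^ ((d:ℝ)/2))
      refine h1.congr ?_
      filter_upwards [h.pos] with s hs
      have h2 := GaussianFourier.integral_rexp_neg_mul_sq_norm (V := Ed d) (b := s*τ) (by positivity)
      have e : (fun ξ : Ed d => ‖Complex.exp (-((s * τ : ℝ):ℂ) * ‖ξ‖ ^ 2 + (-Complex.I) * ⟪x, ξ⟫)‖) = fun ξ : Ed d => Real.exp (-(s*τ) * ‖ξ‖ ^ 2) := by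
        ext ξ; rw [Complex.norm_exp]; congr 1; simp [← Complex.ofReal_pow, ← Complex.ofReal_mul]
      rw [e, h2, finrank_euclideanSpace_fin, mul_comm s τ, ← div_div, Real.div_rpow (by positivity) hs.le, Real.rpow_neg hs.le]
      rfl
  · refine Measurable.aestronglyMeasurable ?_
    fun_prop

lemma stableP_eq (hα1 : 1 < α) (hd : 1 ≤ d) (h : IsSub (α/2) η) {t : ℝ} (ht : 0 < t) (x : Ed d) :
    stableP d α t x = pk d α η t x := by
  have := h.prob
  set τ := t ^ (2/α) with hτd
  have hτ : 0 < τ := by positivity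
  have key := integral_integral_swap (f := fun (ξ : Ed d) (s : ℝ) => Complex.exp (-((s * τ : ℝ):ℂ) * ‖ξ‖ ^ 2 + (-Complex.I) * ⟪x, ξ⟫)) (fub_int (d := d) hα1 hd h hτ x)
  have e1 : ∀ ξ : Ed d, ∫ s, Complex.exp (-((s * τ : ℝ):ℂ) * ‖ξ‖ ^ 2 + (-Complex.I) * ⟪x, ξ⟫) ∂η
     = Complex.exp (-Complex.I * ((⟪ξ, x⟫ : ℝ) : ℂ)) * Complex.exp (-(t : ℂ) * ((‖ξ‖ ^ α : ℝ) : ℂ)) := by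
    intro ξ
    have : Complex.exp (-(t : ℂ) * ((‖ξ‖ ^ α : ℝ) : ℂ)) = ((Real.exp (-(t * ‖ξ‖ ^ α)) : ℝ):ℂ) := by
      push_cast; congr 1; ring
    rw [this, ← lap_xi hα1 h ht, ← integral_complex_ofReal, ← integral_const_mul]
    congr 1; ext s
    rw [Complex.exp_add, mul_comm, real_inner_comm]
    congr 1
    push_cast; congr 1; rw [hτd]; ring
  simp only [e1] at key
  unfold stableP
  rw [key, ← integral_const_mul]
  have e2 : ∫ s, (((2 * Real.pi) ^ (-(d : ℝ)) : ℝ) : ℂ) * (∫ ξ : Ed d, Complex.exp (-((s * τ : ℝ):ℂ) * ‖ξ‖ ^ 2 + (-Complex.I) * ⟪x, ξ⟫)) ∂η = ∫ s, ((gk d (s * τ) x : ℝ) : ℂ) ∂η := by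
    refine integral_congr_ae ?_
    filter_upwards [h.pos] with s hs
    exact gauss_fourier (by positivity) x
  rw [e2, integral_complex_ofReal, Complex.ofReal_re]
  rfl

lemma pk_int_prod (h : IsSub (α/2) η) {t : ℝ} (ht : 0 < t) :
    Integrable (fun p : Ed d × ℝ => gk d (p.2 * t ^ (2/α)) p.1) (volume.prod η) := by
  have := h.prob
  rw [integrable_prod_iff']
  · constructor
    · filter_upwards [h.pos] with s hs
      exact gk_integrable (by positivity)
    · refine (integrable_const (1:ℝ)).congr ?_
      filter_upwards [h.pos] with s hs
      rw [← gk_integral (d := d) (v := s * t ^ (2/α)) (by positivity)]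
      congr 1; ext x
      rw [Real.norm_of_nonneg (gk_nonneg (by positivity) _)]
  · exact ((gk_meas d).comp (f := fun q : Ed d × ℝ => (q.2 * t ^ (2/α), q.1)) (by fun_prop)).aestronglyMeasurable

lemma pk_integrable (h : IsSub (α/2) η) {t : ℝ} (ht : 0 < t) : Integrable (pk d α η t) := by
  have := h.prob
  exact (pk_int_prod h ht).integral_prod_left

lemma pk_integral (h : IsSub (α/2) η) {t : ℝ} (ht : 0 < t) : ∫ x, pk d α η t x = 1 := by
  have := h.prob
  unfold pk
  rw [integral_integral_swap (pk_int_prod h ht)]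
  rw [← probReal_univ (μ := η), ← mul_one (η.real Set.univ), ← smul_eq_mul, ← integral_const]
  refine integral_congr_ae ?_
  filter_upwards [h.pos] with s hs
  exact gk_integral (by positivity)

lemma pk_lintegral (h : IsSub (α/2) η) {t : ℝ} (ht : 0 < t) : ∫⁻ x, ENNReal.ofReal (pk d α η t x) = 1 := by
  rw [← ofReal_integral_eq_lintegral_ofReal (pk_integrable h ht) (ae_of_all _ (pk_nonneg h ht)), pk_integral h ht]
  simp

/-- characteristic function of `pk`. -/
lemma pk_char (hα1 : 1 < α) (h : IsSub (α/2) η) {t : ℝ} (ht : 0 < t) (ξ : Ed d) :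
    ∫ w, (pk d α η t w : ℂ) * Complex.exp (Complex.I * ⟪ξ, w⟫) = ((Real.exp (-(t * ‖ξ‖ ^ α)) : ℝ) : ℂ) := by
  have := h.prob
  set τ := t ^ (2/α) with hτd
  have hτ : 0 < τ := by positivity
  have hi : Integrable (fun p : Ed d × ℝ => (gk d (p.2 * τ) p.1 : ℂ) * Complex.exp (Complex.I * ⟪ξ, p.1⟫)) (volume.prod η) := by
    refine (pk_int_prod h ht).ofReal.mul_bdd (c := 1) ?_ ?_
    · exact Measurable.aestronglyMeasurable (by fun_prop)
    · refine ae_of_all _ fun p => ?_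
      rw [Complex.norm_exp]; simp
  have key := integral_integral_swap (f := fun (w : Ed d) (s : ℝ) => (gk d (s * τ) w : ℂ) * Complex.exp (Complex.I * ⟪ξ, w⟫)) hi
  have e1 : ∀ w : Ed d, (pk d α η t w : ℂ) * Complex.exp (Complex.I * ⟪ξ, w⟫) = ∫ s, (gk d (s * τ) w : ℂ) * Complex.exp (Complex.I * ⟪ξ, w⟫) ∂η := by
    intro w
    rw [integral_mul_const, integral_complex_ofReal]; rfl
  simp only [e1]
  rw [key, ← lap_xi hα1 h ht, ← integral_complex_ofReal]
  refine integral_congr_ae ?_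
  filter_upwards [h.pos] with s hs
  have hv : 0 < s * τ := by positivity
  have hp := Real.pi_pos
  set v := s * τ
  have h3 := GaussianFourier.integral_cexp_neg_mul_sq_norm_add (V := Ed d) (b := ((1/(4*v) : ℝ):ℂ)) (by rw [Complex.ofReal_re]; positivity) Complex.I ξ
  have e3 : ∀ w : Ed d, (gk d v w : ℂ) * Complex.exp (Complex.I * ⟪ξ, w⟫) = (((4 * Real.pi * v) ^ (-(d:ℝ)/2) : ℝ):ℂ) * Complex.exp (-((1/(4*v) : ℝ):ℂ) * ‖w‖^2 + Complex.I * ⟪ξ, w⟫) := by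
    intro w
    unfold gk
    have ee : ((Real.exp (-(‖w‖^2/(4*v))) : ℝ):ℂ) = Complex.exp (-((1/(4*v) : ℝ):ℂ) * ‖w‖^2) := by
      push_cast; congr 1; ring
    rw [Complex.exp_add, ← ee, Complex.ofReal_mul, mul_assoc]
  simp only [e3]
  rw [integral_const_mul, h3]
  have e1 : (↑Real.pi / ((1/(4*v) : ℝ):ℂ)) ^ (((Module.finrank ℝ (Ed d)):ℂ) / 2) = (((Real.pi / (1/(4*v))) ^ ((d:ℝ)/2) : ℝ) : ℂ) := by
    rw [Complex.ofReal_cpow (by positivity)]; simp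
  have e2 : (Complex.I) ^ 2 * (‖ξ‖:ℂ) ^ 2 / (4 * ((1/(4*v) : ℝ):ℂ)) = ((-(v * ‖ξ‖^2) : ℝ) : ℂ) := by
    have : (v:ℂ) ≠ 0 := by exact_mod_cast hv.ne'
    push_cast; rw [Complex.I_sq]; field_simp
  rw [e1, e2, ← Complex.ofReal_exp, ← Complex.ofReal_mul, ← Complex.ofReal_mul, ← mul_assoc]
  congr 1
  have : Real.pi / (1/(4*v)) = 4 * Real.pi * v := by field_simp
  rw [this, ← Real.rpow_add (by positivity)]
  have : -(d:ℝ)/2 + d/2 = 0 := by ring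
  rw [this]; simp

end
end S15

namespace S15
section
variable {d : ℕ} {α : ℝ} {η : Measure ℝ}

lemma gk_hasFDerivAt {v : ℝ} (x : Ed d) :
    HasFDerivAt (gk d v) (innerSL ℝ ((-(gk d v x / (2 * v))) • x)) x := by
  have h1 : HasFDerivAt (fun x : Ed d => ‖x‖^2) (2 • (innerSL ℝ x)) x := (hasStrictFDerivAt_norm_sq x).hasFDerivAt
  have h2 := ((h1.mul_const (4*v)⁻¹).neg.exp).const_mul ((4 * Real.pi * v) ^ (-(d:ℝ)/2))
  have e : (fun y : Ed d => (4 * Real.pi * v) ^ (-(d:ℝ)/2) * Real.exp (-(‖y‖^2 * (4*v)⁻¹))) = gk d v := by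
    ext y; unfold gk; rw [div_eq_mul_inv (‖y‖^2)]
  rw [← e]
  refine h2.congr_fderiv ?_
  ext y
  simp
  ring

lemma pk_hasFDerivAt (hα : 1 < α) (hd : 1 ≤ d) (h : IsSub (α/2) η) {t : ℝ} (ht : 0 < t) (x : Ed d) :
    HasFDerivAt (pk d α η t) (innerSL ℝ (Dk d α η t x)) x := by
  have := h.prob
  set τ := t ^ (2/α) with hτd
  have hτ : 0 < τ := by positivity
  obtain ⟨C, hC, hb⟩ := gk_bound d 1
  have hm := (h.mom_neg (by linarith) (m := ((d:ℝ)+1)/2) (by positivity)).const_mul (C * τ ^ (-(((d:ℝ)+1)/2)))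
  have key := hasFDerivAt_integral_of_dominated_of_fderiv_le (𝕜 := ℝ) (μ := η) (F := fun (x : Ed d) s => gk d (s * τ) x)
    (F' := fun x s => innerSL ℝ ((-(gk d (s*τ) x / (2 * (s*τ)))) • x)) (x₀ := x) (s := Set.univ)
    (bound := fun s => C * τ ^ (-(((d:ℝ)+1)/2)) * s ^ (-(((d:ℝ)+1)/2))) univ_mem
    (Eventually.of_forall fun x => (gk_meas_s _ _).aestronglyMeasurable) (gk_int_s (by linarith) h hd hτ x)
    ?_ ?_ hm ?_
  · refine key.congr_fderiv ?_
    have : ∀ s, innerSL ℝ ((-(gk d (s*τ) x / (2 * (s*τ)))) • x) = (-(gk d (s*τ) x / (2 * (s*τ)))) • innerSL ℝ x := by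
      intro s; rw [map_smul]
    simp only [this]
    rw [integral_smul_const, integral_neg, ← map_smul]
    rfl
  · refine Measurable.aestronglyMeasurable ?_
    refine (innerSL ℝ (E := Ed d)).continuous.measurable.comp ?_
    exact (((gk_meas_s _ _).div (by fun_prop)).neg).smul_const x
  · filter_upwards [h.pos] with s hs y _
    rw [innerSL_apply_norm, norm_smul, norm_neg, Real.norm_of_nonneg (div_nonneg (gk_nonneg (by positivity) _) (by positivity))]
    have := hb (s*τ) (by positivity) y
    rw [mul_assoc, ← Real.mul_rpow hτ.le hs.le, mul_comm τ s, mul_comm, ← mul_div_assoc, div_le_iff₀ (by positivity)]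
    have e2 : (s * τ) ^ (-(((d:ℝ)+1)/2)) * (s * τ) = (s * τ) ^ ((((1:ℕ):ℝ) - d)/2) := by
      nth_rewrite 2 [← Real.rpow_one (s * τ)]
      rw [← Real.rpow_add (by positivity)]
      congr 1; push_cast; ring
    have e3 : C * (s * τ) ^ (-(((d:ℝ)+1)/2)) * (2 * (s * τ)) = 2 * (C * (s * τ) ^ ((((1:ℕ):ℝ) - d)/2)) := by
      rw [← e2]; ring
    rw [e3]
    have h0 := gk_nonneg (d := d) (v := s * τ) (by positivity) y
    rw [pow_one] at this
    have : 0 ≤ ‖y‖ * gk d (s*τ) y := by positivity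
    linarith
  · exact ae_of_all _ fun s y _ => gk_hasFDerivAt y

lemma grad_stableP (hα : 1 < α) (hd : 1 ≤ d) (h : IsSub (α/2) η) {t : ℝ} (ht : 0 < t) (y z : Ed d) :
    gradient (fun w => stableP d α t (w - y)) z = Dk d α η t (z - y) := by
  have e : (fun w => stableP d α t (w - y)) = fun w => pk d α η t (w - y) := by
    ext w; exact stableP_eq hα hd h ht _
  rw [e]
  refine HasGradientAt.gradient ?_
  rw [hasGradientAt_iff_hasFDerivAt]
  have h1 := (pk_hasFDerivAt hα hd h ht (z-y)).comp z ((hasFDerivAt_id z).sub_const y)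
  refine h1.congr_fderiv ?_
  ext v; simp

lemma pk_scale {t : ℝ} (ht : 0 < t) (hα : 1 < α) (h : IsSub (α/2) η) (u : Ed d) :
    pk d α η t ((t ^ (1/α)) • u) = (t ^ (1/α)) ^ (-(d:ℝ)) * pk d α η 1 u := by
  unfold pk
  rw [← integral_const_mul]
  refine integral_congr_ae ?_
  filter_upwards [h.pos] with s hs
  have e : t ^ (2/α) = (t ^ (1/α)) ^ (2:ℝ) := by
    rw [← Real.rpow_mul ht.le]; congr 1; ring
  have hc : 0 < t ^ (1/α) := by positivity
  rw [e]
  set c := t ^ (1/α)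
  unfold gk
  rw [norm_smul, Real.norm_of_nonneg hc.le, Real.one_rpow, mul_one, ← mul_assoc, Real.mul_rpow (by positivity) (by positivity),
    ← Real.rpow_mul hc.le]
  have e1 : 2 * (-(d:ℝ)/2) = -d := by ring
  have e2 : (c * ‖u‖)^2 / (4 * (s * c ^ (2:ℝ))) = ‖u‖^2/(4*s) := by
    rw [Real.rpow_two]; field_simp
  rw [e1, e2]; ring

lemma pk_conv_scale {t : ℝ} (ht : 0 < t) (hα : 1 < α) (h : IsSub (α/2) η) (k : Ed d → ℝ) (z : Ed d) :
    ∫ w, pk d α η t w * k (z - w) = ∫ u, pk d α η 1 u * k (z - (t ^ (1/α)) • u) := by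
  have hc : 0 < t ^ (1/α) := by positivity
  have := Measure.integral_comp_smul (volume : Measure (Ed d)) (fun w => pk d α η t w * k (z - w)) (t ^ (1/α))
  simp only [pk_scale ht hα h] at this
  simp only [mul_assoc, integral_const_mul] at this
  rw [finrank_euclideanSpace_fin, abs_of_nonneg (by positivity), smul_eq_mul, Real.rpow_neg hc.le, Real.rpow_natCast] at this
  exact (mul_left_cancel₀ (by positivity) this).symm

lemma pk_conv_tendsto (hα : 1 < α) (h : IsSub (α/2) η) {k : Ed d → ℝ} (hk : Continuous k) {C : ℝ} (hC : ∀ x, |k x| ≤ C) (z : Ed d) :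
    Tendsto (fun t => ∫ w, pk d α η t w * k (z - w)) (𝓝[>] 0) (𝓝 (k z)) := by
  have e : (fun t => ∫ u, pk d α η 1 u * k (z - (t ^ (1/α)) • u)) =ᶠ[𝓝[>] 0] (fun t => ∫ w, pk d α η t w * k (z - w)) := by
    filter_upwards [self_mem_nhdsWithin] with t ht
    exact (pk_conv_scale ht hα h k z).symm
  refine Tendsto.congr' e ?_
  have : k z = ∫ u, pk d α η 1 u * k z := by
    rw [integral_mul_const, pk_integral h one_pos, one_mul]
  rw [this]
  refine tendsto_integral_filter_of_dominated_convergence (fun u => pk d α η 1 u * C) ?_ ?_ ((pk_integrable h one_pos).mul_const C) ?_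
  · refine Eventually.of_forall fun t => ?_
    exact (pk_integrable h one_pos).aestronglyMeasurable.mul (Continuous.aestronglyMeasurable (by fun_prop))
  · refine Eventually.of_forall fun t => ae_of_all _ fun u => ?_
    rw [norm_mul, Real.norm_of_nonneg (pk_nonneg h one_pos u)]
    exact mul_le_mul_of_nonneg_left (hC _) (pk_nonneg h one_pos u)
  · refine ae_of_all _ fun u => ?_
    refine Tendsto.const_mul _ ?_
    refine (hk.tendsto z).comp ?_
    have h1 : Tendsto (fun t : ℝ => t ^ (1/α)) (𝓝[>] 0) (𝓝 0) := by
      have := (Real.continuousAt_rpow_const 0 (1/α) (Or.inr (by positivity))).tendsto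
      rw [Real.zero_rpow (by positivity)] at this
      exact this.mono_left nhdsWithin_le_nhds
    have h2 := (h1.smul_const u).const_sub z
    simpa using h2

lemma pk_conv_le (h : IsSub (α/2) η) {k : Ed d → ℝ} {C : ℝ} (hC : ∀ x, |k x| ≤ C) {t : ℝ} (ht : 0 < t) (z : Ed d) :
    |∫ w, pk d α η t w * k (z - w)| ≤ C := by
  have : C = ∫ w, pk d α η t w * C := by
    rw [integral_mul_const, pk_integral h ht, one_mul]
  rw [this, ← Real.norm_eq_abs]
  refine norm_integral_le_of_norm_le ((pk_integrable h ht).mul_const C) (ae_of_all _ fun u => ?_)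
  rw [norm_mul, Real.norm_of_nonneg (pk_nonneg h ht u)]
  exact mul_le_mul_of_nonneg_left (hC _) (pk_nonneg h ht u)

lemma Dk_meas_x [SFinite η] (t : ℝ) : Measurable (Dk d α η t) := 
  Dk_meas.comp (f := fun x : Ed d => (t, x)) (by fun_prop)

lemma pk_meas_x [SFinite η] (t : ℝ) : Measurable (pk d α η t) := 
  pk_meas.comp (f := fun x : Ed d => (t, x)) (by fun_prop)

/-- integration by parts -/
lemma G_eq (hα : 1 < α) (hd : 1 ≤ d) (h : IsSub (α/2) η) {f : Ed d → ℝ} (hf : ContDiff ℝ 1 f) (hfc : HasCompactSupport f)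
    {t : ℝ} (ht : 0 < t) (z v : Ed d) :
    ∫ y, f y * ⟪v, Dk d α η t (z - y)⟫ = ∫ w, pk d α η t w * ⟪v, gradient f (z - w)⟫ := by
  have := h.prob
  obtain ⟨C, hC, hb⟩ := Dk_bound (d := d) (α := α) (β := α/2) (by linarith) h
  obtain ⟨C', hb'⟩ := pk_bound0 (d := d) (α := α) (β := α/2) (by linarith) h hd ht
  have hfi : Integrable f := hf.continuous.integrable_of_hasCompactSupport hfc
  have hfv : Integrable (fun y => fderiv ℝ f y v) :=
    ((hf.continuous_fderiv one_ne_zero).clm_apply continuous_const).integrable_of_hasCompactSupport (hfc.fderiv_apply ℝ v)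
  have hu : ∀ y, HasFDerivAt (fun y => pk d α η t (z - y)) (-(innerSL ℝ (Dk d α η t (z - y)))) y := by
    intro y
    have h1 := (pk_hasFDerivAt hα hd h ht (z-y)).comp y ((hasFDerivAt_id y).const_sub z)
    refine h1.congr_fderiv ?_
    ext v; simp
  have key := integral_bilinear_hasFDerivAt_right_eq_neg_left_of_integrable (μ := (volume : Measure (Ed d))) (B := ContinuousLinearMap.mul ℝ ℝ) (v := v)
    (f := fun y => pk d α η t (z - y)) (g := f) (g' := fderiv ℝ f) ?_ ?_ ?_ (fun y _ => hu y) (fun y _ => (hf.differentiable one_ne_zero y).hasFDerivAt)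
  · simp only [ContinuousLinearMap.mul_apply', neg_apply, innerSL_apply_apply, neg_mul, integral_neg, neg_neg] at key
    have e1 : ∫ w, pk d α η t w * ⟪v, gradient f (z - w)⟫ = ∫ y, pk d α η t (z - y) * fderiv ℝ f y v := by
      rw [← integral_sub_left_eq_self _ volume z]
      congr 1; ext y
      rw [sub_sub_cancel, real_inner_comm]
      congr 1
      unfold gradient
      rw [InnerProductSpace.toDual_symm_apply]
    rw [e1, key]
    congr 1; ext y
    rw [real_inner_comm]; ring
  · simp only [ContinuousLinearMap.mul_apply', neg_apply, innerSL_apply_apply]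
    refine hfi.bdd_mul (c := C * t ^ (-((d:ℝ)+1)/α) * ‖v‖) ?_ ?_
    · refine Measurable.aestronglyMeasurable ?_
      exact (((Dk_meas_x t).comp (by fun_prop : Measurable fun y : Ed d => z - y)).inner_const).neg
    · refine ae_of_all _ fun y => ?_
      rw [norm_neg]
      refine (norm_inner_le_norm _ _).trans ?_
      gcongr
      exact (hb t ht _).2
  · simp only [ContinuousLinearMap.mul_apply']
    refine hfv.bdd_mul (c := C') ?_ (ae_of_all _ fun y => ?_)
    · exact ((pk_meas_x t).comp (by fun_prop : Measurable fun y : Ed d => z - y)).aestronglyMeasurable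
    · rw [Real.norm_of_nonneg (pk_nonneg h ht _)]; exact hb' _
  · simp only [ContinuousLinearMap.mul_apply']
    refine hfi.bdd_mul (c := C') ?_ (ae_of_all _ fun y => ?_)
    · exact ((pk_meas_x t).comp (by fun_prop : Measurable fun y : Ed d => z - y)).aestronglyMeasurable
    · rw [Real.norm_of_nonneg (pk_nonneg h ht _)]; exact hb' _

end
end S15

namespace S15
section
variable {d : ℕ} {α : ℝ} {η : Measure ℝ}

lemma levy_rad_int (hα1 : 1 < α) (hα2 : α < 2) (hd : 1 ≤ d) :
    Integrable (fun z : Ed d => min 1 (‖z‖^2) * ‖z‖ ^ (-((d:ℝ) + α))) := by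
  have : Nonempty (Fin d) := ⟨⟨0, hd⟩⟩
  have : Nontrivial (Ed d) := inferInstance
  rw [integrable_fun_norm_addHaar (volume : Measure (Ed d)) (f := fun r => min 1 (r^2) * r ^ (-((d:ℝ) + α)))]
  rw [finrank_euclideanSpace_fin]
  have hp : ∀ y : ℝ, 0 < y → y ^ (d-1) * y ^ (-((d:ℝ) + α)) = y ^ (-1-α) := by
    intro y hy
    rw [← Real.rpow_natCast, ← Real.rpow_add hy]; congr 1
    rw [Nat.cast_sub hd]; push_cast; ring
  rw [← Set.Ioc_union_Ioi_eq_Ioi (zero_le_one' ℝ)]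
  refine IntegrableOn.union ?_ ?_
  · have h1 : IntegrableOn (fun y : ℝ => y ^ (1-α)) (Set.Ioc 0 1) := by
      rw [← intervalIntegrable_iff_integrableOn_Ioc_of_le zero_le_one]
      exact intervalIntegral.intervalIntegrable_rpow' (by linarith)
    refine h1.congr_fun ?_ measurableSet_Ioc
    intro y hy
    have hy0 := hy.1
    have : min 1 (y^2) = y^2 := min_eq_right (by have := hy.2; nlinarith)
    simp only [smul_eq_mul]
    rw [this, mul_left_comm, hp y hy0, ← Real.rpow_two, ← Real.rpow_add hy0]; congr 1; ring
  · have h1 : IntegrableOn (fun y : ℝ => y ^ (-1-α)) (Set.Ioi 1) :=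
      integrableOn_Ioi_rpow_of_lt (by linarith) one_pos
    refine h1.congr_fun ?_ measurableSet_Ioi
    intro y hy
    have hy0 : (1:ℝ) < y := hy
    have : min 1 (y^2) = 1 := min_eq_left (by nlinarith)
    simp only [smul_eq_mul]
    rw [this, one_mul, hp y (by linarith)]

lemma gauss_cos {s : ℝ} (hs : 0 < s) (ξ : Ed d) :
    Integrable (fun z : Ed d => (1 - Real.cos ⟪ξ, z⟫) * Real.exp (-(s * ‖z‖^2))) ∧
    ∫ z : Ed d, (1 - Real.cos ⟪ξ, z⟫) * Real.exp (-(s * ‖z‖^2)) = (Real.pi/s) ^ ((d:ℝ)/2) * (1 - Real.exp (-(‖ξ‖^2/(4*s)))) := by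
  have hp := Real.pi_pos
  have i1 := GaussianFourier.integrable_cexp_neg_mul_sq_norm_add (V := Ed d) (b := (s:ℂ)) (by rw [Complex.ofReal_re]; positivity) Complex.I ξ
  have i0 := GaussianFourier.integrable_cexp_neg_mul_sq_norm_add (V := Ed d) (b := (s:ℂ)) (by rw [Complex.ofReal_re]; positivity) 0 ξ
  have h1 := GaussianFourier.integral_cexp_neg_mul_sq_norm_add (V := Ed d) (b := (s:ℂ)) (by rw [Complex.ofReal_re]; positivity) Complex.I ξ
  have h0 := GaussianFourier.integral_cexp_neg_mul_sq_norm_add (V := Ed d) (b := (s:ℂ)) (by rw [Complex.ofReal_re]; positivity) 0 ξ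
  have e : ∀ z : Ed d, (1 - Real.cos ⟪ξ, z⟫) * Real.exp (-(s * ‖z‖^2)) =
      (Complex.exp (-(s:ℂ) * ‖z‖ ^ 2 + 0 * ⟪ξ, z⟫) - Complex.exp (-(s:ℂ) * ‖z‖ ^ 2 + Complex.I * ⟪ξ, z⟫)).re := by
    intro z
    rw [Complex.sub_re, Complex.exp_re, Complex.exp_re]
    simp [← Complex.ofReal_pow]
    ring
  simp only [e]
  refine ⟨(i0.sub i1).re, ?_⟩
  have := integral_re (i0.sub i1)
  simp only [Pi.sub_apply, RCLike.re_to_complex] at this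
  rw [this, integral_sub i0 i1, h0, h1]
  have e1 : (↑Real.pi / (s:ℂ)) ^ (((Module.finrank ℝ (Ed d)):ℂ) / 2) = (((Real.pi / s) ^ ((d:ℝ)/2) : ℝ) : ℂ) := by
    rw [Complex.ofReal_cpow (by positivity)]; simp
  have e2 : Complex.I ^ 2 * (‖ξ‖:ℂ) ^ 2 / (4 * s) = ((-(‖ξ‖^2/(4*s)) : ℝ) : ℂ) := by
    push_cast; rw [Complex.I_sq]; ring
  rw [e1, e2, ← Complex.ofReal_exp, ← mul_sub]
  simp only [ne_eq, OfNat.ofNat_ne_zero, not_false_eq_true, zero_pow, zero_mul, zero_div, Complex.exp_zero]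
  rw [← Complex.ofReal_one, ← Complex.ofReal_sub, ← Complex.ofReal_mul, Complex.ofReal_re]

lemma levy_inv (hα1 : 1 < α) (hα2 : α < 2) {l : ℝ} (hl : 0 < l) :
    IntegrableOn (fun s : ℝ => s ^ (α/2-1) * (1 - Real.exp (-(l/s)))) (Set.Ioi 0) ∧
    ∫ s in Set.Ioi (0:ℝ), s ^ (α/2-1) * (1 - Real.exp (-(l/s))) = Real.Gamma (1 - α/2) / (α/2) * l ^ (α/2) := by
  have h1 := levy_integrableOn (β := α/2) (by linarith) (by linarith) hl
  have h2 := levy_integral (β := α/2) (by linarith) (by linarith) hl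
  have e : Set.EqOn (fun s : ℝ => (|(-1:ℝ)| * s ^ (-1-1 : ℝ)) • ((fun u : ℝ => (1 - Real.exp (-(l * u))) * u ^ (-1 - α/2)) (s ^ (-1:ℝ))))
      (fun s : ℝ => s ^ (α/2-1) * (1 - Real.exp (-(l/s)))) (Set.Ioi 0) := by
    intro s hs
    have hs : 0 < s := hs
    simp only [smul_eq_mul, abs_neg, abs_one, one_mul]
    rw [← Real.rpow_mul hs.le, Real.rpow_neg_one, ← div_eq_mul_inv, mul_left_comm, ← Real.rpow_add hs, mul_comm]
    congr 2; ring
  constructor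
  · rw [← integrableOn_Ioi_comp_rpow_iff _ (p := -1) (by norm_num)] at h1
    exact h1.congr_fun e measurableSet_Ioi
  · rw [← h2, ← integral_comp_rpow_Ioi (fun u : ℝ => (1 - Real.exp (-(l * u))) * u ^ (-1 - α/2)) (p := -1) (by norm_num)]
    exact (setIntegral_congr_fun measurableSet_Ioi e).symm

lemma one_sub_cos_integral (hα1 : 1 < α) (hα2 : α < 2) (hd : 1 ≤ d) (ξ : Ed d) :
    ∫ z : Ed d, (1 - Real.cos ⟪ξ, z⟫) * (stableConst d α * ‖z‖ ^ (-((d:ℝ) + α))) = ‖ξ‖ ^ α := by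
  rcases eq_or_ne ξ 0 with rfl | hξ
  · simp [Real.zero_rpow (by linarith : α ≠ 0)]
  have hn : 0 < ‖ξ‖ := norm_pos_iff.2 hξ
  have hp := Real.pi_pos
  set m := ((d:ℝ) + α)/2 with hm
  have hm0 : 0 < m := by positivity
  have hGm := Real.Gamma_pos_of_pos hm0
  have hGa := Real.Gamma_pos_of_pos (s := 1 - α/2) (by linarith)
  have inner : ∀ s ∈ Set.Ioi (0:ℝ), ∫ z : Ed d, (1 - Real.cos ⟪ξ, z⟫) * (s ^ (m-1) * Real.exp (-(‖z‖^2 * s))) =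
      Real.pi ^ ((d:ℝ)/2) * (s ^ (α/2-1) * (1 - Real.exp (-((‖ξ‖^2/4)/s)))) := by
    intro s hs
    have hs : 0 < s := hs
    have := (gauss_cos hs ξ).2
    have e : ∀ z : Ed d, (1 - Real.cos ⟪ξ, z⟫) * (s ^ (m-1) * Real.exp (-(‖z‖^2 * s))) = s ^ (m-1) * ((1 - Real.cos ⟪ξ, z⟫) * Real.exp (-(s * ‖z‖^2))) := by
      intro z; rw [mul_comm s]; ring
    simp only [e]
    rw [integral_const_mul, this, Real.div_rpow hp.le hs.le, div_div]
    have : s ^ (m-1) = s ^ (α/2-1) * s ^ ((d:ℝ)/2) := by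
      rw [← Real.rpow_add hs]; congr 1; rw [hm]; ring
    rw [this]; 
    have : 0 < s ^ ((d:ℝ)/2) := by positivity
    field_simp
  have hInt0 : Integrable (fun p : Ed d × ℝ => (1 - Real.cos ⟪ξ, p.1⟫) * (p.2 ^ (m-1) * Real.exp (-(‖p.1‖^2 * p.2)))) (volume.prod (volume.restrict (Set.Ioi 0))) := by
    rw [integrable_prod_iff' (Measurable.aestronglyMeasurable (by fun_prop))]
    constructor
    · filter_upwards [ae_restrict_mem measurableSet_Ioi] with s hs
      have hs : 0 < s := hs
      have := (gauss_cos hs ξ).1.const_mul (s ^ (m-1))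
      refine this.congr (ae_of_all _ fun z => ?_)
      simp only; rw [mul_comm s]; ring
    · refine IntegrableOn.congr_fun ((levy_inv hα1 hα2 (l := ‖ξ‖^2/4) (by positivity)).1.const_mul (Real.pi ^ ((d:ℝ)/2))) ?_ measurableSet_Ioi
      intro s hs
      simp only
      rw [← inner s hs]
      congr 1; ext z
      rw [Real.norm_of_nonneg]
      have hs : 0 < s := hs
      have := Real.cos_le_one ⟪ξ, z⟫
      have : 0 ≤ 1 - Real.cos ⟪ξ, z⟫ := by linarith
      positivity
  have key := integral_integral_swap (f := fun (z : Ed d) (s:ℝ) => (1 - Real.cos ⟪ξ, z⟫) * (s ^ (m-1) * Real.exp (-(‖z‖^2 * s)))) hInt0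
  rw [setIntegral_congr_fun measurableSet_Ioi inner, integral_const_mul, (levy_inv hα1 hα2 (l := ‖ξ‖^2/4) (by positivity)).2] at key
  have left : ∀ᵐ z : Ed d, ∫ s in Set.Ioi (0:ℝ), (1 - Real.cos ⟪ξ, z⟫) * (s ^ (m-1) * Real.exp (-(‖z‖^2 * s))) = Real.Gamma m * ((1 - Real.cos ⟪ξ, z⟫) * ‖z‖ ^ (-((d:ℝ) + α))) := by
    have : Nonempty (Fin d) := ⟨⟨0, hd⟩⟩
    have h0 : ∀ᵐ z : Ed d, z ≠ 0 := Measure.ae_ne volume 0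
    filter_upwards [h0] with z hz
    have hz : 0 < ‖z‖ := norm_pos_iff.2 hz
    rw [integral_const_mul, Real.integral_rpow_mul_exp_neg_mul_Ioi hm0 (by positivity)]
    have : (1 / ‖z‖^2) ^ m = ‖z‖ ^ (-((d:ℝ) + α)) := by
      rw [one_div, Real.inv_rpow (by positivity), ← Real.rpow_two, ← Real.rpow_mul hz.le, Real.rpow_neg hz.le]
      congr 2; rw [hm]; ring
    rw [this]; ring
  rw [integral_congr_ae left, integral_const_mul] at key
  have e : ∀ z : Ed d, (1 - Real.cos ⟪ξ, z⟫) * (stableConst d α * ‖z‖ ^ (-((d:ℝ) + α))) = stableConst d α / Real.Gamma m * (Real.Gamma m * ((1 - Real.cos ⟪ξ, z⟫) * ‖z‖ ^ (-((d:ℝ) + α)))) := by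
    intro z; field_simp
  simp only [e]
  rw [integral_const_mul, integral_const_mul, key]
  unfold stableConst
  rw [← hm]
  have e1 : (‖ξ‖^2/4) ^ (α/2) = ‖ξ‖ ^ α / 2 ^ α := by
    rw [show ‖ξ‖^2/4 = (‖ξ‖/2)^(2:ℝ) by rw [Real.rpow_two]; ring, ← Real.rpow_mul (by positivity), ← Real.div_rpow hn.le (by norm_num)]
    congr 1; ring
  have e2 : Real.pi ^ (-(d:ℝ)/2) = (Real.pi ^ ((d:ℝ)/2))⁻¹ := by
    rw [neg_div, Real.rpow_neg hp.le]
  have e3 : (2:ℝ) ^ (α-1) = 2 ^ α / 2 := by rw [Real.rpow_sub_one (by norm_num)]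
  rw [e1, e2, e3]
  have : 0 < Real.pi ^ ((d:ℝ)/2) := by positivity
  have : (0:ℝ) < 2 ^ α := by positivity
  generalize Real.Gamma (1 - α/2) = G at *
  field_simp

end
end S15

namespace S15
section
variable {d : ℕ} {α : ℝ} {η : Measure ℝ}

open scoped FourierTransform in
lemma four_rep {f : Ed d → ℝ} (hf : ContDiff ℝ (⊤ : ℕ∞) f) (hfc : HasCompactSupport f) :
    ∃ φ : Ed d → ℂ, Continuous φ ∧ (∀ k : ℕ, Integrable (fun ξ => ‖ξ‖^k * ‖φ ξ‖)) ∧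
      ∀ x, (f x : ℂ) = ∫ ξ, φ ξ * Complex.exp (Complex.I * ⟪ξ, x⟫) := by
  have hf' : ContDiff ℝ (⊤ : ℕ∞) (fun x => (f x : ℂ)) := Complex.ofRealCLM.contDiff.comp hf
  have hfc' : HasCompactSupport (fun x => (f x : ℂ)) := hfc.comp_left (g := fun r : ℝ => (r:ℂ)) (by simp)
  set F : SchwartzMap (Ed d) ℂ := hfc'.toSchwartzMap hf' with hF
  set ψ : SchwartzMap (Ed d) ℂ := 𝓕 F with hψ
  have hp := Real.pi_pos
  have inv : ∀ x, (f x : ℂ) = ∫ ξ, Complex.exp (Complex.I * ⟪(2 * Real.pi) • ξ, x⟫) * ψ ξ := by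
    intro x
    have h1 : (𝓕⁻ ψ) = F := FourierTransform.fourierInv_fourier_eq F
    have h2 : (f x : ℂ) = F x := rfl
    rw [h2, ← h1, SchwartzMap.fourierInv_coe, Real.fourierInv_eq']
    congr 1; ext ξ
    rw [smul_eq_mul, real_inner_smul_left]; congr 2; push_cast; ring
  set c := 2 * Real.pi with hc
  have hc0 : 0 < c := by positivity
  refine ⟨fun ξ => ((c ^ d)⁻¹ : ℝ) • ψ (c⁻¹ • ξ), by fun_prop, fun k => ?_, fun x => ?_⟩
  · have h1 := (ψ.integrable_pow_mul volume k).comp_smul (R := c⁻¹) (by positivity)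
    have h2 := h1.const_mul (c^k * (c^d)⁻¹)
    refine h2.congr (ae_of_all _ fun ξ => ?_)
    simp only [norm_smul, norm_inv, Real.norm_of_nonneg hc0.le, norm_pow]
    rw [mul_pow c⁻¹, inv_pow]; field_simp
  · have := Measure.integral_comp_smul (volume : Measure (Ed d)) (fun ζ => Complex.exp (Complex.I * ⟪ζ, x⟫) * ψ (c⁻¹ • ζ)) c
    simp only [inv_smul_smul₀ hc0.ne'] at this
    rw [inv x, this, finrank_euclideanSpace_fin, abs_of_nonneg (by positivity), ← integral_smul]
    congr 1; ext ξ
    simp only [Complex.real_smul]; ring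

lemma norm_e (θ : ℝ) : ‖Complex.exp (Complex.I * θ)‖ = 1 := by
  rw [Complex.norm_exp]; simp

variable {f : Ed d → ℝ} {φ : Ed d → ℂ}

lemma phi_int (hφ : Continuous φ) (hk : ∀ k : ℕ, Integrable (fun ξ => ‖ξ‖^k * ‖φ ξ‖)) : Integrable φ := by
  have := hk 0
  simp only [pow_zero, one_mul] at this
  exact (integrable_norm_iff hφ.aestronglyMeasurable).1 this

lemma rep_hasFDerivAt (hφ : Continuous φ) (hk : ∀ k : ℕ, Integrable (fun ξ => ‖ξ‖^k * ‖φ ξ‖))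
    (hr : ∀ x, (f x : ℂ) = ∫ ξ, φ ξ * Complex.exp (Complex.I * ⟪ξ, x⟫)) (hf : Differentiable ℝ f) (x z : Ed d) :
    ((⟪gradient f x, z⟫ : ℝ) : ℂ) = ∫ ξ, φ ξ * Complex.exp (Complex.I * ⟪ξ, x⟫) * (Complex.I * ⟪ξ, z⟫) := by
  have key := hasDerivAt_integral_of_dominated_loc_of_deriv_le (𝕜 := ℝ) (μ := (volume : Measure (Ed d))) (x₀ := (0:ℝ)) (s := Set.univ)
    (F := fun (r:ℝ) ξ => φ ξ * Complex.exp (Complex.I * ⟪ξ, x + r • z⟫))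
    (F' := fun r ξ => φ ξ * (Complex.exp (Complex.I * ⟪ξ, x + r • z⟫) * (Complex.I * ⟪ξ, z⟫)))
    (bound := fun ξ => (‖ξ‖^1 * ‖φ ξ‖) * ‖z‖) univ_mem ?_ ?_ ?_ ?_ ((hk 1).mul_const _) ?_
  · have h1 := key.2
    simp only [← hr] at h1
    have h2 : HasDerivAt (fun r : ℝ => f (x + r • z)) ⟪gradient f x, z⟫ 0 := by
      have hg : HasFDerivAt f (fderiv ℝ f x) (x + (0:ℝ) • z) := by simpa using (hf x).hasFDerivAt
      have h3 : HasDerivAt (fun r : ℝ => x + r • z) z 0 := by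
        simpa using ((hasDerivAt_id (0:ℝ)).smul_const z).const_add x
      have := hg.comp_hasDerivAt (0:ℝ) h3
      have e : ⟪gradient f x, z⟫ = fderiv ℝ f x z := by
        unfold gradient
        rw [InnerProductSpace.toDual_symm_apply]
      rw [e]; exact this
    have h4 := h2.ofReal_comp.unique h1
    rw [h4]
    simp only [zero_smul, add_zero, mul_assoc]
  · exact Eventually.of_forall fun r => Continuous.aestronglyMeasurable (by fun_prop)
  · refine (phi_int hφ hk).mul_bdd (c := 1) (Continuous.aestronglyMeasurable (by fun_prop)) (ae_of_all _ fun ξ => (norm_e _).le)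
  · exact Continuous.aestronglyMeasurable (by fun_prop)
  · refine ae_of_all _ fun ξ r _ => ?_
    rw [norm_mul, norm_mul, norm_e, one_mul, norm_mul, Complex.norm_I, one_mul, Complex.norm_real]
    have := norm_inner_le_norm (𝕜 := ℝ) ξ z
    calc _ ≤ ‖φ ξ‖ * (‖ξ‖ * ‖z‖) := by gcongr
      _ = _ := by ring
  · refine ae_of_all _ fun ξ r _ => ?_
    refine HasDerivAt.const_mul _ ?_
    have h1 : HasDerivAt (fun r : ℝ => ⟪ξ, x + r • z⟫) ⟪ξ, z⟫ r := by
      simp only [inner_add_right, real_inner_smul_right]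
      simpa using ((hasDerivAt_id r).mul_const ⟪ξ, z⟫).const_add ⟪ξ, x⟫
    exact (h1.ofReal_comp.const_mul Complex.I).cexp

end
end S15

namespace S15
section
variable {d : ℕ} {α : ℝ} {η : Measure ℝ}

/-- Lévy–Khintchine kernel. -/
noncomputable def Kk (ξ z : Ed d) : ℂ :=
  Complex.exp (Complex.I * ⟪ξ, z⟫) - 1 - (if ‖z‖ ≤ 1 then Complex.I * ⟪ξ, z⟫ else 0)

lemma Kk_meas : Measurable (fun p : Ed d × Ed d => Kk p.1 p.2) := by
  unfold Kk
  refine Measurable.sub (by fun_prop) (Measurable.ite ?_ (by fun_prop) (by fun_prop))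
  exact measurableSet_le (by fun_prop) (by fun_prop)

lemma exp_bound (θ : ℝ) : ‖Complex.exp (Complex.I * θ) - 1 - Complex.I * θ‖ ≤ 3 * θ^2 := by
  have hn : ‖Complex.I * (θ:ℂ)‖ = |θ| := by simp
  by_cases h : |θ| ≤ 1
  · have := Complex.norm_exp_sub_one_sub_id_le (x := Complex.I * θ) (by rw [hn]; exact h)
    rw [hn, sq_abs] at this
    nlinarith [sq_nonneg θ]
  · push Not at h
    have h1 : ‖Complex.exp (Complex.I * θ) - 1 - Complex.I * θ‖ ≤ 1 + 1 + |θ| := by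
      refine (norm_sub_le _ _).trans ?_
      rw [hn]
      gcongr
      refine (norm_sub_le _ _).trans ?_
      rw [norm_e, norm_one]
    rw [← sq_abs]; nlinarith

lemma Kk_bound (ξ z : Ed d) : ‖Kk ξ z‖ ≤ (2 + 3 * ‖ξ‖^2) * min 1 (‖z‖^2) := by
  unfold Kk
  have hi := abs_real_inner_le_norm ξ z
  split_ifs with h
  · have : min 1 (‖z‖^2) = ‖z‖^2 := min_eq_right (by have := norm_nonneg z; nlinarith)
    rw [this]
    refine (exp_bound _).trans ?_
    have : ⟪ξ, z⟫^2 ≤ (‖ξ‖ * ‖z‖)^2 := by rw [← sq_abs]; gcongr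
    nlinarith [sq_nonneg ‖z‖]
  · push Not at h
    have : min 1 (‖z‖^2) = 1 := min_eq_left (by nlinarith)
    rw [this, sub_zero]
    refine (norm_sub_le _ _).trans ?_
    rw [norm_e, norm_one]; nlinarith [sq_nonneg ‖ξ‖]

lemma stableConst_pos (hα1 : 1 < α) (hα2 : α < 2) (d : ℕ) : 0 < stableConst d α := by
  have := Real.Gamma_pos_of_pos (s := 1 - α/2) (by linarith)
  have := Real.Gamma_pos_of_pos (s := ((d:ℝ) + α)/2) (by positivity)
  have := Real.pi_pos
  unfold stableConst; positivity

lemma Kk_int (hα1 : 1 < α) (hα2 : α < 2) (hd : 1 ≤ d) (ξ : Ed d) :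
    Integrable (fun z => Kk ξ z * ((stableConst d α * ‖z‖ ^ (-((d:ℝ) + α)) : ℝ) : ℂ)) := by
  have hA := stableConst_pos hα1 hα2 d
  refine (((levy_rad_int hα1 hα2 hd).const_mul (stableConst d α * (2 + 3 * ‖ξ‖^2)))).mono' ?_ (ae_of_all _ fun z => ?_)
  · refine Measurable.aestronglyMeasurable ((Kk_meas.comp (f := fun z : Ed d => (ξ, z)) (by fun_prop)).mul (by fun_prop))
  · have h0 : 0 ≤ stableConst d α * ‖z‖ ^ (-((d:ℝ) + α)) := by positivity
    rw [norm_mul, Complex.norm_real, Real.norm_of_nonneg h0]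
    calc _ ≤ ((2 + 3 * ‖ξ‖^2) * min 1 (‖z‖^2)) * (stableConst d α * ‖z‖ ^ (-((d:ℝ) + α))) := by
          gcongr; exact Kk_bound _ _
      _ = _ := by ring

lemma Kk_integral (hα1 : 1 < α) (hα2 : α < 2) (hd : 1 ≤ d) (ξ : Ed d) :
    ∫ z, Kk ξ z * ((stableConst d α * ‖z‖ ^ (-((d:ℝ) + α)) : ℝ) : ℂ) = ((-(‖ξ‖ ^ α) : ℝ) : ℂ) := by
  have hi := Kk_int hα1 hα2 hd ξ
  set J := ∫ z, Kk ξ z * ((stableConst d α * ‖z‖ ^ (-((d:ℝ) + α)) : ℝ) : ℂ) with hJ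
  have h1 : ∫ z, Kk ξ (-z) * ((stableConst d α * ‖z‖ ^ (-((d:ℝ) + α)) : ℝ) : ℂ) = J := by
    rw [hJ, ← integral_neg_eq_self]; simp only [norm_neg, neg_neg]
  have hi' : Integrable (fun z => Kk ξ (-z) * ((stableConst d α * ‖z‖ ^ (-((d:ℝ) + α)) : ℝ) : ℂ)) := by
    have := hi.comp_neg; simpa only [norm_neg] using this
  have h2 := integral_add hi hi'
  rw [h1, ← hJ] at h2
  have h3 : ∀ z : Ed d, Kk ξ z * ((stableConst d α * ‖z‖ ^ (-((d:ℝ) + α)) : ℝ) : ℂ) + Kk ξ (-z) * ((stableConst d α * ‖z‖ ^ (-((d:ℝ) + α)) : ℝ) : ℂ)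
     = (((-2) * ((1 - Real.cos ⟪ξ, z⟫) * (stableConst d α * ‖z‖ ^ (-((d:ℝ) + α)))) : ℝ) : ℂ) := by
    intro z
    rw [← add_mul]
    have : Kk ξ z + Kk ξ (-z) = (((-2) * (1 - Real.cos ⟪ξ, z⟫) : ℝ) : ℂ) := by
      unfold Kk
      rw [norm_neg, inner_neg_right]
      push_cast
      rw [Complex.cos, mul_comm Complex.I, mul_comm Complex.I]
      split_ifs <;> ring
    rw [this, ← Complex.ofReal_mul, mul_assoc]
  simp only [h3] at h2
  rw [integral_complex_ofReal, integral_const_mul, one_sub_cos_integral hα1 hα2 hd] at h2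
  have : J + J = 2 * J := by ring
  rw [this] at h2
  have h5 : J = 2⁻¹ * (2 * J) := by ring
  rw [h5, ← h2]; push_cast; ring

variable {f : Ed d → ℝ} {φ : Ed d → ℂ}

lemma fracLap_rep (hα1 : 1 < α) (hα2 : α < 2) (hd : 1 ≤ d) (hφ : Continuous φ) (hk : ∀ k : ℕ, Integrable (fun ξ => ‖ξ‖^k * ‖φ ξ‖))
    (hr : ∀ x, (f x : ℂ) = ∫ ξ, φ ξ * Complex.exp (Complex.I * ⟪ξ, x⟫)) (hf : Differentiable ℝ f) (x : Ed d) :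
    (fracLap d α f x : ℂ) = ∫ ξ, φ ξ * Complex.exp (Complex.I * ⟪ξ, x⟫) * ((-(‖ξ‖ ^ α) : ℝ) : ℂ) := by
  have hA := stableConst_pos hα1 hα2 d
  have hφi := phi_int hφ hk
  have hb : ∀ x : Ed d, Integrable (fun ξ => φ ξ * Complex.exp (Complex.I * ⟪ξ, x⟫)) := fun x =>
    hφi.mul_bdd (c := 1) (Continuous.aestronglyMeasurable (by fun_prop)) (ae_of_all _ fun ξ => (norm_e _).le)
  have hb2 : ∀ x z : Ed d, Integrable (fun ξ => φ ξ * Complex.exp (Complex.I * ⟪ξ, x⟫) * (Complex.I * ⟪ξ, z⟫)) := by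
    intro x z
    refine ((hk 1).mul_const ‖z‖).mono' (Continuous.aestronglyMeasurable (by fun_prop)) (ae_of_all _ fun ξ => ?_)
    rw [norm_mul, norm_mul, norm_e, mul_one, norm_mul, Complex.norm_I, one_mul, Complex.norm_real]
    have := norm_inner_le_norm (𝕜 := ℝ) ξ z
    calc _ ≤ ‖φ ξ‖ * (‖ξ‖ * ‖z‖) := by gcongr
      _ = _ := by ring
  have e1 : ∀ z, (((f (x + z) - f x - (if ‖z‖ ≤ 1 then ⟪gradient f x, z⟫ else 0)) * (stableConst d α * ‖z‖ ^ (-((d : ℝ) + α))) : ℝ) : ℂ)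
     = ∫ ξ, φ ξ * Complex.exp (Complex.I * ⟪ξ, x⟫) * (Kk ξ z * ((stableConst d α * ‖z‖ ^ (-((d:ℝ) + α)) : ℝ) : ℂ)) := by
    intro z
    have e2 : ((f (x + z) - f x - (if ‖z‖ ≤ 1 then ⟪gradient f x, z⟫ else 0) : ℝ) : ℂ) = ∫ ξ, φ ξ * Complex.exp (Complex.I * ⟪ξ, x⟫) * Kk ξ z := by
      have e3 : ∀ ξ : Ed d, Complex.exp (Complex.I * ⟪ξ, x + z⟫) = Complex.exp (Complex.I * ⟪ξ, x⟫) * Complex.exp (Complex.I * ⟪ξ, z⟫) := by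
        intro ξ; rw [← Complex.exp_add, inner_add_right]; push_cast; ring_nf
      by_cases hz : ‖z‖ ≤ 1
      · simp only [Kk, hz, if_true]
        rw [Complex.ofReal_sub, Complex.ofReal_sub, rep_hasFDerivAt hφ hk hr hf x z, hr (x+z), hr x, ← integral_sub (hb _) (hb _),
          ← integral_sub (f := fun ξ => φ ξ * Complex.exp (Complex.I * ⟪ξ, x+z⟫) - φ ξ * Complex.exp (Complex.I * ⟪ξ, x⟫)) ((hb _).sub (hb _)) (hb2 _ _)]
        congr 1; ext ξ
        rw [e3]; ring
      · simp only [Kk, hz, if_false, sub_zero]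
        rw [Complex.ofReal_sub, hr (x+z), hr x, ← integral_sub (hb _) (hb _)]
        congr 1; ext ξ
        rw [e3]; ring
    rw [Complex.ofReal_mul, e2, ← integral_mul_const]
    simp only [mul_assoc]
  unfold fracLap
  rw [← integral_complex_ofReal]
  simp only [e1]
  rw [integral_integral_swap]
  · congr 1; ext ξ
    rw [integral_const_mul, Kk_integral hα1 hα2 hd]
  · have hp : Integrable (fun p : Ed d × Ed d => (min 1 (‖p.1‖^2) * ‖p.1‖ ^ (-((d:ℝ) + α))) * (stableConst d α * (2 * (‖p.2‖^0 * ‖φ p.2‖) + 3 * (‖p.2‖^2 * ‖φ p.2‖)))) (volume.prod volume) := 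
      (levy_rad_int hα1 hα2 hd).mul_prod ((((hk 0).const_mul 2).add ((hk 2).const_mul 3)).const_mul _)
    refine hp.mono' ?_ (ae_of_all _ fun p => ?_)
    · refine Measurable.aestronglyMeasurable ?_
      have hφm := hφ.measurable
      have := (Kk_meas (d := d)).comp (f := fun p : Ed d × Ed d => (p.2, p.1)) (by fun_prop)
      simp only [Function.comp_def] at this
      simp only [Function.uncurry_def]
      fun_prop
    · obtain ⟨z, ξ⟩ := p
      simp only [Function.uncurry]
      have h0 : 0 ≤ stableConst d α * ‖z‖ ^ (-((d:ℝ) + α)) := by positivity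
      rw [norm_mul, norm_mul, norm_e, mul_one, norm_mul, Complex.norm_real, Real.norm_of_nonneg h0]
      calc _ ≤ ‖φ ξ‖ * (((2 + 3 * ‖ξ‖^2) * min 1 (‖z‖^2)) * (stableConst d α * ‖z‖ ^ (-((d:ℝ) + α)))) := by
            gcongr; exact Kk_bound _ _
        _ = _ := by ring

lemma Pt_rep (hα1 : 1 < α) (h : IsSub (α/2) η) (hφ : Continuous φ) (hk : ∀ k : ℕ, Integrable (fun ξ => ‖ξ‖^k * ‖φ ξ‖))
    (hr : ∀ x, (f x : ℂ) = ∫ ξ, φ ξ * Complex.exp (Complex.I * ⟪ξ, x⟫)) {t : ℝ} (ht : 0 < t) (x : Ed d) :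
    ((∫ w, pk d α η t w * f (x - w) : ℝ) : ℂ) = ∫ ξ, φ ξ * Complex.exp (Complex.I * ⟪ξ, x⟫) * ((Real.exp (-(t * ‖ξ‖ ^ α)) : ℝ) : ℂ) := by
  have := h.prob
  have hφi := phi_int hφ hk
  rw [← integral_complex_ofReal]
  have e1 : ∀ w, ((pk d α η t w * f (x - w) : ℝ) : ℂ) = ∫ ξ, φ ξ * Complex.exp (Complex.I * ⟪ξ, x⟫) * ((pk d α η t w : ℂ) * Complex.exp (Complex.I * ⟪-ξ, w⟫)) := by
    intro w
    rw [Complex.ofReal_mul, hr, ← integral_const_mul]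
    congr 1; ext ξ
    have : Complex.exp (Complex.I * ⟪ξ, x - w⟫) = Complex.exp (Complex.I * ⟪ξ, x⟫) * Complex.exp (Complex.I * ⟪-ξ, w⟫) := by
      rw [← Complex.exp_add, inner_sub_right, inner_neg_left]; push_cast; ring_nf
    rw [this]; ring
  simp only [e1]
  rw [integral_integral_swap]
  · congr 1; ext ξ
    rw [integral_const_mul, pk_char hα1 h ht, norm_neg]
  · have hp : Integrable (fun p : Ed d × Ed d => pk d α η t p.1 * ‖φ p.2‖) (volume.prod volume) := 
      (pk_integrable h ht).mul_prod hφi.norm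
    refine hp.mono' ?_ (ae_of_all _ fun p => ?_)
    · refine Measurable.aestronglyMeasurable ?_
      have hφm := hφ.measurable
      have := pk_meas_x (d := d) (α := α) (η := η) t
      simp only [Function.uncurry_def]
      fun_prop
    · obtain ⟨z, ξ⟩ := p
      simp only [Function.uncurry]
      rw [norm_mul, norm_mul, norm_e, mul_one, norm_mul, norm_e, mul_one, Complex.norm_real, Real.norm_of_nonneg (pk_nonneg h ht _), mul_comm]

lemma gen_pt (hα1 : 1 < α) (hα2 : α < 2) (hd : 1 ≤ d) (h : IsSub (α/2) η) (hf : ContDiff ℝ (⊤ : ℕ∞) f) (hfc : HasCompactSupport f) :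
    (∃ C : ℝ, ∀ t, 0 < t → ∀ x, |t⁻¹ * ((∫ w, pk d α η t w * f (x - w)) - f x)| ≤ C) ∧
    ∀ x, Tendsto (fun t => t⁻¹ * ((∫ w, pk d α η t w * f (x - w)) - f x)) (𝓝[>] 0) (𝓝 (fracLap d α f x)) := by
  obtain ⟨φ, hφ, hk, hr⟩ := four_rep hf hfc
  have hφi := phi_int hφ hk
  have hfd : Differentiable ℝ f := hf.differentiable (by simp)
  have ha : ∀ ξ : Ed d, ‖ξ‖^α ≤ ‖ξ‖^0 + ‖ξ‖^2 := by
    intro ξ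
    rcases le_total ‖ξ‖ 1 with h1 | h1
    · have := Real.rpow_le_one (norm_nonneg ξ) h1 (by linarith : 0 ≤ α)
      have : 0 ≤ ‖ξ‖^2 := by positivity
      simp; linarith
    · have := Real.rpow_le_rpow_of_exponent_le h1 hα2.le
      rw [Real.rpow_two] at this
      simp; linarith
  have hai : Integrable (fun ξ => ‖ξ‖^α * ‖φ ξ‖) := by
    refine ((hk 0).add (hk 2)).mono' ?_ (ae_of_all _ fun ξ => ?_)
    · have := hφ.measurable
      exact Measurable.aestronglyMeasurable (by fun_prop)
    · rw [Real.norm_of_nonneg (by positivity)]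
      simp only [Pi.add_apply]
      rw [← add_mul]
      gcongr; exact ha ξ
  have hb : ∀ x : Ed d, Integrable (fun ξ => φ ξ * Complex.exp (Complex.I * ⟪ξ, x⟫)) := fun x =>
    hφi.mul_bdd (c := 1) (Continuous.aestronglyMeasurable (by fun_prop)) (ae_of_all _ fun ξ => (norm_e _).le)
  have rep : ∀ t, 0 < t → ∀ x, ((t⁻¹ * ((∫ w, pk d α η t w * f (x - w)) - f x) : ℝ) : ℂ) = 
      ∫ ξ, φ ξ * Complex.exp (Complex.I * ⟪ξ, x⟫) * ((t⁻¹ * (Real.exp (-(t * ‖ξ‖ ^ α)) - 1) : ℝ) : ℂ) := by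
    intro t ht x
    rw [Complex.ofReal_mul, Complex.ofReal_sub, Pt_rep hα1 h hφ hk hr ht, hr x, ← integral_sub, ← integral_const_mul]
    · congr 1; ext ξ; push_cast; ring
    · refine (hb x).mul_bdd (c := 1) (Measurable.aestronglyMeasurable (by fun_prop)) (ae_of_all _ fun ξ => ?_)
      rw [Complex.norm_real, Real.norm_of_nonneg (Real.exp_pos _).le, Real.exp_le_one_iff]
      have : 0 ≤ t * ‖ξ‖^α := by positivity
      linarith
    · exact hb x
  have bd : ∀ t, 0 < t → ∀ x ξ : Ed d, ‖φ ξ * Complex.exp (Complex.I * ⟪ξ, x⟫) * ((t⁻¹ * (Real.exp (-(t * ‖ξ‖ ^ α)) - 1) : ℝ) : ℂ)‖ ≤ ‖ξ‖^α * ‖φ ξ‖ := by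
    intro t ht x ξ
    rw [norm_mul, norm_mul, norm_e, mul_one, Complex.norm_real, mul_comm, norm_mul, Real.norm_of_nonneg (by positivity)]
    gcongr
    have h1 := one_sub_exp_le (x := t * ‖ξ‖^α)
    have h2 : Real.exp (-(t * ‖ξ‖^α)) ≤ 1 := by
      rw [Real.exp_le_one_iff]
      have : 0 ≤ t * ‖ξ‖^α := by positivity
      linarith
    rw [Real.norm_eq_abs, abs_of_nonpos (by linarith), inv_mul_le_iff₀ ht]
    linarith
  constructor
  · refine ⟨∫ ξ, ‖ξ‖^α * ‖φ ξ‖, fun t ht x => ?_⟩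
    rw [← Real.norm_eq_abs, ← Complex.norm_real, rep t ht x]
    exact norm_integral_le_of_norm_le hai (ae_of_all _ (bd t ht x))
  · intro x
    have key : Tendsto (fun t : ℝ => ((t⁻¹ * ((∫ w, pk d α η t w * f (x - w)) - f x) : ℝ) : ℂ)) (𝓝[>] 0) (𝓝 (fracLap d α f x : ℂ)) := by
      rw [fracLap_rep hα1 hα2 hd hφ hk hr hfd]
      have e : (fun t : ℝ => ∫ ξ, φ ξ * Complex.exp (Complex.I * ⟪ξ, x⟫) * ((t⁻¹ * (Real.exp (-(t * ‖ξ‖ ^ α)) - 1) : ℝ) : ℂ)) =ᶠ[𝓝[>] 0] (fun t : ℝ => ((t⁻¹ * ((∫ w, pk d α η t w * f (x - w)) - f x) : ℝ) : ℂ)) := by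
        filter_upwards [self_mem_nhdsWithin] with t ht
        exact (rep t ht x).symm
      refine Tendsto.congr' e ?_
      refine tendsto_integral_filter_of_dominated_convergence _ ?_ ?_ hai ?_
      · refine Eventually.of_forall fun t => ?_
        have := hφ.measurable
        exact Measurable.aestronglyMeasurable (by fun_prop)
      · filter_upwards [self_mem_nhdsWithin] with t ht
        exact ae_of_all _ (bd t ht x)
      · refine ae_of_all _ fun ξ => ?_
        refine Tendsto.const_mul _ ?_
        refine (Complex.continuous_ofReal.tendsto _).comp ?_
        have hd1 : HasDerivAt (fun t : ℝ => Real.exp (-(t * ‖ξ‖^α))) (-(‖ξ‖^α)) 0 := by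
          have := ((hasDerivAt_id (0:ℝ)).mul_const (‖ξ‖^α)).neg.exp
          simpa using this
        have := hd1.tendsto_slope_zero_right
        simpa using this
    exact (Complex.continuous_re.tendsto _).comp key

end
end S15

namespace S15
section
variable {d : ℕ} {α : ℝ} {η : Measure ℝ}

lemma Pt_meas [SFinite η] {f : Ed d → ℝ} (hf : Measurable f) (t : ℝ) : StronglyMeasurable (fun x => ∫ w, pk d α η t w * f (x - w)) := by
  refine StronglyMeasurable.integral_prod_right (f := fun x w => pk d α η t w * f (x - w)) ?_
  have := pk_meas_x (d := d) (α := α) (η := η) t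
  refine Measurable.stronglyMeasurable ?_
  simp only [Function.uncurry_def]
  fun_prop

lemma gen_tendsto (hα1 : 1 < α) (hα2 : α < 2) (hd : 1 ≤ d) (h : IsSub (α/2) η) {f g : Ed d → ℝ} (hf : ContDiff ℝ (⊤ : ℕ∞) f) (hfc : HasCompactSupport f)
    (hg : Integrable g) :
    Integrable (fun x => fracLap d α f x * g x) ∧ 
    Tendsto (fun t => t⁻¹ * ∫ x, ((∫ w, pk d α η t w * f (x - w)) - f x) * g x) (𝓝[>] 0) (𝓝 (∫ x, fracLap d α f x * g x)) := by
  have := h.prob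
  obtain ⟨⟨C, hC⟩, hlim⟩ := gen_pt hα1 hα2 hd h hf hfc
  have hm : ∀ t : ℝ, AEStronglyMeasurable (fun x => t⁻¹ * ((∫ w, pk d α η t w * f (x - w)) - f x)) volume := fun t =>
    (((Pt_meas hf.continuous.measurable t).sub hf.continuous.stronglyMeasurable).const_mul _).aestronglyMeasurable
  constructor
  · refine hg.bdd_mul (c := C) ?_ (ae_of_all _ fun x => ?_)
    · exact aestronglyMeasurable_of_tendsto_ae (𝓝[>] (0:ℝ)) hm (ae_of_all _ hlim)
    · rw [Real.norm_eq_abs]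
      refine le_of_tendsto (hlim x).abs ?_
      filter_upwards [self_mem_nhdsWithin] with t ht using hC t ht x
  · have e : (fun t : ℝ => ∫ x, (t⁻¹ * ((∫ w, pk d α η t w * f (x - w)) - f x)) * g x) = (fun t => t⁻¹ * ∫ x, ((∫ w, pk d α η t w * f (x - w)) - f x) * g x) := by
      ext t; rw [← integral_const_mul]; simp only [mul_assoc]
    rw [← e]
    refine tendsto_integral_filter_of_dominated_convergence (fun x => C * |g x|) ?_ ?_ (hg.abs.const_mul C) ?_
    · exact Eventually.of_forall fun t => (hm t).mul hg.aestronglyMeasurable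
    · filter_upwards [self_mem_nhdsWithin] with t ht
      refine ae_of_all _ fun x => ?_
      rw [norm_mul, Real.norm_eq_abs, Real.norm_eq_abs]
      gcongr; exact hC t ht x
    · exact ae_of_all _ fun x => (hlim x).mul_const _

end
end S15

namespace S15
section
variable {d : ℕ} {α : ℝ} {η : Measure ℝ}

/-- polynomial weight -/
noncomputable def kw (d : ℕ) (w : Ed d) : ℝ≥0∞ := ENNReal.ofReal ((1 + ‖w‖) ^ (-((d:ℝ)+1)))

lemma kw_meas : Measurable (kw d) := by unfold kw; fun_prop

lemma kw_fin : ∫⁻ w, kw d w < ∞ := by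
  unfold kw
  exact finite_integral_one_add_norm (by rw [finrank_euclideanSpace_fin]; linarith)

lemma kato_term (hd : 1 ≤ d) (f : Ed d → ℝ) (hfm : Measurable f) (r : ℝ) (x : Ed d) :
    ∫⁻ y in Metric.ball x r, ‖f y‖ₑ * ENNReal.ofReal (‖x - y‖ ^ (-((d : ℝ) + 1 - α))) ≤ katoSup d α f r := by
  unfold katoSup
  refine le_trans (le_of_eq ?_) (le_iSup _ x)
  refine lintegral_congr fun y => ?_
  rw [ENNReal.ofReal_mul (abs_nonneg _), ← Real.norm_eq_abs, ofReal_norm]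

lemma kato_loc (hα2 : α < 2) (hd : 1 ≤ d) (f : Ed d → ℝ) (hfm : Measurable f) {r : ℝ} (hr : 0 < r) (x : Ed d) :
    ∫⁻ y in Metric.ball x r, ‖f y‖ₑ ≤ ENNReal.ofReal (r ^ ((d:ℝ) + 1 - α)) * katoSup d α f r := by
  have : Nonempty (Fin d) := ⟨⟨0, hd⟩⟩
  have hd' : (1:ℝ) ≤ d := by exact_mod_cast hd
  refine le_trans ?_ (mul_le_mul_right (kato_term hd f hfm r x) _)
  rw [← lintegral_const_mul _ (by fun_prop)]
  refine setLIntegral_mono_ae (by fun_prop) ?_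
  have h0 : ∀ᵐ z : Ed d, z ≠ x := Measure.ae_ne volume x
  filter_upwards [h0] with y hy hyr
  have h1 : 0 < ‖x - y‖ := norm_pos_iff.2 (sub_ne_zero.2 hy.symm)
  have h2 : ‖x - y‖ < r := by rw [← dist_eq_norm, dist_comm]; exact hyr
  rw [mul_left_comm, ← ENNReal.ofReal_mul (by positivity)]
  refine le_mul_of_one_le_right (zero_le) ?_
  rw [← ENNReal.ofReal_one]
  refine ENNReal.ofReal_le_ofReal ?_
  have : ‖x - y‖ ^ ((d:ℝ) + 1 - α) ≤ r ^ ((d:ℝ) + 1 - α) := Real.rpow_le_rpow h1.le h2.le (by linarith)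
  calc (1:ℝ) = ‖x - y‖ ^ ((d:ℝ) + 1 - α) * ‖x - y‖ ^ (-((d:ℝ) + 1 - α)) := by
        rw [← Real.rpow_add h1]; simp
    _ ≤ _ := by gcongr

lemma kw_shift {ρ : ℝ} (hρ : 0 < ρ) (w u : Ed d) (hu : ‖u‖ < ρ) :
    kw d w ≤ ENNReal.ofReal ((1 + ρ) ^ ((d:ℝ)+1)) * kw d (w + u) := by
  unfold kw
  rw [← ENNReal.ofReal_mul (by positivity)]
  refine ENNReal.ofReal_le_ofReal ?_
  have h1 : 1 + ‖w + u‖ ≤ (1 + ρ) * (1 + ‖w‖) := by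
    have := norm_add_le w u
    have := norm_nonneg w
    nlinarith
  rw [Real.rpow_neg (by positivity), Real.rpow_neg (by positivity), ← div_eq_mul_inv, inv_le_comm₀ (by positivity) (by positivity), inv_div,
    div_le_iff₀ (by positivity), ← Real.mul_rpow (by positivity) (by positivity), mul_comm]
  exact Real.rpow_le_rpow (by positivity) h1 (by positivity)

lemma kw_conv (hd : 1 ≤ d) {ρ : ℝ} (hρ : 0 < ρ) : ∃ C : ℝ≥0∞, C ≠ ∞ ∧ ∀ (B : Ed d → ℝ≥0∞), Measurable B → ∀ S : ℝ≥0∞,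
    (∀ x, ∫⁻ y in Metric.ball x ρ, B y ≤ S) → ∀ z, ∫⁻ y, B y * kw d (z - y) ≤ C * S := by
  have hV0 : volume (Metric.ball (0 : Ed d) ρ) ≠ 0 := (Metric.measure_ball_pos volume _ hρ).ne'
  have hVt : volume (Metric.ball (0 : Ed d) ρ) ≠ ∞ := measure_ball_lt_top.ne
  set V := volume (Metric.ball (0 : Ed d) ρ) with hV
  set c := ENNReal.ofReal ((1 + ρ) ^ ((d:ℝ)+1)) with hc
  refine ⟨V⁻¹ * (c * ∫⁻ w, kw d w), ENNReal.mul_ne_top (ENNReal.inv_ne_top.2 hV0) (ENNReal.mul_ne_top ENNReal.ofReal_ne_top kw_fin.ne), fun B hB S hS z => ?_⟩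
  have hkm := kw_meas (d := d)
  have h1 : V * ∫⁻ y, B y * kw d (z - y) ≤ c * ((∫⁻ w, kw d w) * S) := by
    calc V * ∫⁻ y, B y * kw d (z - y) = ∫⁻ u in Metric.ball (0 : Ed d) ρ, (∫⁻ y, B y * kw d (z - y)) := by
          rw [setLIntegral_const, mul_comm]
      _ ≤ ∫⁻ u in Metric.ball (0 : Ed d) ρ, (c * ∫⁻ v, B (v + u) * kw d (z - v)) := by
          refine setLIntegral_mono' measurableSet_ball fun u hu => ?_
          have hu : ‖u‖ < ρ := by simpa using hu
          rw [← lintegral_const_mul _ (by fun_prop), ← lintegral_add_right_eq_self _ u]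
          refine lintegral_mono fun v => ?_
          have := kw_shift hρ (z - (v + u)) u hu
          rw [show z - (v + u) + u = z - v by abel] at this
          calc _ ≤ B (v + u) * (c * kw d (z - v)) := by gcongr
            _ = _ := by ring
      _ = c * ∫⁻ v, kw d (z - v) * (∫⁻ u in Metric.ball (0 : Ed d) ρ, B (v + u)) := by
          rw [lintegral_const_mul _ (by fun_prop), lintegral_lintegral_swap (by fun_prop)]
          congr 1
          refine lintegral_congr fun v => ?_
          rw [← lintegral_const_mul _ (by fun_prop)]
          simp only [mul_comm]
      _ ≤ c * ∫⁻ v, kw d (z - v) * S := by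
          gcongr with v
          refine le_trans (le_of_eq ?_) (hS v)
          rw [← lintegral_indicator measurableSet_ball, ← lintegral_indicator measurableSet_ball]
          refine Eq.trans ?_ (lintegral_add_left_eq_self _ v)
          refine lintegral_congr fun u => ?_
          simp [Set.indicator]
      _ = c * ((∫⁻ w, kw d w) * S) := by
          rw [lintegral_mul_const _ (by fun_prop), lintegral_sub_left_eq_self]
  calc ∫⁻ y, B y * kw d (z - y) = V⁻¹ * (V * ∫⁻ y, B y * kw d (z - y)) := by
        rw [← mul_assoc, ENNReal.inv_mul_cancel hV0 hVt, one_mul]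
    _ ≤ V⁻¹ * (c * ((∫⁻ w, kw d w) * S)) := by gcongr
    _ = _ := by ring

end
end S15

namespace S15
section
variable {d : ℕ} {α : ℝ} {η : Measure ℝ}

lemma Dk_time (hα1 : 1 < α) (hα2 : α < 2) (hd : 1 ≤ d) (h : IsSub (α/2) η) : ∃ C : ℝ≥0∞, C ≠ ∞ ∧ ∀ w : Ed d, w ≠ 0 →
    (∫⁻ r in Set.Ioi (0:ℝ), ‖Dk d α η r w‖ₑ ≤ C * ENNReal.ofReal (‖w‖ ^ (-((d:ℝ)+1-α)))) ∧
    ∀ T : ℝ, ∫⁻ r in Set.Ioc (0:ℝ) T, ‖Dk d α η r w‖ₑ ≤ C * (ENNReal.ofReal T * ENNReal.ofReal (‖w‖ ^ (-((d:ℝ)+1)))) := by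
  obtain ⟨C, hC, hDC⟩ := Dk_bound (d := d) (α := α) (η := η) (by linarith) h
  have hd' : (1:ℝ) ≤ d := by exact_mod_cast hd
  have hα0 : 0 < α := by linarith
  set a : ℝ := -((d:ℝ)+1)/α with ha
  have ha1 : a < -1 := by
    rw [ha, div_lt_iff₀ hα0]; linarith
  have key : ∀ w : Ed d, w ≠ 0 → ∀ T : ℝ, ∫⁻ r in Set.Ioc (0:ℝ) T, ‖Dk d α η r w‖ₑ ≤ ENNReal.ofReal C * (ENNReal.ofReal T * ENNReal.ofReal (‖w‖ ^ (-((d:ℝ)+1)))) := by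
    intro w hw T
    have hw0 : 0 < ‖w‖ := norm_pos_iff.2 hw
    calc ∫⁻ r in Set.Ioc (0:ℝ) T, ‖Dk d α η r w‖ₑ ≤ ∫⁻ r in Set.Ioc (0:ℝ) T, ENNReal.ofReal (C * ‖w‖ ^ (-((d:ℝ)+1))) := by
          refine setLIntegral_mono' measurableSet_Ioc fun r hr => ?_
          rw [← ofReal_norm]
          refine ENNReal.ofReal_le_ofReal ?_
          have h1 := (hDC r hr.1 w).1
          rw [Real.rpow_neg hw0.le, ← div_eq_mul_inv, le_div_iff₀ (by positivity), mul_comm]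
          have : ‖w‖ ^ ((d:ℝ)+1) = ‖w‖ ^ (d+1) := by rw [← Real.rpow_natCast]; push_cast; rfl
          rw [this]; exact h1
      _ = _ := by
          rw [setLIntegral_const, Real.volume_Ioc, ENNReal.ofReal_mul hC.le, sub_zero]; ring
  refine ⟨ENNReal.ofReal C + ENNReal.ofReal (C * (-(a+1))⁻¹), ENNReal.add_ne_top.2 ⟨ENNReal.ofReal_ne_top, ENNReal.ofReal_ne_top⟩, fun w hw => ⟨?_, fun T => ?_⟩⟩
  · have hw0 : 0 < ‖w‖ := norm_pos_iff.2 hw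
    set R := ‖w‖ ^ α with hR
    have hR0 : 0 < R := by positivity
    have hs : Set.Ioi (0:ℝ) = Set.Ioc 0 R ∪ Set.Ioi R := (Set.Ioc_union_Ioi_eq_Ioi hR0.le).symm
    rw [hs, add_mul]
    refine (lintegral_union_le _ _ _).trans (add_le_add ?_ ?_)
    · refine (key w hw R).trans (le_of_eq ?_)
      rw [← ENNReal.ofReal_mul hR0.le, hR, ← Real.rpow_add hw0]
      congr 3; ring
    · calc ∫⁻ r in Set.Ioi R, ‖Dk d α η r w‖ₑ ≤ ∫⁻ r in Set.Ioi R, ENNReal.ofReal (C * r ^ a) := by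
            refine setLIntegral_mono' measurableSet_Ioi fun r hr => ?_
            rw [← ofReal_norm]
            exact ENNReal.ofReal_le_ofReal (hDC r (hR0.trans hr) w).2
        _ = ENNReal.ofReal (∫ r in Set.Ioi R, C * r ^ a) := by
            rw [ofReal_integral_eq_lintegral_ofReal ((integrableOn_Ioi_rpow_of_lt ha1 hR0).const_mul C)]
            filter_upwards [ae_restrict_mem measurableSet_Ioi] with r hr
            have : 0 < r := hR0.trans hr
            simp only [Pi.zero_apply]; positivity
        _ = _ := by
            rw [integral_const_mul, integral_Ioi_rpow_of_lt ha1 hR0, ← ENNReal.ofReal_mul (by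
              apply mul_nonneg hC.le; rw [inv_nonneg]; linarith)]
            congr 1
            rw [hR, ← Real.rpow_mul hw0.le, show α * (a+1) = -((d:ℝ)+1-α) by rw [ha]; field_simp; ring]
            rw [neg_div, ← div_neg, div_eq_mul_inv]; ring
  · refine (key w hw T).trans ?_
    gcongr
    exact le_self_add

lemma far_kw {ρ : ℝ} (hρ : 0 < ρ) (w : Ed d) (hw : ρ ≤ ‖w‖) :
    ENNReal.ofReal (‖w‖ ^ (-((d:ℝ)+1))) ≤ ENNReal.ofReal (((1+ρ)/ρ) ^ ((d:ℝ)+1)) * kw d w := by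
  unfold kw
  have hw0 : 0 < ‖w‖ := hρ.trans_le hw
  rw [← ENNReal.ofReal_mul (by positivity)]
  refine ENNReal.ofReal_le_ofReal ?_
  rw [Real.rpow_neg (by positivity), Real.rpow_neg (by positivity), ← div_eq_mul_inv, inv_le_comm₀ (by positivity) (by positivity), inv_div,
    div_le_iff₀ (by positivity), ← Real.mul_rpow (by positivity) (by positivity)]
  refine Real.rpow_le_rpow (by positivity) ?_ (by positivity)
  rw [mul_div_assoc', le_div_iff₀ hρ]
  nlinarith

/-- the main Kato estimate -/
lemma kato_main (hα1 : 1 < α) (hα2 : α < 2) (hd : 1 ≤ d) (h : IsSub (α/2) η) : ∃ C : ℝ≥0∞, C ≠ ∞ ∧ ∀ ρ : ℝ, 0 < ρ → ∃ Cρ : ℝ≥0∞, Cρ ≠ ∞ ∧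
    ∀ f : Ed d → ℝ, Measurable f → ∀ T : ℝ, ∀ z,
    ∫⁻ y, (∫⁻ r in Set.Ioc (0:ℝ) T, ‖Dk d α η r (z - y)‖ₑ) * ‖f y‖ₑ ≤ (C + ENNReal.ofReal T * Cρ) * katoSup d α f ρ := by
  have := h.prob
  have : Nonempty (Fin d) := ⟨⟨0, hd⟩⟩
  obtain ⟨C, hC, hE⟩ := Dk_time (d := d) hα1 hα2 hd h
  refine ⟨C, hC, fun ρ hρ => ?_⟩
  obtain ⟨C2, hC2, hconv⟩ := kw_conv hd hρ
  set c3 := ENNReal.ofReal (((1+ρ)/ρ) ^ ((d:ℝ)+1)) with hc3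
  refine ⟨C * c3 * C2 * ENNReal.ofReal (ρ ^ ((d:ℝ)+1-α)), by finiteness, fun f hf T z => ?_⟩
  have h0 : ∀ᵐ y : Ed d, y ≠ z := Measure.ae_ne volume z
  have hkm := kw_meas (d := d)
  rw [← lintegral_add_compl _ (measurableSet_ball (x := z) (ε := ρ)), add_mul]
  refine add_le_add ?_ ?_
  · refine le_trans ?_ (mul_le_mul_right (kato_term hd f hf ρ z) _)
    rw [← lintegral_const_mul _ (by fun_prop)]
    refine setLIntegral_mono_ae (by fun_prop) ?_
    filter_upwards [h0] with y hy _
    have h1 := (hE (z - y) (sub_ne_zero.2 hy.symm)).1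
    calc _ ≤ (C * ENNReal.ofReal (‖z - y‖ ^ (-((d:ℝ)+1-α)))) * ‖f y‖ₑ := by
          gcongr
          exact (lintegral_mono_set Set.Ioc_subset_Ioi_self).trans h1
      _ = _ := by ring
  · calc _ ≤ ∫⁻ y in (Metric.ball z ρ)ᶜ, (C * c3 * ENNReal.ofReal T) * (‖f y‖ₑ * kw d (z - y)) := by
          refine setLIntegral_mono' measurableSet_ball.compl fun y hy => ?_
          have hy' : ρ ≤ ‖z - y‖ := by
            rw [← dist_eq_norm, dist_comm]; simpa using hy
          have hne : z - y ≠ 0 := norm_pos_iff.1 (hρ.trans_le hy')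
          have h1 := (hE (z - y) hne).2 T
          have h2 := far_kw hρ (z - y) hy'
          calc _ ≤ (C * (ENNReal.ofReal T * (c3 * kw d (z - y)))) * ‖f y‖ₑ := by
                gcongr
                exact h1.trans (by gcongr)
            _ = _ := by ring
      _ ≤ ∫⁻ y, (C * c3 * ENNReal.ofReal T) * (‖f y‖ₑ * kw d (z - y)) := setLIntegral_le_lintegral _ _
      _ ≤ (C * c3 * ENNReal.ofReal T) * (C2 * (ENNReal.ofReal (ρ ^ ((d:ℝ)+1-α)) * katoSup d α f ρ)) := by
          rw [lintegral_const_mul _ (by fun_prop)]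
          gcongr
          exact hconv (fun y => ‖f y‖ₑ) (by fun_prop) _ (fun x => kato_loc hα2 hd f hf hρ x) z
      _ = _ := by ring

end
end S15

namespace S15
section
variable {d : ℕ} {α : ℝ} {η : Measure ℝ}

lemma katoSup_bdd (hα1 : 1 < α) (hα2 : α < 2) (hd : 1 ≤ d) (f : Ed d → ℝ) {M : ℝ} (hM : ∀ x, |f x| ≤ M) :
    katoSup d α f 1 ≠ ∞ := by
  have : Nonempty (Fin d) := ⟨⟨0, hd⟩⟩
  have hd' : (1:ℝ) ≤ d := by exact_mod_cast hd
  have hi := levy_rad_int (d := d) (α := 3 - α) (by linarith) (by linarith) hd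
  set F := fun z : Ed d => min 1 (‖z‖^2) * ‖z‖ ^ (-((d:ℝ) + (3 - α))) with hF
  have hfin : ∫⁻ z, ENNReal.ofReal (M * F z) ≠ ∞ := ((hi.const_mul M).lintegral_lt_top).ne
  refine ne_top_of_le_ne_top hfin ?_
  unfold katoSup
  refine iSup_le fun x => ?_
  calc _ ≤ ∫⁻ y in Metric.ball x 1, ENNReal.ofReal (M * F (x - y)) := by
        refine setLIntegral_mono_ae (by simp only [hF]; fun_prop) ?_
        have h0 : ∀ᵐ z : Ed d, z ≠ x := Measure.ae_ne volume x
        filter_upwards [h0] with y hy hyr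
        have h1 : 0 < ‖x - y‖ := norm_pos_iff.2 (sub_ne_zero.2 hy.symm)
        have h2 : ‖x - y‖ < 1 := by rw [← dist_eq_norm, dist_comm]; exact hyr
        refine ENNReal.ofReal_le_ofReal ?_
        have h3 : F (x - y) = ‖x - y‖ ^ (-((d:ℝ) + 1 - α)) := by
          simp only [hF]
          rw [min_eq_right (by nlinarith), ← Real.rpow_natCast, ← Real.rpow_add h1]
          congr 1; push_cast; ring
        rw [h3]
        gcongr
        exact hM y
    _ ≤ ∫⁻ y, ENNReal.ofReal (M * F (x - y)) := setLIntegral_le_lintegral _ _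
    _ = _ := lintegral_sub_left_eq_self (fun z => ENNReal.ofReal (M * F z)) x

lemma kato_small (hα1 : 1 < α) (hα2 : α < 2) (hd : 1 ≤ d) (h : IsSub (α/2) η) (f : Ed d → ℝ) (hf : Measurable f)
    (hb : Tendsto (katoSup d α f) (𝓝[>] (0 : ℝ)) (𝓝 0)) {ε : ℝ≥0∞} (hε : 0 < ε) :
    ∃ T > 0, ∀ z, ∫⁻ y, (∫⁻ r in Set.Ioc (0:ℝ) T, ‖Dk d α η r (z - y)‖ₑ) * ‖f y‖ₑ ≤ ε := by
  obtain ⟨C, hC, hK⟩ := kato_main (d := d) hα1 hα2 hd h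
  have h1 : Tendsto (fun ρ => C * katoSup d α f ρ) (𝓝[>] (0 : ℝ)) (𝓝 0) := by
    simpa using ENNReal.Tendsto.const_mul hb (Or.inr hC)
  have hε2 : 0 < ε / 2 := ENNReal.half_pos hε.ne'
  have h2 : ∀ᶠ ρ in 𝓝[>] (0:ℝ), C * katoSup d α f ρ ≤ ε / 2 ∧ katoSup d α f ρ ≤ 1 ∧ 0 < ρ :=
    (h1.eventually (eventually_le_nhds hε2)).and ((hb.eventually (eventually_le_nhds one_pos)).and self_mem_nhdsWithin)
  obtain ⟨ρ, ha, hb1, hρ⟩ := h2.exists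
  obtain ⟨Cρ, hCρ, hK2⟩ := hK ρ hρ
  have h3 : Tendsto (fun T : ℝ => ENNReal.ofReal T * Cρ) (𝓝[>] (0 : ℝ)) (𝓝 0) := by
    have : Tendsto (fun T : ℝ => ENNReal.ofReal T * Cρ) (𝓝 (0 : ℝ)) (𝓝 (ENNReal.ofReal 0 * Cρ)) :=
      ENNReal.Tendsto.mul_const (ENNReal.continuous_ofReal.tendsto 0) (Or.inr hCρ)
    simp only [ENNReal.ofReal_zero, zero_mul] at this
    exact this.mono_left nhdsWithin_le_nhds
  obtain ⟨T, hT, hT0⟩ := ((h3.eventually (eventually_le_nhds hε2)).and self_mem_nhdsWithin).exists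
  refine ⟨T, hT0, fun z => (hK2 f hf T z).trans ?_⟩
  rw [add_mul, ← ENNReal.add_halves ε]
  refine add_le_add ha ?_
  calc _ ≤ ε / 2 * 1 := by gcongr
    _ = _ := mul_one _

lemma kato_finite (hα1 : 1 < α) (hα2 : α < 2) (hd : 1 ≤ d) (h : IsSub (α/2) η) (f : Ed d → ℝ) (hf : Measurable f)
    {M : ℝ} (hM : ∀ x, |f x| ≤ M) (T : ℝ) :
    ∃ K : ℝ≥0∞, K ≠ ∞ ∧ ∀ z, ∫⁻ y, (∫⁻ r in Set.Ioc (0:ℝ) T, ‖Dk d α η r (z - y)‖ₑ) * ‖f y‖ₑ ≤ K := by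
  obtain ⟨C, hC, hK⟩ := kato_main (d := d) hα1 hα2 hd h
  obtain ⟨Cρ, hCρ, hK2⟩ := hK 1 one_pos
  have := katoSup_bdd hα1 hα2 hd f hM
  exact ⟨_, by finiteness, fun z => hK2 f hf T z⟩

lemma kw_neg (w : Ed d) : kw d (-w) = kw d w := by unfold kw; rw [norm_neg]

lemma kw_ne_top (w : Ed d) : kw d w ≠ ∞ := ENNReal.ofReal_ne_top

lemma kato_kw (hα1 : 1 < α) (hα2 : α < 2) (hd : 1 ≤ d) (f : Ed d → ℝ) (hf : Measurable f)
    (hb : Tendsto (katoSup d α f) (𝓝[>] (0 : ℝ)) (𝓝 0)) : ∫⁻ y, ‖f y‖ₑ * kw d y ≠ ∞ := by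
  obtain ⟨ρ, hb1, hρ⟩ := ((hb.eventually (eventually_le_nhds one_pos)).and self_mem_nhdsWithin).exists
  obtain ⟨C2, hC2, hconv⟩ := kw_conv hd hρ
  have := hconv (fun y => ‖f y‖ₑ) (by fun_prop) _ (fun x => kato_loc hα2 hd f hf hρ x) 0
  simp only [zero_sub, kw_neg] at this
  have hk : katoSup d α f ρ ≠ ∞ := ne_top_of_le_ne_top ENNReal.one_ne_top hb1
  exact ne_top_of_le_ne_top (by finiteness) this

/-- decay of `P_s |g|` -/
lemma A0_bound (hα1 : 1 < α) (hα2 : α < 2) (hd : 1 ≤ d) (h : IsSub (α/2) η) (g : Ed d → ℝ) (hg : Measurable g) (hgc : HasCompactSupport g)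
    {M : ℝ} (hM : ∀ x, |g x| ≤ M) : ∃ C : ℝ≥0∞, C ≠ ∞ ∧ ∀ s, 0 < s → s ≤ 1 → ∀ z,
      ∫⁻ x, ‖g x‖ₑ * ‖pk d α η s (x - z)‖ₑ ≤ C * kw d z := by
  have := h.prob
  have : Nonempty (Fin d) := ⟨⟨0, hd⟩⟩
  obtain ⟨C, hC, hpk⟩ := pk_bound (d := d) (α := α) (η := η) (by linarith) h hd
  obtain ⟨R, hR⟩ := hgc.isCompact.isBounded.subset_closedBall (0 : Ed d)
  set R' := max R 0
  have hR' : ∀ x, g x ≠ 0 → ‖x‖ ≤ R' := fun x hx => by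
    have := hR (subset_tsupport _ hx)
    simp at this
    exact this.trans (le_max_left _ _)
  have hR0 : 0 ≤ R' := le_max_right _ _
  have hM0 : 0 ≤ M := (abs_nonneg _).trans (hM 0)
  set c := (1 + R') ^ (d+1) * 2 ^ d with hc
  have hc0 : 0 < c := by positivity
  have hgfin : ∫⁻ x, ‖g x‖ₑ ≠ ∞ := by
    rw [← setLIntegral_eq_of_support_subset (s := tsupport g)]
    · refine ne_top_of_le_ne_top ?_ (setLIntegral_mono' (isClosed_tsupport g).measurableSet (g := fun _ => ENNReal.ofReal M) fun x _ => ?_)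
      · rw [setLIntegral_const]
        exact ENNReal.mul_ne_top ENNReal.ofReal_ne_top hgc.isCompact.measure_lt_top.ne
      · rw [← ofReal_norm]; exact ENNReal.ofReal_le_ofReal (hM x)
    · intro x hx
      exact subset_tsupport g (by simpa using hx)
  refine ⟨ENNReal.ofReal (c * M) + ENNReal.ofReal (c * C) * ∫⁻ x, ‖g x‖ₑ, by finiteness, fun s hs hs1 z => ?_⟩
  have key : ∀ x, ‖g x‖ₑ * ‖pk d α η s (x - z)‖ₑ ≤
      (ENNReal.ofReal (c * M) * ENNReal.ofReal (pk d α η s (x - z)) + ENNReal.ofReal (c * C) * ‖g x‖ₑ) * kw d z := by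
    intro x
    by_cases hx : g x = 0
    · simp [hx]
    have hx' := hR' x hx
    have hp0 := pk_nonneg (d := d) (α := α) h hs (x - z)
    have h1 : (1 + ‖z‖) ^ (d+1) * pk d α η s (x - z) ≤ c * (pk d α η s (x - z) + C) := by
      have e1 : 1 + ‖z‖ ≤ (1 + R') * (1 + ‖x - z‖) := by
        have : ‖z‖ ≤ ‖x‖ + ‖x - z‖ := by
          have := norm_sub_le x (x - z); simpa using this
        nlinarith [norm_nonneg (x - z)]
      have e2 : (1 + ‖x - z‖) ^ (d+1) ≤ 2 ^ d * (1 + ‖x - z‖ ^ (d+1)) := by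
        have := add_pow_le (zero_le_one' ℝ) (norm_nonneg (x - z)) (d+1)
        simpa using this
      have e3 := hpk s hs (x - z)
      have e4 : s ^ (1/α) ≤ 1 := Real.rpow_le_one hs.le hs1 (by positivity)
      calc (1 + ‖z‖) ^ (d+1) * pk d α η s (x - z) ≤ ((1 + R') * (1 + ‖x - z‖)) ^ (d+1) * pk d α η s (x - z) := by gcongr
        _ = (1 + R') ^ (d+1) * (1 + ‖x - z‖) ^ (d+1) * pk d α η s (x - z) := by rw [mul_pow (1 + R')]
        _ ≤ (1 + R') ^ (d+1) * (2 ^ d * (1 + ‖x - z‖ ^ (d+1))) * pk d α η s (x - z) := by gcongr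
        _ = c * (pk d α η s (x - z) + ‖x - z‖ ^ (d+1) * pk d α η s (x - z)) := by rw [hc]; ring
        _ ≤ c * (pk d α η s (x - z) + C) := by
          gcongr
          refine e3.trans ?_
          nlinarith
    have hkw : kw d z = ENNReal.ofReal (((1 + ‖z‖) ^ (d+1))⁻¹) := by
      unfold kw
      rw [Real.rpow_neg (by positivity)]; congr 2
      rw [← Real.rpow_natCast]; push_cast; rfl
    rw [hkw, ← ofReal_norm, ← ofReal_norm, ← ENNReal.ofReal_mul (by positivity), ← ENNReal.ofReal_mul (by positivity), ← ENNReal.ofReal_mul (by positivity),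
      ← ENNReal.ofReal_add (by positivity) (by positivity), ← ENNReal.ofReal_mul (by positivity)]
    refine ENNReal.ofReal_le_ofReal ?_
    rw [← div_eq_mul_inv, le_div_iff₀ (by positivity), Real.norm_of_nonneg hp0]
    have hgx : ‖g x‖ ≤ M := hM x
    calc _ = ‖g x‖ * ((1 + ‖z‖) ^ (d+1) * pk d α η s (x - z)) := by ring
      _ ≤ ‖g x‖ * (c * (pk d α η s (x - z) + C)) := by gcongr
      _ = c * ‖g x‖ * pk d α η s (x - z) + c * C * ‖g x‖ := by ring
      _ ≤ _ := by gcongr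
  have hpm := pk_meas_x (d := d) (α := α) (η := η) s
  calc _ ≤ _ := lintegral_mono key
    _ = _ := by
      rw [lintegral_mul_const _ (by fun_prop), lintegral_add_left (by fun_prop), lintegral_const_mul _ (by fun_prop), lintegral_const_mul _ (by fun_prop),
        lintegral_sub_right_eq_self (fun w => ENNReal.ofReal (pk d α η s w)) z, pk_lintegral h hs, mul_one]

end
end S15

namespace S15
section
variable {d : ℕ} {α : ℝ} {η : Measure ℝ} {b : Ed d → Ed d}

open Classical in
/-- `Dk` cut off at nonpositive times -/
noncomputable def D0 (d : ℕ) (α : ℝ) (η : Measure ℝ) (t : ℝ) (x : Ed d) : Ed d :=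
  if 0 < t then Dk d α η t x else 0

open Classical in
/-- globally defined version of the series -/
noncomputable def qs (d : ℕ) (α : ℝ) (η : Measure ℝ) (b : Ed d → Ed d) : ℕ → ℝ → Ed d → Ed d → ℝ
  | 0, t, x, y => if 0 < t then pk d α η t (x - y) else 0
  | k + 1, t, x, y => ∫ s, ∫ z, qs d α η b k s x z * ⟪b z, D0 d α η (t - s) (z - y)⟫

lemma D0_meas [SFinite η] : Measurable (fun p : ℝ × Ed d => D0 d α η p.1 p.2) := by
  unfold D0
  exact Measurable.ite (measurableSet_lt measurable_const measurable_fst) Dk_meas measurable_const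

lemma D0_meas' [SFinite η] {X : Type*} [MeasurableSpace X] {u : X → ℝ} {v : X → Ed d} (hu : Measurable u) (hv : Measurable v) :
    Measurable (fun p => D0 d α η (u p) (v p)) := D0_meas.comp (hu.prodMk hv)

lemma qs_meas [SFinite η] (hb : Measurable b) (k : ℕ) : Measurable (fun p : ℝ × Ed d × Ed d => qs d α η b k p.1 p.2.1 p.2.2) := by
  induction k with
  | zero =>
    unfold qs
    refine Measurable.ite (measurableSet_lt measurable_const measurable_fst) ?_ measurable_const
    exact pk_meas.comp (f := fun p : ℝ × Ed d × Ed d => (p.1, p.2.1 - p.2.2)) (by fun_prop)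
  | succ k ih =>
    simp only [qs]
    refine StronglyMeasurable.measurable (StronglyMeasurable.integral_prod_right
      (f := fun (p : ℝ × Ed d × Ed d) (s : ℝ) => ∫ z, qs d α η b k s p.2.1 z * ⟪b z, D0 d α η (p.1 - s) (z - p.2.2)⟫) ?_)
    refine (StronglyMeasurable.integral_prod_right
      (f := fun (q : (ℝ × Ed d × Ed d) × ℝ) (z : Ed d) => qs d α η b k q.2 q.1.2.1 z * ⟪b z, D0 d α η (q.1.1 - q.2) (z - q.1.2.2)⟫) ?_)
    refine Measurable.stronglyMeasurable ?_
    refine Measurable.mul ?_ (Measurable.inner ?_ ?_)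
    · exact ih.comp (f := fun p : ((ℝ × Ed d × Ed d) × ℝ) × Ed d => (p.1.2, p.1.1.2.1, p.2)) (by fun_prop)
    · fun_prop
    · exact D0_meas' (by fun_prop) (by fun_prop)

lemma qs_meas' [SFinite η] (hb : Measurable b) (k : ℕ) {X : Type*} [MeasurableSpace X] {u : X → ℝ} {v w : X → Ed d} (hu : Measurable u) (hv : Measurable v)
    (hw : Measurable w) : Measurable (fun p => qs d α η b k (u p) (v p) (w p)) := (qs_meas hb k).comp (hu.prodMk (hv.prodMk hw))

lemma qs_nonpos (k : ℕ) : ∀ {t : ℝ}, t ≤ 0 → ∀ x y, qs d α η b k t x y = 0 := by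
  induction k with
  | zero => intro t ht x y; simp [qs, not_lt.2 ht]
  | succ k ih =>
    intro t ht x y
    simp only [qs]
    rw [integral_eq_zero_of_ae]
    refine ae_of_all _ fun s => ?_
    dsimp only [Pi.zero_apply]
    rw [integral_eq_zero_of_ae]
    refine ae_of_all _ fun z => ?_
    rcases le_or_gt s 0 with hs | hs
    · simp [ih hs]
    · have : ¬ (0 < t - s) := by linarith
      simp [D0, this]

lemma qs_eq (hα1 : 1 < α) (hd : 1 ≤ d) (h : IsSub (α/2) η) (k : ℕ) : ∀ {t : ℝ}, 0 < t → ∀ x y, qSeries d α b k t x y = qs d α η b k t x y := by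
  induction k with
  | zero => intro t ht x y; simp [qs, qSeries, ht, stableP_eq hα1 hd h ht]
  | succ k ih =>
    intro t ht x y
    simp only [qs, qSeries]
    rw [integral_Ioc_eq_integral_Ioo]
    rw [← integral_indicator measurableSet_Ioo]
    refine integral_congr_ae (ae_of_all _ fun s => ?_)
    by_cases hs : s ∈ Set.Ioo 0 t
    · rw [Set.indicator_of_mem hs]
      refine integral_congr_ae (ae_of_all _ fun z => ?_)
      have h1 : 0 < t - s := by linarith [hs.2]
      simp only [D0, h1, if_true]
      rw [ih hs.1, grad_stableP hα1 hd h h1]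
    · rw [Set.indicator_of_notMem hs]
      dsimp only
      rw [integral_eq_zero_of_ae]
      refine ae_of_all _ fun z => ?_
      rcases le_or_gt s 0 with hs0 | hs0
      · simp [qs_nonpos k hs0]
      · have : ¬ (0 < t - s) := fun h => hs ⟨hs0, by linarith⟩
        simp [D0, this]

/-- weighted absolute mass of the series terms -/
noncomputable def Ak (d : ℕ) (α : ℝ) (η : Measure ℝ) (b : Ed d → Ed d) (g : Ed d → ℝ) (k : ℕ) (s : ℝ) (z : Ed d) : ℝ≥0∞ :=
  ∫⁻ x, ‖g x‖ₑ * ‖qs d α η b k s x z‖ₑ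

/-- upper bound for `Ak (k+1)` -/
noncomputable def Wk (d : ℕ) (α : ℝ) (η : Measure ℝ) (b : Ed d → Ed d) (g : Ed d → ℝ) (k : ℕ) (t : ℝ) (y : Ed d) : ℝ≥0∞ :=
  ∫⁻ p : ℝ × Ed d, Ak d α η b g k p.1 p.2 * ‖b p.2‖ₑ * ‖D0 d α η (t - p.1) (p.2 - y)‖ₑ

/-- total mass -/
noncomputable def Uk (d : ℕ) (α : ℝ) (η : Measure ℝ) (b : Ed d → Ed d) (g : Ed d → ℝ) (k : ℕ) (T : ℝ) : ℝ≥0∞ :=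
  ∫⁻ p in (Set.Iic T ×ˢ Set.univ : Set (ℝ × Ed d)), Ak d α η b g k p.1 p.2 * ‖b p.2‖ₑ

variable {g : Ed d → ℝ}

lemma Ak_meas [SFinite η] (hb : Measurable b) (hg : Measurable g) (k : ℕ) : Measurable (fun p : ℝ × Ed d => Ak d α η b g k p.1 p.2) := by
  unfold Ak
  refine Measurable.lintegral_prod_right' (f := fun q : (ℝ × Ed d) × Ed d => ‖g q.2‖ₑ * ‖qs d α η b k q.1.1 q.2 q.1.2‖ₑ) ?_
  have := qs_meas' (α := α) (η := η) hb k (X := (ℝ × Ed d) × Ed d) (u := fun q => q.1.1) (v := fun q => q.2) (w := fun q => q.1.2) (by fun_prop) (by fun_prop) (by fun_prop)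
  fun_prop

lemma Ak_meas' [SFinite η] (hb : Measurable b) (hg : Measurable g) (k : ℕ) {X : Type*} [MeasurableSpace X] {u : X → ℝ} {v : X → Ed d}
    (hu : Measurable u) (hv : Measurable v) : Measurable (fun p => Ak d α η b g k (u p) (v p)) := (Ak_meas hb hg k).comp (hu.prodMk hv)

lemma Ak_nonpos (k : ℕ) {s : ℝ} (hs : s ≤ 0) (z : Ed d) : Ak d α η b g k s z = 0 := by
  simp [Ak, qs_nonpos k hs]

lemma Wk_meas [SFinite η] (hb : Measurable b) (hg : Measurable g) (k : ℕ) : Measurable (fun p : ℝ × Ed d => Wk d α η b g k p.1 p.2) := by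
  unfold Wk
  refine Measurable.lintegral_prod_right' (f := fun q : (ℝ × Ed d) × (ℝ × Ed d) => Ak d α η b g k q.2.1 q.2.2 * ‖b q.2.2‖ₑ * ‖D0 d α η (q.1.1 - q.2.1) (q.2.2 - q.1.2)‖ₑ) ?_
  have h1 := Ak_meas' (α := α) (η := η) hb hg k (X := (ℝ × Ed d) × (ℝ × Ed d)) (u := fun q => q.2.1) (v := fun q => q.2.2) (by fun_prop) (by fun_prop)
  have h2 := D0_meas' (d := d) (α := α) (η := η) (X := (ℝ × Ed d) × (ℝ × Ed d)) (u := fun q => q.1.1 - q.2.1) (v := fun q => q.2.2 - q.1.2) (by fun_prop) (by fun_prop)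
  fun_prop

lemma qs_succ_le [SFinite η] (hb : Measurable b) (k : ℕ) (t : ℝ) (x y : Ed d) :
    ‖qs d α η b (k+1) t x y‖ₑ ≤ ∫⁻ p : ℝ × Ed d, ‖qs d α η b k p.1 x p.2‖ₑ * (‖b p.2‖ₑ * ‖D0 d α η (t - p.1) (p.2 - y)‖ₑ) := by
  have h1 := qs_meas' (α := α) (η := η) hb k (X := (ℝ × Ed d)) (u := fun q => q.1) (v := fun q => x) (w := fun q => q.2) (by fun_prop) (by fun_prop) (by fun_prop)
  have h2 := D0_meas' (d := d) (α := α) (η := η) (X := (ℝ × Ed d)) (u := fun q => t - q.1) (v := fun q => q.2 - y) (by fun_prop) (by fun_prop)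
  rw [Measure.volume_eq_prod, lintegral_prod _ (by fun_prop)]
  simp only [qs]
  refine (enorm_integral_le_lintegral_enorm _).trans (lintegral_mono fun s => ?_)
  refine (enorm_integral_le_lintegral_enorm _).trans (lintegral_mono fun z => ?_)
  rw [enorm_mul]
  gcongr
  rw [← ofReal_norm, ← ofReal_norm, ← ofReal_norm, ← ENNReal.ofReal_mul (norm_nonneg _)]
  exact ENNReal.ofReal_le_ofReal (norm_inner_le_norm _ _)

lemma Ak_succ_le [SFinite η] (hb : Measurable b) (hg : Measurable g) (k : ℕ) (t : ℝ) (y : Ed d) :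
    Ak d α η b g (k+1) t y ≤ Wk d α η b g k t y := by
  have h1 := qs_meas' (α := α) (η := η) hb k (X := Ed d × (ℝ × Ed d)) (u := fun q => q.2.1) (v := fun q => q.1) (w := fun q => q.2.2) (by fun_prop) (by fun_prop) (by fun_prop)
  have h1' := fun p : ℝ × Ed d => qs_meas' (α := α) (η := η) hb k (X := Ed d) (u := fun q => p.1) (v := fun q => q) (w := fun q => p.2) (by fun_prop) (by fun_prop) (by fun_prop)
  have h1'' := fun x : Ed d => qs_meas' (α := α) (η := η) hb k (X := ℝ × Ed d) (u := fun q => q.1) (v := fun q => x) (w := fun q => q.2) (by fun_prop) (by fun_prop) (by fun_prop)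
  have h2 := D0_meas' (d := d) (α := α) (η := η) (X := Ed d × (ℝ × Ed d)) (u := fun q => t - q.2.1) (v := fun q => q.2.2 - y) (by fun_prop) (by fun_prop)
  have h2' := D0_meas' (d := d) (α := α) (η := η) (X := (ℝ × Ed d)) (u := fun q => t - q.1) (v := fun q => q.2 - y) (by fun_prop) (by fun_prop)
  calc Ak d α η b g (k+1) t y ≤ ∫⁻ x, ∫⁻ p : ℝ × Ed d, ‖g x‖ₑ * (‖qs d α η b k p.1 x p.2‖ₑ * (‖b p.2‖ₑ * ‖D0 d α η (t - p.1) (p.2 - y)‖ₑ)) := by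
        unfold Ak
        refine lintegral_mono fun x => ?_
        have := h1'' x
        rw [lintegral_const_mul _ (by fun_prop)]
        gcongr
        exact qs_succ_le hb k t x y
    _ = ∫⁻ p : ℝ × Ed d, ∫⁻ x, ‖g x‖ₑ * (‖qs d α η b k p.1 x p.2‖ₑ * (‖b p.2‖ₑ * ‖D0 d α η (t - p.1) (p.2 - y)‖ₑ)) := by
        rw [lintegral_lintegral_swap]
        simp only [Function.uncurry_def]
        fun_prop
    _ = Wk d α η b g k t y := by
        unfold Wk
        refine lintegral_congr fun p => ?_
        have := h1' p
        unfold Ak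
        simp only [← mul_assoc]
        rw [lintegral_mul_const _ (by fun_prop), lintegral_mul_const _ (by fun_prop)]

lemma Wk_time [SFinite η] (hb : Measurable b) (hg : Measurable g) (k : ℕ) {φ : Ed d → ℝ≥0∞} (hφ : Measurable φ) (T : ℝ) {K : ℝ≥0∞}
    (hK : ∀ z, ∫⁻ y, (∫⁻ r in Set.Ioc (0:ℝ) T, ‖Dk d α η r (z - y)‖ₑ) * φ y ≤ K) :
    ∫⁻ q in (Set.Iic T ×ˢ Set.univ : Set (ℝ × Ed d)), Wk d α η b g k q.1 q.2 * φ q.2 ≤ K * Uk d α η b g k T := by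
  have hDm := Dk_meas (d := d) (α := α) (η := η)
  set S := (Set.Iic T ×ˢ Set.univ : Set (ℝ × Ed d)) with hS
  have hSm : MeasurableSet S := measurableSet_Iic.prod MeasurableSet.univ
  have h1 := Ak_meas' (α := α) (η := η) hb hg k (X := (ℝ × Ed d) × (ℝ × Ed d)) (u := fun q => q.2.1) (v := fun q => q.2.2) (by fun_prop) (by fun_prop)
  have h1' := Ak_meas' (α := α) (η := η) hb hg k (X := (ℝ × Ed d)) (u := fun q => q.1) (v := fun q => q.2) (by fun_prop) (by fun_prop)
  have h2 := D0_meas' (d := d) (α := α) (η := η) (X := (ℝ × Ed d) × (ℝ × Ed d)) (u := fun q => q.1.1 - q.2.1) (v := fun q => q.2.2 - q.1.2) (by fun_prop) (by fun_prop)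
  have h2' := fun q : ℝ × Ed d => D0_meas' (d := d) (α := α) (η := η) (X := (ℝ × Ed d)) (u := fun p => q.1 - p.1) (v := fun p => p.2 - q.2) (by fun_prop) (by fun_prop)
  have h2'' := fun p : ℝ × Ed d => D0_meas' (d := d) (α := α) (η := η) (X := (ℝ × Ed d)) (u := fun q => q.1 - p.1) (v := fun q => p.2 - q.2) (by fun_prop) (by fun_prop)
  have hin : ∀ p : ℝ × Ed d, 0 < p.1 → ∫⁻ q in S, ‖D0 d α η (q.1 - p.1) (p.2 - q.2)‖ₑ * φ q.2 ≤ S.indicator (fun _ => K) p := by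
    intro p hp
    have e1 : ∀ q : ℝ × Ed d, S.indicator (fun q => ‖D0 d α η (q.1 - p.1) (p.2 - q.2)‖ₑ * φ q.2) q ≤
        S.indicator (fun _ => 1) p * ((Set.Ioc 0 T).indicator (fun r => ‖Dk d α η r (p.2 - q.2)‖ₑ) (q.1 - p.1) * φ q.2) := by
      intro q
      by_cases hq : q ∈ S
      · rw [Set.indicator_of_mem hq]
        have hq1 : q.1 ≤ T := hq.1
        by_cases hpos : 0 < q.1 - p.1
        · have hpS : p ∈ S := ⟨by show p.1 ≤ T; linarith, trivial⟩
          rw [Set.indicator_of_mem hpS, one_mul, Set.indicator_of_mem (show q.1 - p.1 ∈ Set.Ioc 0 T from ⟨hpos, by linarith⟩)]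
          simp [D0, hpos]
        · simp [D0, hpos]
      · rw [Set.indicator_of_notMem hq]; exact bot_le
    rw [← lintegral_indicator hSm]
    refine (lintegral_mono e1).trans ?_
    have e2 : Measurable (fun q : ℝ × Ed d => (Set.Ioc 0 T).indicator (fun r => ‖Dk d α η r (p.2 - q.2)‖ₑ) (q.1 - p.1)) := by
      have : (fun q : ℝ × Ed d => (Set.Ioc 0 T).indicator (fun r => ‖Dk d α η r (p.2 - q.2)‖ₑ) (q.1 - p.1)) =
          Set.indicator ((fun q : ℝ × Ed d => q.1 - p.1) ⁻¹' (Set.Ioc 0 T)) (fun q => ‖Dk d α η (q.1 - p.1) (p.2 - q.2)‖ₑ) := by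
        ext q; simp [Set.indicator]
      rw [this]
      refine Measurable.indicator ?_ ((by fun_prop : Measurable fun q : ℝ × Ed d => q.1 - p.1) measurableSet_Ioc)
      exact (hDm.comp (f := fun q : ℝ × Ed d => (q.1 - p.1, p.2 - q.2)) (by fun_prop)).enorm
    rw [lintegral_const_mul _ (by fun_prop), Measure.volume_eq_prod, lintegral_prod_symm _ (by fun_prop)]
    have e3 : ∀ y : Ed d, ∫⁻ t, (Set.Ioc 0 T).indicator (fun r => ‖Dk d α η r (p.2 - y)‖ₑ) (t - p.1) * φ y =
        (∫⁻ r in Set.Ioc (0:ℝ) T, ‖Dk d α η r (p.2 - y)‖ₑ) * φ y := by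
      intro y
      rw [lintegral_mul_const _ (by exact e2.comp (f := fun t : ℝ => (t, y)) (by fun_prop)),
        lintegral_sub_right_eq_self (fun r => (Set.Ioc 0 T).indicator (fun r => ‖Dk d α η r (p.2 - y)‖ₑ) r) p.1, lintegral_indicator measurableSet_Ioc]
    simp only [e3]
    calc _ ≤ S.indicator (fun _ => 1) p * K := by gcongr; exact hK p.2
      _ = _ := by by_cases hp : p ∈ S <;> simp [hp]
  calc ∫⁻ q in S, Wk d α η b g k q.1 q.2 * φ q.2
      = ∫⁻ q in S, ∫⁻ p : ℝ × Ed d, Ak d α η b g k p.1 p.2 * ‖b p.2‖ₑ * ‖D0 d α η (q.1 - p.1) (p.2 - q.2)‖ₑ * φ q.2 := by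
        refine lintegral_congr fun q => ?_
        have := h2' q
        unfold Wk
        rw [← lintegral_mul_const _ (by fun_prop)]
    _ = ∫⁻ p : ℝ × Ed d, ∫⁻ q in S, Ak d α η b g k p.1 p.2 * ‖b p.2‖ₑ * ‖D0 d α η (q.1 - p.1) (p.2 - q.2)‖ₑ * φ q.2 := by
        rw [lintegral_lintegral_swap]
        simp only [Function.uncurry_def]
        fun_prop
    _ = ∫⁻ p : ℝ × Ed d, (Ak d α η b g k p.1 p.2 * ‖b p.2‖ₑ) * ∫⁻ q in S, ‖D0 d α η (q.1 - p.1) (p.2 - q.2)‖ₑ * φ q.2 := by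
        refine lintegral_congr fun p => ?_
        have := h2'' p
        rw [← lintegral_const_mul _ (by fun_prop)]
        simp only [mul_assoc]
    _ ≤ ∫⁻ p : ℝ × Ed d, S.indicator (fun p => K * (Ak d α η b g k p.1 p.2 * ‖b p.2‖ₑ)) p := by
        refine lintegral_mono fun p => ?_
        rcases le_or_gt p.1 0 with hp | hp
        · simp [Ak_nonpos k hp]
        · calc _ ≤ (Ak d α η b g k p.1 p.2 * ‖b p.2‖ₑ) * S.indicator (fun _ => K) p := by gcongr; exact hin p hp
            _ = _ := by by_cases hp : p ∈ S <;> simp [hp, mul_comm]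
    _ = K * Uk d α η b g k T := by
        rw [lintegral_indicator hSm, lintegral_const_mul _ (by fun_prop), Uk]

lemma Uk_succ [SFinite η] (hb : Measurable b) (hg : Measurable g) (k : ℕ) (T : ℝ) {K : ℝ≥0∞}
    (hK : ∀ z, ∫⁻ y, (∫⁻ r in Set.Ioc (0:ℝ) T, ‖Dk d α η r (z - y)‖ₑ) * ‖b y‖ₑ ≤ K) :
    Uk d α η b g (k+1) T ≤ K * Uk d α η b g k T := by
  refine le_trans ?_ (Wk_time hb hg k (φ := fun y => ‖b y‖ₑ) (by fun_prop) T hK)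
  unfold Uk
  refine lintegral_mono fun p => ?_
  dsimp only
  gcongr
  exact Ak_succ_le hb hg k p.1 p.2

lemma Uk_le [SFinite η] (hb : Measurable b) (hg : Measurable g) (T : ℝ) {K : ℝ≥0∞}
    (hK : ∀ z, ∫⁻ y, (∫⁻ r in Set.Ioc (0:ℝ) T, ‖Dk d α η r (z - y)‖ₑ) * ‖b y‖ₑ ≤ K) (k : ℕ) :
    Uk d α η b g k T ≤ K ^ k * Uk d α η b g 0 T := by
  induction k with
  | zero => simp
  | succ k ih => 
    refine (Uk_succ hb hg k T hK).trans ?_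
    calc _ ≤ K * (K ^ k * Uk d α η b g 0 T) := by gcongr
      _ = _ := by ring

end
end S15

namespace S15
section
variable {d : ℕ} {α : ℝ} {η : Measure ℝ} {b : Ed d → Ed d} {f g : Ed d → ℝ}

/-- pairing of the series terms with test functions -/
noncomputable def Jk (d : ℕ) (α : ℝ) (η : Measure ℝ) (b : Ed d → Ed d) (f g : Ed d → ℝ) (k : ℕ) (t : ℝ) : ℝ :=
  ∫ p : Ed d × Ed d, g p.1 * qs d α η b k t p.1 p.2 * f p.2

/-- the disintegrated integrand -/
noncomputable def Hk (d : ℕ) (α : ℝ) (η : Measure ℝ) (b : Ed d → Ed d) (f g : Ed d → ℝ) (k : ℕ) (t : ℝ) (q : ℝ × Ed d) : ℝ :=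
  (∫ x, g x * qs d α η b k q.1 x q.2) * (∫ y, f y * ⟪b q.2, D0 d α η (t - q.1) (q.2 - y)⟫)

/-- absolute bound -/
noncomputable def Rk (d : ℕ) (α : ℝ) (η : Measure ℝ) (b : Ed d → Ed d) (f g : Ed d → ℝ) (k : ℕ) (t : ℝ) : ℝ≥0∞ :=
  ∫⁻ y, Wk d α η b g k t y * ‖f y‖ₑ

lemma Jk_lint [SFinite η] (hb : Measurable b) (hf : Measurable f) (hg : Measurable g) (k : ℕ) (t : ℝ) :
    ∫⁻ p : Ed d × Ed d, ‖g p.1 * qs d α η b (k+1) t p.1 p.2 * f p.2‖ₑ ≤ Rk d α η b f g k t := by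
  have h1 := qs_meas' (α := α) (η := η) hb (k+1) (X := Ed d × Ed d) (u := fun q => t) (v := fun q => q.1) (w := fun q => q.2) (by fun_prop) (by fun_prop) (by fun_prop)
  have h1' := fun y => qs_meas' (α := α) (η := η) hb (k+1) (X := Ed d) (u := fun q => t) (v := fun q => q) (w := fun q => y) (by fun_prop) (by fun_prop) (by fun_prop)
  rw [Measure.volume_eq_prod, lintegral_prod_symm _ (by fun_prop), Rk]
  refine lintegral_mono fun y => ?_
  have := h1' y
  simp only [enorm_mul]
  rw [lintegral_mul_const _ (by fun_prop)]
  gcongr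
  exact Ak_succ_le hb hg k t y

lemma Jk_succ [SFinite η] (hb : Measurable b) (hf : Measurable f) (hg : Measurable g) (k : ℕ) (t : ℝ) (hR : Rk d α η b f g k t ≠ ∞) :
    Jk d α η b f g (k+1) t = ∫ q : ℝ × Ed d, Hk d α η b f g k t q := by
  set F : (Ed d × Ed d) → (ℝ × Ed d) → ℝ := fun p q => (g p.1 * qs d α η b k q.1 p.1 q.2) * (f p.2 * ⟪b q.2, D0 d α η (t - q.1) (q.2 - p.2)⟫) with hF
  have m1 := qs_meas' (α := α) (η := η) hb k (X := (Ed d × Ed d) × (ℝ × Ed d)) (u := fun q => q.2.1) (v := fun q => q.1.1) (w := fun q => q.2.2) (by fun_prop) (by fun_prop) (by fun_prop)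
  have m2 := D0_meas' (d := d) (α := α) (η := η) (X := (Ed d × Ed d) × (ℝ × Ed d)) (u := fun q => t - q.2.1) (v := fun q => q.2.2 - q.1.2) (by fun_prop) (by fun_prop)
  have m1' := fun q : ℝ × Ed d => qs_meas' (α := α) (η := η) hb k (X := Ed d) (u := fun x => q.1) (v := fun x => x) (w := fun x => q.2) (by fun_prop) (by fun_prop) (by fun_prop)
  have m2' := fun q : ℝ × Ed d => D0_meas' (d := d) (α := α) (η := η) (X := Ed d) (u := fun y => t - q.1) (v := fun y => q.2 - y) (by fun_prop) (by fun_prop)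
  have m3 := D0_meas' (d := d) (α := α) (η := η) (X := (Ed d) × (ℝ × Ed d)) (u := fun q => t - q.2.1) (v := fun q => q.2.2 - q.1) (by fun_prop) (by fun_prop)
  have m3' := fun y : Ed d => D0_meas' (d := d) (α := α) (η := η) (X := ℝ × Ed d) (u := fun q => t - q.1) (v := fun q => q.2 - y) (by fun_prop) (by fun_prop)
  have m4 := Ak_meas' (α := α) (η := η) hb hg k (X := Ed d × (ℝ × Ed d)) (u := fun q => q.2.1) (v := fun q => q.2.2) (by fun_prop) (by fun_prop)
  have m4' := Ak_meas' (α := α) (η := η) hb hg k (X := (ℝ × Ed d)) (u := fun q => q.1) (v := fun q => q.2) (by fun_prop) (by fun_prop)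
  have hFm : Measurable (Function.uncurry F) := by
    simp only [hF, Function.uncurry_def]
    exact Measurable.mul (by fun_prop) (Measurable.mul (by fun_prop) (Measurable.inner (by fun_prop) m2))
  have hFi : Integrable (Function.uncurry F) (volume.prod volume) := by
    refine ⟨hFm.aestronglyMeasurable, ?_⟩
    refine lt_of_le_of_lt ?_ hR.lt_top
    rw [lintegral_prod_symm _ (by fun_prop)]
    calc _ ≤ ∫⁻ q : ℝ × Ed d, Ak d α η b g k q.1 q.2 * ∫⁻ y, ‖f y‖ₑ * (‖b q.2‖ₑ * ‖D0 d α η (t - q.1) (q.2 - y)‖ₑ) := by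
          refine lintegral_mono fun q => ?_
          have := m1' q
          have := m2' q
          calc _ ≤ ∫⁻ p : Ed d × Ed d, (‖g p.1‖ₑ * ‖qs d α η b k q.1 p.1 q.2‖ₑ) * (‖f p.2‖ₑ * (‖b q.2‖ₑ * ‖D0 d α η (t - q.1) (q.2 - p.2)‖ₑ)) := by
                refine lintegral_mono fun p => ?_
                simp only [hF, Function.uncurry_def, enorm_mul]
                gcongr
                rw [← ofReal_norm, ← ofReal_norm, ← ofReal_norm, ← ENNReal.ofReal_mul (norm_nonneg _)]
                exact ENNReal.ofReal_le_ofReal (norm_inner_le_norm _ _)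
            _ = _ := by
                rw [Measure.volume_eq_prod, lintegral_prod_mul (f := fun x => ‖g x‖ₑ * ‖qs d α η b k q.1 x q.2‖ₑ)
                  (g := fun y => ‖f y‖ₑ * (‖b q.2‖ₑ * ‖D0 d α η (t - q.1) (q.2 - y)‖ₑ)) (by fun_prop) (by fun_prop), Ak]
      _ = ∫⁻ q : ℝ × Ed d, ∫⁻ y, Ak d α η b g k q.1 q.2 * (‖f y‖ₑ * (‖b q.2‖ₑ * ‖D0 d α η (t - q.1) (q.2 - y)‖ₑ)) := by
          refine lintegral_congr fun q => ?_
          have := m2' q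
          rw [lintegral_const_mul _ (by fun_prop)]
      _ = ∫⁻ y, ∫⁻ q : ℝ × Ed d, Ak d α η b g k q.1 q.2 * (‖f y‖ₑ * (‖b q.2‖ₑ * ‖D0 d α η (t - q.1) (q.2 - y)‖ₑ)) := by
          rw [lintegral_lintegral_swap]
          refine Measurable.aemeasurable ?_
          simp only [Function.uncurry_def]
          have e := (show Measurable (fun z : Ed d × (ℝ × Ed d) => Ak d α η b g k z.2.1 z.2.2 * (‖f z.1‖ₑ * (‖b z.2.2‖ₑ * ‖D0 d α η (t - z.2.1) (z.2.2 - z.1)‖ₑ))) by fun_prop)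
          exact e.comp measurable_swap
      _ = _ := by
          unfold Rk Wk
          refine lintegral_congr fun y => ?_
          have := m3' y
          rw [← lintegral_mul_const _ (by fun_prop)]
          refine lintegral_congr fun q => ?_
          ring
  have e1 : Jk d α η b f g (k+1) t = ∫ p, ∫ q, F p q := by
    unfold Jk
    refine integral_congr_ae ?_
    filter_upwards [hFi.prod_right_ae] with p hp
    have hp' : Integrable (fun q => F p q) (volume.prod volume) := hp
    rw [Measure.volume_eq_prod, integral_prod _ hp']
    simp only [qs, hF]
    rw [mul_right_comm, ← integral_const_mul]
    refine integral_congr_ae (ae_of_all _ fun s => ?_)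
    dsimp only
    rw [← integral_const_mul]
    refine integral_congr_ae (ae_of_all _ fun z => ?_)
    dsimp only
    ring
  rw [e1, integral_integral_swap hFi]
  refine integral_congr_ae (ae_of_all _ fun q => ?_)
  simp only [hF, Hk]
  rw [Measure.volume_eq_prod, integral_prod_mul (fun x => g x * qs d α η b k q.1 x q.2) (fun y => f y * ⟪b q.2, D0 d α η (t - q.1) (q.2 - y)⟫)]

lemma G_bound (hα1 : 1 < α) (hd : 1 ≤ d) (h : IsSub (α/2) η) (hf : ContDiff ℝ 1 f) (hfc : HasCompactSupport f) {M : ℝ} (hM : ∀ x, ‖gradient f x‖ ≤ M)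
    {r : ℝ} (hr : 0 < r) (z v : Ed d) : ‖∫ y, f y * ⟪v, D0 d α η r (z - y)⟫‖ₑ ≤ ENNReal.ofReal M * ‖v‖ₑ := by
  simp only [D0, hr, if_true]
  rw [G_eq hα1 hd h hf hfc hr]
  have := pk_conv_le (d := d) h (k := fun x => ⟪v, gradient f x⟫) (C := M * ‖v‖) (fun x => by
    rw [← Real.norm_eq_abs, mul_comm]
    exact (norm_inner_le_norm _ _).trans (by gcongr; exact hM x)) hr z
  have hM0 : 0 ≤ M := (norm_nonneg _).trans (hM 0)
  rw [← ofReal_norm, ← ofReal_norm, ← ENNReal.ofReal_mul hM0]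
  exact ENNReal.ofReal_le_ofReal this

lemma Hk_bound (hα1 : 1 < α) (hd : 1 ≤ d) (h : IsSub (α/2) η) (hf : ContDiff ℝ 1 f) (hfc : HasCompactSupport f) {M : ℝ} (hM : ∀ x, ‖gradient f x‖ ≤ M)
    (k : ℕ) (t : ℝ) (q : ℝ × Ed d) : ‖Hk d α η b f g k t q‖ₑ ≤ (Set.Iio t ×ˢ Set.univ : Set (ℝ × Ed d)).indicator
      (fun q => ENNReal.ofReal M * (Ak d α η b g k q.1 q.2 * ‖b q.2‖ₑ)) q := by
  unfold Hk
  by_cases hq : q.1 < t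
  · rw [Set.indicator_of_mem (show q ∈ (Set.Iio t ×ˢ Set.univ : Set (ℝ × Ed d)) from ⟨hq, trivial⟩), enorm_mul]
    calc _ ≤ Ak d α η b g k q.1 q.2 * (ENNReal.ofReal M * ‖b q.2‖ₑ) := by
          gcongr
          · refine (enorm_integral_le_lintegral_enorm _).trans (le_of_eq ?_)
            simp only [enorm_mul, Ak]
          · exact G_bound hα1 hd h hf hfc hM (by linarith) _ _
      _ = _ := by ring
  · have : ¬ (0 < t - q.1) := by linarith
    simp [D0, this]

lemma Jk_bound (hα1 : 1 < α) (hd : 1 ≤ d) (h : IsSub (α/2) η) (hb : Measurable b) (hg : Measurable g) (hf : ContDiff ℝ 1 f) (hfc : HasCompactSupport f) {M : ℝ}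
    (hM : ∀ x, ‖gradient f x‖ ≤ M) (k : ℕ) (t : ℝ) (hR : Rk d α η b f g k t ≠ ∞) :
    ‖Jk d α η b f g (k+1) t‖ₑ ≤ ENNReal.ofReal M * Uk d α η b g k t := by
  have := h.prob
  rw [Jk_succ hb hf.continuous.measurable hg k t hR]
  have m4' := Ak_meas' (α := α) (η := η) hb hg k (X := (ℝ × Ed d)) (u := fun q => q.1) (v := fun q => q.2) (by fun_prop) (by fun_prop)
  refine (enorm_integral_le_lintegral_enorm _).trans ?_
  refine (lintegral_mono (Hk_bound hα1 hd h hf hfc hM k t)).trans ?_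
  rw [lintegral_indicator (measurableSet_Iio.prod MeasurableSet.univ), lintegral_const_mul _ (by fun_prop)]
  gcongr
  unfold Uk
  refine lintegral_mono_set ?_
  exact Set.prod_mono Set.Iio_subset_Iic_self le_rfl

lemma J0_int (hα1 : 1 < α) (hd : 1 ≤ d) (h : IsSub (α/2) η) (hf : Integrable f) (hg : Integrable g) (hfm : Measurable f) (hgm : Measurable g) (hb : Measurable b) (t : ℝ) :
    Integrable (fun p : Ed d × Ed d => g p.1 * qs d α η b 0 t p.1 p.2 * f p.2) := by
  have := h.prob
  have h1 := qs_meas' (α := α) (η := η) hb 0 (X := Ed d × Ed d) (u := fun q => t) (v := fun q => q.1) (w := fun q => q.2) (by fun_prop) (by fun_prop) (by fun_prop)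
  rcases le_or_gt t 0 with ht | ht
  · simp [qs_nonpos 0 ht]
  obtain ⟨C, hC⟩ := pk_bound0 (d := d) (α := α) (β := α/2) (by linarith) h hd ht
  refine ((hg.mul_prod hf).const_mul C).mono (by fun_prop) (ae_of_all _ fun p => ?_)
  have h0 := pk_nonneg (α := α) h ht (p.1 - p.2)
  have h2 := hC (p.1 - p.2)
  simp only [qs, ht, if_true, norm_mul, Real.norm_of_nonneg h0, Real.norm_of_nonneg (h0.trans h2)]
  calc _ = pk d α η t (p.1 - p.2) * (‖g p.1‖ * ‖f p.2‖) := by ring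
    _ ≤ _ := by gcongr

lemma J0_eq (hα1 : 1 < α) (hd : 1 ≤ d) (h : IsSub (α/2) η) (hf : Integrable f) (hg : Integrable g) (hfm : Measurable f) (hgm : Measurable g) (hb : Measurable b) {t : ℝ} (ht : 0 < t) :
    Integrable (fun x => (∫ w, pk d α η t w * f (x - w)) * g x) ∧ Jk d α η b f g 0 t = ∫ x, (∫ w, pk d α η t w * f (x - w)) * g x := by
  have hi := J0_int (b := b) hα1 hd h hf hg hfm hgm hb t
  have e : ∀ x, ∫ y, g x * qs d α η b 0 t x y * f y = (∫ w, pk d α η t w * f (x - w)) * g x := by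
    intro x
    simp only [qs, ht, if_true]
    rw [mul_comm, ← integral_const_mul, ← integral_sub_left_eq_self _ volume x]
    refine integral_congr_ae (ae_of_all _ fun y => ?_)
    simp only [sub_sub_cancel]; ring
  rw [Measure.volume_eq_prod] at hi
  constructor
  · simpa only [e] using hi.integral_prod_left
  · unfold Jk
    rw [Measure.volume_eq_prod, integral_prod _ hi]
    simp only [e]

end
end S15

namespace S15
section
variable {d : ℕ} {α : ℝ} {η : Measure ℝ} {b : Ed d → Ed d} {f g : Ed d → ℝ}

lemma Hk_meas [SFinite η] (hb : Measurable b) (hf : Measurable f) (hg : Measurable g) (k : ℕ) (t : ℝ) : Measurable (Hk d α η b f g k t) := by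
  unfold Hk
  refine Measurable.mul ?_ ?_
  · refine StronglyMeasurable.measurable (StronglyMeasurable.integral_prod_right
      (f := fun (q : ℝ × Ed d) (x : Ed d) => g x * qs d α η b k q.1 x q.2) ?_)
    refine Measurable.stronglyMeasurable ?_
    have := qs_meas' (α := α) (η := η) hb k (X := (ℝ × Ed d) × Ed d) (u := fun q => q.1.1) (v := fun q => q.2) (w := fun q => q.1.2) (by fun_prop) (by fun_prop) (by fun_prop)
    simp only [Function.uncurry_def]
    fun_prop
  · refine StronglyMeasurable.measurable (StronglyMeasurable.integral_prod_right
      (f := fun (q : ℝ × Ed d) (y : Ed d) => f y * ⟪b q.2, D0 d α η (t - q.1) (q.2 - y)⟫) ?_)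
    refine Measurable.stronglyMeasurable ?_
    simp only [Function.uncurry_def]
    refine Measurable.mul (by fun_prop) (Measurable.inner (by fun_prop) (D0_meas' (by fun_prop) (by fun_prop)))

lemma Hk_zero (t : ℝ) (q : ℝ × Ed d) (hq : q.1 ∉ Set.Ioo 0 t) (k : ℕ) : Hk d α η b f g k t q = 0 := by
  unfold Hk
  rcases le_or_gt q.1 0 with h0 | h0
  · simp [qs_nonpos k h0]
  · have : ¬ (0 < t - q.1) := fun h => hq ⟨h0, by linarith⟩
    simp [D0, this]

lemma H0_eq (hα1 : 1 < α) (hd : 1 ≤ d) (h : IsSub (α/2) η) (hf : ContDiff ℝ 1 f) (hfc : HasCompactSupport f) (t : ℝ) (q : ℝ × Ed d) (hq : q.1 ∈ Set.Ioo 0 t) :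
    Hk d α η b f g 0 t q = (∫ w, pk d α η q.1 w * g (q.2 - w)) * (∫ w, pk d α η (t - q.1) w * ⟪b q.2, gradient f (q.2 - w)⟫) := by
  unfold Hk
  have h1 : 0 < t - q.1 := by linarith [hq.2]
  simp only [D0, h1, if_true, qs, hq.1]
  rw [G_eq hα1 hd h hf hfc h1]
  congr 1
  rw [← integral_sub_left_eq_self (fun w => pk d α η q.1 w * g (q.2 - w)) volume q.2]
  refine integral_congr_ae (ae_of_all _ fun x => ?_)
  simp only [sub_sub_cancel]
  rw [← pk_neg, neg_sub, mul_comm]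

lemma J1_tendsto (hα1 : 1 < α) (hα2 : α < 2) (hd : 1 ≤ d) (h : IsSub (α/2) η) (hb : Measurable b)
    (hbk : Tendsto (katoSup d α (fun y => ‖b y‖)) (𝓝[>] (0 : ℝ)) (𝓝 0))
    (hf : ContDiff ℝ 1 f) (hfc : HasCompactSupport f) (hg : Continuous g) (hgc : HasCompactSupport g) :
    (∃ C3 : ℝ≥0∞, C3 ≠ ∞ ∧ ∀ T, 0 < T → T ≤ 1 → Uk d α η b g 0 T ≤ C3 * ENNReal.ofReal T) ∧
    Integrable (fun z => ⟪b z, gradient f z⟫ * g z) ∧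
    Tendsto (fun t => t⁻¹ * ∫ q : ℝ × Ed d, Hk d α η b f g 0 t q) (𝓝[>] 0) (𝓝 (∫ z, ⟪b z, gradient f z⟫ * g z)) := by
  have := h.prob
  obtain ⟨Mg, hMg⟩ := hgc.exists_bound_of_continuous hg
  have hgradc : Continuous (gradient f) := (InnerProductSpace.toDual ℝ (Ed d)).symm.continuous.comp (hf.continuous_fderiv one_ne_zero)
  have hgradcs : HasCompactSupport (gradient f) := by
    refine (hfc.fderiv ℝ).comp_left (g := (InnerProductSpace.toDual ℝ (Ed d)).symm) (map_zero _)
  obtain ⟨M, hM⟩ := hgradcs.exists_bound_of_continuous hgradc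
  have hM0 : 0 ≤ M := (norm_nonneg _).trans (hM 0)
  obtain ⟨C, hC, hA⟩ := A0_bound hα1 hα2 hd h g hg.measurable hgc hMg
  have hkb := kato_kw hα1 hα2 hd (fun y => ‖b y‖) (by fun_prop) hbk
  simp only [enorm_norm] at hkb
  have hkm := kw_meas (d := d)
  have hA0 : ∀ s z, s ≤ 1 → Ak d α η b g 0 s z ≤ (Set.Ioi (0:ℝ)).indicator (fun _ => 1) s * (C * kw d z) := by
    intro s z hs1
    rcases le_or_gt s 0 with hs | hs
    · rw [Ak_nonpos 0 hs]; exact bot_le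
    · rw [Set.indicator_of_mem (show s ∈ Set.Ioi (0:ℝ) from hs), one_mul]
      unfold Ak
      simp only [qs, hs, if_true]
      exact hA s hs hs1 z
  set Ψ : Ed d → ℝ≥0∞ := fun z => ENNReal.ofReal M * (C * kw d z * ‖b z‖ₑ) with hΨ
  have hΨm : Measurable Ψ := by fun_prop
  have hΨt : ∀ z, Ψ z ≠ ∞ := fun z => by
    have := kw_ne_top z
    simp only [hΨ]; finiteness
  have hΨfin : ∫⁻ z, Ψ z ≠ ∞ := by
    simp only [hΨ]
    rw [lintegral_const_mul _ (by fun_prop)]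
    simp only [mul_assoc]
    rw [lintegral_const_mul _ (by fun_prop)]
    simp only [mul_comm (kw d _)]
    finiteness
  set Dom : ℝ × Ed d → ℝ≥0∞ := fun q => (Set.Ioo (0:ℝ) 1).indicator (fun _ => 1) q.1 * Ψ q.2 with hDom
  have him : Measurable ((Set.Ioo (0:ℝ) 1).indicator (fun _ => (1:ℝ≥0∞))) := measurable_const.indicator measurableSet_Ioo
  have hDomm : Measurable Dom := by fun_prop
  have hDomfin : ∫⁻ q, Dom q ≠ ∞ := by
    simp only [hDom]
    rw [Measure.volume_eq_prod, lintegral_prod_mul him.aemeasurable hΨm.aemeasurable, lintegral_indicator measurableSet_Ioo]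
    simpa using hΨfin
  have hDomt : ∀ q, Dom q ≠ ∞ := fun q => by
    have := hΨt q.2
    simp only [hDom]
    by_cases hq : q.1 ∈ Set.Ioo (0:ℝ) 1
    · rw [Set.indicator_of_mem hq, one_mul]; exact this
    · rw [Set.indicator_of_notMem hq, zero_mul]; exact ENNReal.zero_ne_top
  have hHb : ∀ t, 0 < t → t ≤ 1 → ∀ q : ℝ × Ed d, ‖Hk d α η b f g 0 t q‖ₑ ≤ (Set.Ioo (0:ℝ) t).indicator (fun _ => 1) q.1 * Ψ q.2 := by
    intro t ht ht1 q
    by_cases hq : q.1 ∈ Set.Ioo 0 t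
    · refine (Hk_bound hα1 hd h hf hfc hM 0 t q).trans ?_
      refine (Set.indicator_le_self _ _ _).trans ?_
      rw [Set.indicator_of_mem hq, one_mul]
      simp only [hΨ]
      gcongr
      refine (hA0 _ _ (hq.2.le.trans ht1)).trans ?_
      rw [Set.indicator_of_mem (show q.1 ∈ Set.Ioi (0:ℝ) from hq.1), one_mul]
    · rw [Hk_zero t q hq]; simp
  refine ⟨⟨∫⁻ z, C * kw d z * ‖b z‖ₑ, ?_, fun T hT hT1 => ?_⟩, ?_, ?_⟩
  · simp only [mul_assoc]
    rw [lintegral_const_mul _ (by fun_prop)]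
    simp only [mul_comm (kw d _)]
    finiteness
  · unfold Uk
    calc _ ≤ ∫⁻ p in (Set.Iic T ×ˢ Set.univ : Set (ℝ × Ed d)), (Set.Ioi (0:ℝ)).indicator (fun _ => 1) p.1 * (C * kw d p.2 * ‖b p.2‖ₑ) := by
          refine setLIntegral_mono' (measurableSet_Iic.prod MeasurableSet.univ) fun p hp => ?_
          rw [← mul_assoc]
          gcongr
          exact hA0 _ _ (le_trans hp.1 hT1)
      _ = _ := by
          have hi2 : Measurable ((Set.Ioi (0:ℝ)).indicator (fun _ => (1:ℝ≥0∞))) := measurable_const.indicator measurableSet_Ioi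
          rw [Measure.volume_eq_prod, ← Measure.prod_restrict, Measure.restrict_univ,
            lintegral_prod_mul (g := fun z => C * kw d z * ‖b z‖ₑ) hi2.aemeasurable (by fun_prop), lintegral_indicator measurableSet_Ioi, mul_comm]
          congr 1
          rw [setLIntegral_const, one_mul, Measure.restrict_apply measurableSet_Ioi]
          rw [Set.Ioi_inter_Iic, Real.volume_Ioc, sub_zero]
  · obtain ⟨Cg, hCg⟩ : ∃ Cg : ℝ≥0∞, Cg ≠ ∞ ∧ ∀ z, ‖g z‖ₑ ≤ Cg * kw d z := by
      have hcont : Continuous (fun z : Ed d => (1 + ‖z‖) ^ ((d:ℝ)+1) * g z) := by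
        refine Continuous.mul ?_ hg
        exact Continuous.rpow_const (by fun_prop) fun z => Or.inr (by positivity)
      obtain ⟨c, hc⟩ := (hgc.mul_left (f := fun z : Ed d => (1 + ‖z‖) ^ ((d:ℝ)+1))).exists_bound_of_continuous hcont
      refine ⟨ENNReal.ofReal c, ENNReal.ofReal_ne_top, fun z => ?_⟩
      have hcz := hc z
      have hc0 : 0 ≤ c := (norm_nonneg _).trans hcz
      unfold kw
      rw [← ofReal_norm, ← ENNReal.ofReal_mul hc0]
      refine ENNReal.ofReal_le_ofReal ?_
      rw [Real.rpow_neg (by positivity), ← div_eq_mul_inv, le_div_iff₀ (by positivity), mul_comm]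
      rw [Pi.mul_apply, norm_mul, Real.norm_of_nonneg (by positivity)] at hcz
      exact hcz
    refine ⟨?_, ?_⟩
    · have hgm := hgradc.measurable
      have hgm' := hg.measurable
      exact ((hb.inner hgm).mul hgm').aestronglyMeasurable
    · refine lt_of_le_of_lt (lintegral_mono (g := fun z => (ENNReal.ofReal M * Cg) * (‖b z‖ₑ * kw d z)) fun z => ?_) ?_
      · rw [enorm_mul]
        calc _ ≤ (‖b z‖ₑ * ENNReal.ofReal M) * (Cg * kw d z) := by
              gcongr
              · rw [← ofReal_norm, ← ofReal_norm, ← ENNReal.ofReal_mul (norm_nonneg _)]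
                exact ENNReal.ofReal_le_ofReal ((norm_inner_le_norm _ _).trans (by gcongr; exact hM z))
              · exact hCg.2 z
          _ = _ := by ring
      · rw [lintegral_const_mul _ (by fun_prop)]
        have := hCg.1
        exact Ne.lt_top (by finiteness)
  · have hHm := fun t => Hk_meas (α := α) (η := η) hb hf.continuous.measurable hg.measurable 0 t
    have hHi : ∀ t, 0 < t → t ≤ 1 → Integrable (Hk d α η b f g 0 t) := by
      intro t ht ht1
      refine ⟨(hHm t).aestronglyMeasurable, lt_of_le_of_lt (lintegral_mono fun q => (hHb t ht ht1 q).trans ?_) hDomfin.lt_top⟩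
      simp only [hDom]
      gcongr
    have hsb : ∀ t, 0 < t → t ≤ 1 → ∀ q : ℝ × Ed d, ‖Hk d α η b f g 0 t (t * q.1, q.2)‖ₑ ≤ Dom q := by
      intro t ht ht1 q
      refine (hHb t ht ht1 _).trans ?_
      simp only [hDom]
      gcongr
      by_cases hq : t * q.1 ∈ Set.Ioo 0 t
      · have : q.1 ∈ Set.Ioo (0:ℝ) 1 := ⟨by have := hq.1; exact pos_of_mul_pos_right this ht.le, by have := hq.2; nlinarith⟩
        rw [Set.indicator_of_mem hq, Set.indicator_of_mem this]
      · rw [Set.indicator_of_notMem hq]; exact bot_le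
    have hsm : ∀ t, Measurable (fun q : ℝ × Ed d => Hk d α η b f g 0 t (t * q.1, q.2)) := fun t => (hHm t).comp (by fun_prop)
    have hsi : ∀ t, 0 < t → t ≤ 1 → Integrable (fun q : ℝ × Ed d => Hk d α η b f g 0 t (t * q.1, q.2)) := by
      intro t ht ht1
      exact ⟨(hsm t).aestronglyMeasurable, lt_of_le_of_lt (lintegral_mono fun q => hsb t ht ht1 q) hDomfin.lt_top⟩
    have hsc : ∀ t, 0 < t → t ≤ 1 → ∫ q : ℝ × Ed d, Hk d α η b f g 0 t (t * q.1, q.2) = t⁻¹ * ∫ q : ℝ × Ed d, Hk d α η b f g 0 t q := by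
      intro t ht ht1
      have e1 := hsi t ht ht1
      have e2 := hHi t ht ht1
      rw [Measure.volume_eq_prod] at e1 e2 ⊢
      rw [integral_prod_symm _ e1, integral_prod_symm _ e2, ← integral_const_mul]
      refine integral_congr_ae (ae_of_all _ fun z => ?_)
      dsimp only
      rw [Measure.integral_comp_mul_left (fun s => Hk d α η b f g 0 t (s, z)) t, abs_of_pos (inv_pos.2 ht), smul_eq_mul]
    have hlim : Tendsto (fun t => ∫ q : ℝ × Ed d, Hk d α η b f g 0 t (t * q.1, q.2)) (𝓝[>] 0)
        (𝓝 (∫ q : ℝ × Ed d, (Set.Ioo (0:ℝ) 1).indicator (fun _ => (1:ℝ)) q.1 * (⟪b q.2, gradient f q.2⟫ * g q.2))) := by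
      have hev : ∀ᶠ t in 𝓝[>] (0:ℝ), 0 < t ∧ t ≤ 1 := by
        filter_upwards [Ioc_mem_nhdsGT (zero_lt_one' ℝ)] with t ht using ht
      refine tendsto_integral_filter_of_dominated_convergence (fun q => (Dom q).toReal) (Eventually.of_forall fun t => (hsm t).aestronglyMeasurable) ?_
        (integrable_toReal_of_lintegral_ne_top hDomm.aemeasurable hDomfin) (ae_of_all _ fun q => ?_)
      · filter_upwards [hev] with t ht
        refine ae_of_all _ fun q => ?_
        have := ENNReal.toReal_mono (hDomt q) (hsb t ht.1 ht.2 q)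
        simpa using this
      · by_cases hq : q.1 ∈ Set.Ioo (0:ℝ) 1
        · rw [Set.indicator_of_mem hq, one_mul, mul_comm]
          have l1 : Tendsto (fun t => t * q.1) (𝓝[>] (0:ℝ)) (𝓝[>] 0) := by
            refine tendsto_nhdsWithin_iff.2 ⟨?_, ?_⟩
            · have : Tendsto (fun t => t * q.1) (𝓝 (0:ℝ)) (𝓝 (0 * q.1)) := (continuous_id.mul continuous_const).tendsto 0
              rw [zero_mul] at this
              exact this.mono_left nhdsWithin_le_nhds
            · filter_upwards [hev] with t ht using mul_pos ht.1 hq.1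
          have l2 : Tendsto (fun t => t - t * q.1) (𝓝[>] (0:ℝ)) (𝓝[>] 0) := by
            refine tendsto_nhdsWithin_iff.2 ⟨?_, ?_⟩
            · have : Tendsto (fun t => t - t * q.1) (𝓝 (0:ℝ)) (𝓝 (0 - 0 * q.1)) := (continuous_id.sub (continuous_id.mul continuous_const)).tendsto 0
              rw [zero_mul, sub_zero] at this
              exact this.mono_left nhdsWithin_le_nhds
            · filter_upwards [hev] with t ht
              have := hq.2
              have := ht.1
              show 0 < t - t * q.1
              nlinarith
          have t1 := (pk_conv_tendsto hα1 h hg hMg q.2).comp l1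
          have t2 := (pk_conv_tendsto hα1 h (k := fun x => ⟪b q.2, gradient f x⟫) (continuous_const.inner hgradc) (C := ‖b q.2‖ * M) (fun x => by
            rw [← Real.norm_eq_abs]
            exact (norm_inner_le_norm _ _).trans (by gcongr; exact hM x)) q.2).comp l2
          refine (t1.mul t2).congr' ?_
          filter_upwards [hev] with t ht
          rw [H0_eq hα1 hd h hf hfc]
          · rfl
          · have := hq.2
            have := hq.1
            have := ht.1
            exact ⟨by dsimp only; positivity, by dsimp only; nlinarith⟩
        · rw [Set.indicator_of_notMem hq, zero_mul]
          refine tendsto_const_nhds.congr' ?_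
          filter_upwards [hev] with t ht
          rw [Hk_zero]
          rintro ⟨h1, h2⟩
          exact hq ⟨pos_of_mul_pos_right h1 ht.1.le, by dsimp only at h2; have := ht.1; nlinarith⟩
    rw [Measure.volume_eq_prod, integral_prod_mul ((Set.Ioo (0:ℝ) 1).indicator (fun _ => (1:ℝ))) (fun z => ⟪b z, gradient f z⟫ * g z),
      integral_indicator measurableSet_Ioo] at hlim
    simp only [integral_const, MeasurableSet.univ, measureReal_restrict_apply, Set.univ_inter, Real.volume_real_Ioo_of_le zero_le_one, sub_zero, smul_eq_mul, one_mul] at hlim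
    refine hlim.congr' ?_
    filter_upwards [Ioc_mem_nhdsGT (zero_lt_one' ℝ)] with t ht
    rw [← Measure.volume_eq_prod, hsc t ht.1 ht.2]

end
end S15

namespace S15
section
variable {d : ℕ} {α : ℝ} {η : Measure ℝ} {b : Ed d → Ed d} {f g : Ed d → ℝ}

lemma Rk_time [SFinite η] (hb : Measurable b) (hf : Measurable f) (hg : Measurable g) (k : ℕ) (T : ℝ) {K : ℝ≥0∞}
    (hK : ∀ z, ∫⁻ y, (∫⁻ r in Set.Ioc (0:ℝ) T, ‖Dk d α η r (z - y)‖ₑ) * ‖f y‖ₑ ≤ K) :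
    ∫⁻ t in Set.Iic T, Rk d α η b f g k t ≤ K * Uk d α η b g k T := by
  have hW := Wk_meas (α := α) (η := η) hb hg k
  refine le_trans (le_of_eq ?_) (Wk_time hb hg k (φ := fun y => ‖f y‖ₑ) (by fun_prop) T hK)
  rw [Measure.volume_eq_prod, setLIntegral_prod _ (by fun_prop), Measure.restrict_univ]
  rfl

lemma Rk_meas [SFinite η] (hb : Measurable b) (hf : Measurable f) (hg : Measurable g) (k : ℕ) : Measurable (Rk d α η b f g k) := by
  have hW := Wk_meas (α := α) (η := η) hb hg k
  unfold Rk
  exact Measurable.lintegral_prod_right' (f := fun q : ℝ × Ed d => Wk d α η b g k q.1 q.2 * ‖f q.2‖ₑ) (by fun_prop)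

lemma grad_bdd (hf : ContDiff ℝ 1 f) (hfc : HasCompactSupport f) : ∃ M : ℝ, ∀ x, ‖gradient f x‖ ≤ M := by
  have hgradc : Continuous (gradient f) := (InnerProductSpace.toDual ℝ (Ed d)).symm.continuous.comp (hf.continuous_fderiv one_ne_zero)
  have hgradcs : HasCompactSupport (gradient f) := by
    refine (hfc.fderiv ℝ).comp_left (g := (InnerProductSpace.toDual ℝ (Ed d)).symm) (map_zero _)
  exact hgradcs.exists_bound_of_continuous hgradc

lemma main_ae (hα1 : 1 < α) (hα2 : α < 2) (hd : 1 ≤ d) (h : IsSub (α/2) η) (hb : Measurable b)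
    (hbk : Tendsto (katoSup d α (fun y => ‖b y‖)) (𝓝[>] (0 : ℝ)) (𝓝 0))
    (hf : ContDiff ℝ 1 f) (hfc : HasCompactSupport f) (hg : Continuous g) (hgc : HasCompactSupport g)
    {T₀ : ℝ} (hT₀ : 0 < T₀) (Q : ℝ → Ed d → Ed d → ℝ)
    (hsum : ∀ t ∈ Set.Ioc (0 : ℝ) T₀, ∀ x y, HasSum (fun k : ℕ => qSeries d α b k t x y) (Q t x y))
    {ε : ℝ} (hε : 0 < ε) :
    ∃ T > 0, ∀ᵐ t : ℝ, t ∈ Set.Ioc 0 T →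
      |(∫ p : Ed d × Ed d, g p.1 * Q t p.1 p.2 * f p.2) - Jk d α η b f g 0 t - ∫ q : ℝ × Ed d, Hk d α η b f g 0 t q| ≤ ε * t := by
  have := h.prob
  obtain ⟨M, hM⟩ := grad_bdd hf hfc
  obtain ⟨Mf, hMf⟩ := hfc.exists_bound_of_continuous hf.continuous
  obtain ⟨⟨C3, hC3, hU0⟩, -, -⟩ := J1_tendsto hα1 hα2 hd h hb hbk hf hfc hg hgc
  have hfm := hf.continuous.measurable
  have hgm := hg.measurable
  set E := ENNReal.ofReal M * 2 * C3 with hE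
  have hEt : E ≠ ∞ := by finiteness
  set δ := min (2⁻¹ : ℝ≥0∞) (ENNReal.ofReal ε / (E + 1)) with hδ
  have hδ0 : 0 < δ := by
    rw [hδ, lt_min_iff]
    exact ⟨by simp, ENNReal.div_pos (by simpa using hε) (by finiteness)⟩
  obtain ⟨T1, hT1, hK1⟩ := kato_small hα1 hα2 hd h (fun y => ‖b y‖) (by fun_prop) hbk hδ0
  simp only [enorm_norm] at hK1
  set T := min T1 (min 1 T₀) with hT
  have hTpos : 0 < T := by rw [hT]; positivity
  have hK : ∀ T' ≤ T, ∀ z, ∫⁻ y, (∫⁻ r in Set.Ioc (0:ℝ) T', ‖Dk d α η r (z - y)‖ₑ) * ‖b y‖ₑ ≤ δ := by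
    intro T' hT' z
    refine le_trans (lintegral_mono fun y => ?_) (hK1 z)
    gcongr
    exact hT'.trans (min_le_left _ _)
  have hU : ∀ t, 0 < t → t ≤ T → ∀ k, Uk d α η b g k t ≤ δ ^ k * (C3 * ENNReal.ofReal t) := by
    intro t ht htT k
    refine (Uk_le hb hgm t (hK t htT) k).trans ?_
    gcongr
    exact hU0 t ht (htT.trans ((min_le_right _ _).trans (min_le_left _ _)))
  have hδh : δ ≤ 2⁻¹ := min_le_left _ _
  have hinv : (1 - δ)⁻¹ ≤ 2 := by
    rw [ENNReal.inv_le_iff_inv_le]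
    calc (2:ℝ≥0∞)⁻¹ = 1 - 2⁻¹ := ENNReal.one_sub_inv_two.symm
      _ ≤ 1 - δ := tsub_le_tsub_left hδh _
  obtain ⟨Kf, hKf, hKfb⟩ := kato_finite hα1 hα2 hd h f hfm hMf T
  have hRsum : ∀ᵐ t ∂(volume.restrict (Set.Iic T)), ∑' k, Rk d α η b f g k t < ∞ := by
    refine ae_lt_top (Measurable.ennreal_tsum fun k => Rk_meas hb hfm hgm k) ?_
    rw [lintegral_tsum fun k => (Rk_meas hb hfm hgm k).aemeasurable]
    have : ∑' k, ∫⁻ t in Set.Iic T, Rk d α η b f g k t ≤ ∑' k, Kf * (δ ^ k * (C3 * ENNReal.ofReal T)) :=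
      ENNReal.tsum_le_tsum fun k => (Rk_time hb hfm hgm k T hKfb).trans (by gcongr; exact hU T hTpos le_rfl k)
    refine ne_top_of_le_ne_top ?_ this
    rw [ENNReal.tsum_mul_left, ENNReal.tsum_mul_right, ENNReal.tsum_geometric]
    have : (1 - δ)⁻¹ ≠ ∞ := ne_top_of_le_ne_top (by finiteness) hinv
    finiteness
  refine ⟨T, hTpos, ?_⟩
  rw [ae_restrict_iff' measurableSet_Iic] at hRsum
  filter_upwards [hRsum] with t htR ht
  have htR := htR ht.2
  have ht0 := ht.1
  have hRk : ∀ k, Rk d α η b f g k t ≠ ∞ := ENNReal.ne_top_of_tsum_ne_top htR.ne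
  have hfi : Integrable f := hf.continuous.integrable_of_hasCompactSupport hfc
  have hgi : Integrable g := hg.integrable_of_hasCompactSupport hgc
  set F : ℕ → Ed d × Ed d → ℝ := fun k p => g p.1 * qs d α η b k t p.1 p.2 * f p.2 with hF
  have hFm : ∀ k, Measurable (F k) := fun k => by
    have h1 := qs_meas' (α := α) (η := η) hb k (X := Ed d × Ed d) (u := fun q => t) (v := fun q => q.1) (w := fun q => q.2) (by fun_prop) (by fun_prop) (by fun_prop)
    simp only [hF]; fun_prop
  have hFi : ∀ k, Integrable (F k) := by
    intro k
    cases k with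
    | zero => exact J0_int hα1 hd h hfi hgi hfm hgm hb t
    | succ k => exact ⟨(hFm _).aestronglyMeasurable, (Jk_lint hb hfm hgm k t).trans_lt (hRk k).lt_top⟩
  have hFs : Summable fun k => ∫ p, ‖F k p‖ := by
    rw [← summable_nat_add_iff 1]
    have e : ∀ k, ∫ p, ‖F (k+1) p‖ ≤ (Rk d α η b f g k t).toReal := by
      intro k
      rw [integral_norm_eq_lintegral_enorm (hFm _).aestronglyMeasurable]
      exact ENNReal.toReal_mono (hRk k) (Jk_lint hb hfm hgm k t)
    exact Summable.of_nonneg_of_le (fun k => integral_nonneg fun p => norm_nonneg _) e (ENNReal.summable_toReal htR.ne)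
  have hS := hasSum_integral_of_summable_integral_norm hFi hFs
  have hQ : ∫ p : Ed d × Ed d, g p.1 * Q t p.1 p.2 * f p.2 = ∫ p, ∑' k, F k p := by
    refine integral_congr_ae (ae_of_all _ fun p => ?_)
    have h1 := hsum t ⟨ht0, ht.2.trans ((min_le_right _ _).trans (min_le_right _ _))⟩ p.1 p.2
    simp only [qs_eq hα1 hd h _ ht0] at h1
    exact (((h1.mul_left (g p.1)).mul_right (f p.2)).tsum_eq).symm
  rw [hQ]
  have hS2 : HasSum (fun k => Jk d α η b f g (k+2) t) ((∫ p, ∑' k, F k p) - Jk d α η b f g 0 t - ∫ q : ℝ × Ed d, Hk d α η b f g 0 t q) := by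
    have := (hasSum_nat_add_iff' 2).2 hS
    rw [Finset.sum_range_succ, Finset.sum_range_one, ← sub_sub] at this
    rw [← Jk_succ hb hfm hgm 0 t (hRk 0)]
    exact this
  have hn : ‖(∫ p, ∑' k, F k p) - Jk d α η b f g 0 t - ∫ q : ℝ × Ed d, Hk d α η b f g 0 t q‖ₑ ≤ ENNReal.ofReal (ε * t) := by
    rw [← hS2.tsum_eq]
    calc _ ≤ ∑' k, ‖Jk d α η b f g (k+2) t‖ₑ := enorm_tsum_le_tsum_enorm
      _ ≤ ∑' k, ENNReal.ofReal M * (δ ^ (k+1) * (C3 * ENNReal.ofReal t)) := by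
          refine ENNReal.tsum_le_tsum fun k => ?_
          refine (Jk_bound hα1 hd h hb hgm hf hfc hM (k+1) t (hRk _)).trans ?_
          gcongr
          exact hU t ht0 ht.2 (k+1)
      _ = ENNReal.ofReal M * ((1 - δ)⁻¹ * δ * (C3 * ENNReal.ofReal t)) := by
          rw [ENNReal.tsum_mul_left, ENNReal.tsum_mul_right]
          simp only [pow_succ]
          rw [ENNReal.tsum_mul_right, ENNReal.tsum_geometric]
      _ ≤ ENNReal.ofReal M * (2 * (ENNReal.ofReal ε / (E + 1)) * (C3 * ENNReal.ofReal t)) := by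
          gcongr
          exact min_le_right _ _
      _ = (E * (ENNReal.ofReal ε / (E + 1))) * ENNReal.ofReal t := by rw [hE]; ring
      _ ≤ ((E + 1) * (ENNReal.ofReal ε / (E + 1))) * ENNReal.ofReal t := by
          gcongr; exact le_self_add
      _ ≤ ENNReal.ofReal ε * ENNReal.ofReal t := by
          gcongr; exact ENNReal.mul_div_le
      _ = _ := by rw [ENNReal.ofReal_mul hε.le]
  rw [← ofReal_norm, ENNReal.ofReal_le_ofReal_iff (by positivity)] at hn
  exact hn

/-- from almost every time to every time -/
lemma ae_to_all {F : ℝ → ℝ} (hF : ContinuousOn F (Set.Ioi 0)) {T c L : ℝ} (hF2 : ∀ᵐ t : ℝ, t ∈ Set.Ioo 0 T → |F t - L| ≤ c) :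
    ∀ t ∈ Set.Ioo 0 T, |F t - L| ≤ c := by
  intro t ht
  by_contra hcon
  push Not at hcon
  have hc : ContinuousAt (fun s => |F s - L|) t := ((hF.continuousAt (Ioi_mem_nhds ht.1)).sub continuousAt_const).abs
  have h1 : ∀ᶠ s in 𝓝 t, c < |F s - L| ∧ s ∈ Set.Ioo 0 T := (hc.eventually (lt_mem_nhds hcon)).and (Ioo_mem_nhds ht.1 ht.2)
  have h2 : ∃ᵐ s : ℝ, s ∈ {s | c < |F s - L| ∧ s ∈ Set.Ioo 0 T} := by
    rw [frequently_ae_mem_iff]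
    exact (Measure.measure_pos_of_mem_nhds volume h1).ne'
  obtain ⟨s, hs, hs2⟩ := (h2.and_eventually hF2).exists
  exact absurd (hs2 hs.2) (not_le.2 hs.1)

lemma main_thm (hα1 : 1 < α) (hα2 : α < 2) (hd : 1 ≤ d) (hb : Measurable b)
    (hbk : Tendsto (katoSup d α (fun y => ‖b y‖)) (𝓝[>] (0 : ℝ)) (𝓝 0))
    (hf : ContDiff ℝ (⊤ : ℕ∞) f) (hfc : HasCompactSupport f) (hg : Continuous g) (hgc : HasCompactSupport g)
    {T₀ : ℝ} (hT₀ : 0 < T₀) (Q : ℝ → Ed d → Ed d → ℝ)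
    (hsum : ∀ t ∈ Set.Ioc (0 : ℝ) T₀, ∀ x y, HasSum (fun k : ℕ => qSeries d α b k t x y) (Q t x y))
    (hcont : ContinuousOn (fun p : ℝ × Ed d × Ed d => Q p.1 p.2.1 p.2.2) (Set.Ioi 0 ×ˢ (Set.univ ×ˢ Set.univ))) :
    Tendsto (fun t : ℝ => t⁻¹ * ∫ x, ((∫ y, Q t x y * f y) - f x) * g x)
      (𝓝[>] (0 : ℝ)) (𝓝 (∫ x, (fracLap d α f x + ⟪b x, gradient f x⟫) * g x)) := by
  obtain ⟨η, hη1, hη2, hη3⟩ := exists_subordinator (β := α/2) (by linarith) (by linarith)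
  have h : IsSub (α/2) η := ⟨hη1, hη2, hη3⟩
  have hf1 : ContDiff ℝ 1 f := hf.of_le (by exact_mod_cast le_top)
  have hfi : Integrable f := hf.continuous.integrable_of_hasCompactSupport hfc
  have hgi : Integrable g := hg.integrable_of_hasCompactSupport hgc
  have hfgi : Integrable (fun x => f x * g x) := (hf.continuous.mul hg).integrable_of_hasCompactSupport (hgc.mul_left)
  have hfm := hf.continuous.measurable
  have hgm := hg.measurable
  obtain ⟨gi, gt⟩ := gen_tendsto hα1 hα2 hd h hf hfc hgi
  obtain ⟨-, ji, jt⟩ := J1_tendsto hα1 hα2 hd h hb hbk hf1 hfc hg hgc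
  have hL : ∫ x, (fracLap d α f x + ⟪b x, gradient f x⟫) * g x = (∫ x, fracLap d α f x * g x) + ∫ x, ⟪b x, gradient f x⟫ * g x := by
    rw [← integral_add gi ji]
    simp only [add_mul]
  rw [hL]
  set N : ℝ → ℝ := fun t => ∫ p : Ed d × Ed d, g p.1 * Q t p.1 p.2 * f p.2 with hN
  have hQc : ContinuousOn (Function.uncurry fun (t : ℝ) (p : Ed d × Ed d) => g p.1 * Q t p.1 p.2 * f p.2) (Set.Ioi 0 ×ˢ Set.univ) := by
    have e : ContinuousOn (fun p : ℝ × Ed d × Ed d => Q p.1 p.2.1 p.2.2) (Set.Ioi 0 ×ˢ Set.univ) := by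
      rwa [Set.univ_prod_univ] at hcont
    have c1 : Continuous (fun p : ℝ × Ed d × Ed d => g p.2.1) := by fun_prop
    have c2 : Continuous (fun p : ℝ × Ed d × Ed d => f p.2.2) := hf.continuous.comp (by fun_prop)
    exact (c1.continuousOn.mul e).mul c2.continuousOn
  have hz : ∀ (t : ℝ) (p : Ed d × Ed d), p ∉ tsupport g ×ˢ tsupport f → g p.1 * Q t p.1 p.2 * f p.2 = 0 := by
    intro t p hp
    rw [Set.mem_prod, not_and_or] at hp
    rcases hp with hp | hp
    · rw [image_eq_zero_of_notMem_tsupport hp]; simp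
    · rw [image_eq_zero_of_notMem_tsupport hp]; simp
  have hKc : IsCompact (tsupport g ×ˢ tsupport f) := hgc.isCompact.prod hfc.isCompact
  have hNc : ContinuousOn N (Set.Ioi 0) :=
    continuousOn_integral_of_compact_support hKc hQc (fun t p _ hp => hz t p hp)
  have hNe : ∀ t, 0 < t → ∫ x, ((∫ y, Q t x y * f y) - f x) * g x = N t - ∫ x, f x * g x := by
    intro t ht
    have hc : Continuous (fun p : Ed d × Ed d => g p.1 * Q t p.1 p.2 * f p.2) := by
      rw [← continuousOn_univ]
      exact hQc.comp (f := fun p : Ed d × Ed d => (t, p)) (by fun_prop) (fun p _ => ⟨ht, trivial⟩)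
    have hi : Integrable (fun p : Ed d × Ed d => g p.1 * Q t p.1 p.2 * f p.2) (volume.prod volume) :=
      hc.integrable_of_hasCompactSupport (HasCompactSupport.intro hKc (hz t))
    have e : ∀ x, ∫ y, g x * Q t x y * f y = (∫ y, Q t x y * f y) * g x := by
      intro x
      rw [mul_comm, ← integral_const_mul]
      simp only [mul_assoc]
    have hi2 : Integrable (fun x => (∫ y, Q t x y * f y) * g x) := by
      simpa only [e] using hi.integral_prod_left
    simp only [hN]
    rw [Measure.volume_eq_prod, integral_prod _ hi]
    simp only [e]
    rw [← integral_sub hi2 hfgi]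
    simp only [sub_mul]
  set L := (∫ x, fracLap d α f x * g x) + ∫ x, ⟪b x, gradient f x⟫ * g x with hLdef
  set Z : ℝ → ℝ := fun t => t⁻¹ * (N t - ∫ x, f x * g x) with hZ
  have hZc : ContinuousOn Z (Set.Ioi 0) := by
    refine ContinuousOn.mul (continuousOn_inv₀.mono fun t ht => ?_) (hNc.sub continuousOn_const)
    exact ne_of_gt ht
  have hZt : Tendsto Z (𝓝[>] 0) (𝓝 L) := by
    rw [Metric.tendsto_nhds]
    intro ε hε
    obtain ⟨T1, hT1, hae⟩ := main_ae hα1 hα2 hd h hb hbk hf1 hfc hg hgc hT₀ Q hsum (show 0 < ε/4 by positivity)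
    have hcomb := (Metric.tendsto_nhds.1 gt (ε/4) (by positivity)).and (Metric.tendsto_nhds.1 jt (ε/4) (by positivity))
    obtain ⟨T2, hT2, hTs⟩ := mem_nhdsGT_iff_exists_Ioo_subset.1 hcomb
    have key : ∀ t ∈ Set.Ioo 0 (min T1 T2), |Z t - L| ≤ 3 * ε / 4 := by
      refine ae_to_all hZc ?_
      filter_upwards [hae] with t hta ht
      have ht0 : 0 < t := ht.1
      have h1 := hta ⟨ht.1, ht.2.le.trans (min_le_left _ _)⟩
      obtain ⟨h2, h3⟩ := hTs ⟨ht.1, ht.2.trans_le (min_le_right _ _)⟩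
      obtain ⟨pi, pe⟩ := J0_eq (b := b) hα1 hd h hfi hgi hfm hgm hb ht0
      have e0 : ∫ x, ((∫ w, pk d α η t w * f (x - w)) - f x) * g x = Jk d α η b f g 0 t - ∫ x, f x * g x := by
        rw [pe, ← integral_sub pi hfgi]
        simp only [sub_mul]
      rw [Real.dist_eq, e0] at h2
      rw [Real.dist_eq] at h3
      set J0 := Jk d α η b f g 0 t
      set J1 := ∫ q : ℝ × Ed d, Hk d α η b f g 0 t q
      have h4 : |t⁻¹ * (N t - J0 - J1)| ≤ ε / 4 := by
        rw [abs_mul, abs_of_pos (inv_pos.2 ht0), inv_mul_le_iff₀ ht0, mul_comm]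
        exact h1
      have e1 : Z t - L = t⁻¹ * (N t - J0 - J1) + (t⁻¹ * (J0 - ∫ x, f x * g x) - ∫ x, fracLap d α f x * g x) + (t⁻¹ * J1 - ∫ x, ⟪b x, gradient f x⟫ * g x) := by
        simp only [hZ, hLdef]; ring
      rw [e1]
      refine (abs_add_three _ _ _).trans ?_
      linarith
    filter_upwards [Ioo_mem_nhdsGT (show (0:ℝ) < min T1 T2 from lt_min hT1 hT2)] with t ht
    rw [Real.dist_eq]
    have := key t ht
    linarith
  refine hZt.congr' ?_
  filter_upwards [self_mem_nhdsWithin] with t ht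
  simp only [hZ]
  rw [hNe t ht]

end
end S15

/-- for the fundamental solution `Q = q^b` from the perturbation
construction (extended by Chapman–Kolmogorov), and `T_t^b f(x) = ∫ Q(t,x,y)f(y) dy`,
one has `(1/t)∫(T_t^b f - f)g dx → ∫(Δ^{α/2}f + b·∇f)g dx` as `t ↓ 0`, for all
`f, g ∈ C_c^∞`. -/
theorem stmt15 (d : ℕ) (hd : 1 ≤ d) (α : ℝ) (hα1 : 1 < α) (hα2 : α < 2)
    (b : EuclideanSpace ℝ (Fin d) → EuclideanSpace ℝ (Fin d)) (hbm : Measurable b)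
    (hb : Tendsto (katoSup d α (fun y => ‖b y‖)) (𝓝[>] (0 : ℝ)) (𝓝 0))
    (T₀ c₁ : ℝ) (hT₀ : 0 < T₀) (hc₁ : 1 < c₁)
    (Q : ℝ → EuclideanSpace ℝ (Fin d) → EuclideanSpace ℝ (Fin d) → ℝ)
    -- `Q` is the sum of the perturbation series on `(0,T₀]`:
    (hsum : ∀ t ∈ Set.Ioc (0 : ℝ) T₀, ∀ x y,
      HasSum (fun k : ℕ => qSeries d α b k t x y) (Q t x y))
    (hbd : ∀ t ∈ Set.Ioc (0 : ℝ) T₀, ∀ x y,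
      ENNReal.ofReal c₁⁻¹ * heatBnd d α t x y ≤ ENNReal.ofReal (Q t x y) ∧
      ENNReal.ofReal (Q t x y) ≤ ENNReal.ofReal c₁ * heatBnd d α t x y)
    -- extended to all `t > 0` as a jointly continuous Chapman–Kolmogorov kernel:
    (hcont : ContinuousOn
      (fun p : ℝ × EuclideanSpace ℝ (Fin d) × EuclideanSpace ℝ (Fin d) => Q p.1 p.2.1 p.2.2)
      (Set.Ioi 0 ×ˢ (Set.univ ×ˢ Set.univ)))
    (hpos : ∀ t : ℝ, 0 < t → ∀ x y, 0 < Q t x y)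
    (hmass : ∀ t : ℝ, 0 < t → ∀ x, ∫ z, Q t x z = 1)
    (hck : ∀ s t : ℝ, 0 < s → 0 < t → ∀ x y, Q (s + t) x y = ∫ z, Q s x z * Q t z y)
    (f g : EuclideanSpace ℝ (Fin d) → ℝ)
    (hf : ContDiff ℝ (⊤ : ℕ∞) f) (hfc : HasCompactSupport f)
    (hg : ContDiff ℝ (⊤ : ℕ∞) g) (hgc : HasCompactSupport g) :
    Tendsto (fun t : ℝ => t⁻¹ * ∫ x, ((∫ y, Q t x y * f y) - f x) * g x)
      (𝓝[>] (0 : ℝ))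
      (𝓝 (∫ x, (fracLap d α f x + ⟪b x, gradient f x⟫) * g x)) := by
  exact S15.main_thm hα1 hα2 hd hbm hb hf hfc hg.continuous hgc hT₀ Q hsum hcont
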